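/- Let Ω_n ⊂ ℝ³ be Borel sets of finite perimeter with |Ω_n| → m > 0 and I[Ω_n]/|Ω_n| → μ*. Then there exist an integer K ≥ 1, Borel sets Ω_*^{(1)},…,Ω_*^{(K)} ⊂ ℝ³ of finite positive measures m_*^{(j)} := |Ω_*^{(j)}|, sequences a_n^{(j)} ∈ ℝ³ with |a_n^{(j)} − a_n^{(k)}| → ∞ for j ≠ k, and a constant R > 0 such that, after passing to a subsequence: (i) each Ω_*^{(j)} is a minimizer, i.e. I[Ω_*^{(j)}] = μ* m_*^{(j)}, and in particular m_*^{(j)} ∈ [m**, m*]; (ii) for every j, the characteristic functions of (Ω_n − a_n^{(j)}) ∩ B(0,R) converge in L¹(ℝ³) to the characteristic function of Ω_*^{(j)}; (iii) |Ω_n ∖ ⋃_{j=1}^K B(a_n^{(j)},R)| → 0 and Per(Ω_n ∖ ⋃_{j=1}^K B(a_n^{(j)},R)) → 0, hence m = Σ_{j=1}^K m_*^{(j)}; (iv) if K ≥ 2, then I[Ω_n] ≥ μ*|Ω_n| + Σ_{1≤j<k≤K} (m_*^{(j)} m_*^{(k)} + o(1))/|a_n^{(j)} − a_n^{(k)}|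 as n → ∞. -/

import Mathlib

open MeasureTheory Metric Set Filter Bornology
open scoped Topology ENNReal NNReal Pointwise

noncomputable section

/-- Three-dimensional Euclidean space. -/
abbrev E3 : Type := EuclideanSpace ℝ (Fin 3)

/-- The divergence of a vector field on `E3`, defined as the trace of its derivative. -/
def divg (φ : E3 → E3) (x : E3) : ℝ :=
  LinearMap.trace ℝ E3 (fderiv ℝ φ x : E3 →ₗ[ℝ] E3)

/-- The candidate values `∫_Ω div φ` over `C¹` compactly supported vector fields bounded by one. -/
def perCand (Ω : Set E3) : Set ℝ :=
  {a : ℝ | ∃ φ : E3 → E3, ContDiff ℝ 1 φ ∧ HasCompactSupport φ ∧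
      (∀ x, ‖φ x‖ ≤ 1) ∧ a = ∫ x in Ω, divg φ x}

/-- The perimeter of a set, in the sense of geometric measure theory. -/
def per (Ω : Set E3) : ℝ := sSup (perCand Ω)

/-- A set has finite perimeter if the family of integrals defining the perimeter is
bounded above. -/
def HasFinPer (Ω : Set E3) : Prop := BddAbove (perCand Ω)

/-- The Lebesgue volume of a set as a real number. -/
def vol (Ω : Set E3) : ℝ := (volume Ω).toReal

/-- The liquid drop energy `𝓔_Λ[ρ,Ω]`. -/
def ldEnergy (Λ : Set E3) (ρ : ℝ) (Ω : Set E3) : ℝ :=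
  per Ω + (1/2) * ∫ x, ∫ y,
    (Set.indicator Ω (fun _ => (1:ℝ)) x - ρ * Set.indicator Λ (fun _ => (1:ℝ)) x) *
      (Set.indicator Ω (fun _ => (1:ℝ)) y - ρ * Set.indicator Λ (fun _ => (1:ℝ)) y) / ‖x - y‖

/-- The neutral ground state energy `E_Λ(ρ)`. -/
def EE (Λ : Set E3) (ρ : ℝ) : ℝ :=
  sInf {t : ℝ | ∃ Ω : Set E3, MeasurableSet Ω ∧ Ω ⊆ Λ ∧ HasFinPer Ω ∧
    vol Ω = ρ * vol Λ ∧ t = ldEnergy Λ ρ Ω}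

/-- The liquid drop energy `I[Ω]` of an isolated droplet (no background). -/
def II (Ω : Set E3) : ℝ :=
  per Ω + (1/2) * ∫ x in Ω, ∫ y in Ω, 1 / ‖x - y‖

/-- `μ* = inf I[Ω]/|Ω|`. -/
def muStar : ℝ :=
  sInf {t : ℝ | ∃ Ω : Set E3, MeasurableSet Ω ∧ HasFinPer Ω ∧
    0 < volume Ω ∧ volume Ω < ⊤ ∧ t = II Ω / vol Ω}

/-- A minimizer for the isolated liquid drop problem. -/
def IsMinimizer (Ω : Set E3) : Prop :=
  MeasurableSet Ω ∧ HasFinPer Ω ∧ 0 < volume Ω ∧ volume Ω < ⊤ ∧ II Ω = muStar * vol Ω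

/-- The set of masses of minimizers. -/
def minimizerMasses : Set ℝ := {m : ℝ | ∃ Ω : Set E3, IsMinimizer Ω ∧ m = vol Ω}

/-- The largest mass of a minimizer. -/
def mStar : ℝ := sSup minimizerMasses

/-- The smallest mass of a minimizer. -/
def mStarStar : ℝ := sInf minimizerMasses

/-- `Λ` is an `(r,L)`-Lipschitz open set: near each boundary point it is, in a suitable
orthonormal coordinate system, the epigraph of an `L`-Lipschitz function. -/
def IsLipschitzDomain (r L : ℝ) (Λ : Set E3) : Prop :=
  ∀ x ∈ frontier Λ, ∃ (g : E3 ≃ᵢ E3) (f : ℝ × ℝ → ℝ),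
    LipschitzWith L.toNNReal f ∧
    Λ ∩ ball x r = {y ∈ ball x r | f (g y 0, g y 1) < g y 2}

/-- Fisher regularity of the boundary. -/
def FisherCond (C ℓ : ℝ) (Λ : Set E3) : Prop :=
  ∀ h : ℝ, 0 < h → h ≤ ℓ → (volume (frontier Λ + ball (0:E3) h)).toReal ≤ C * ℓ^2 * h

/-- An admissible sequence of domains for the thermodynamic limit. -/
def IsAdmissibleSeq (r L C : ℝ) (Λs : ℕ → Set E3) (ℓ : ℕ → ℝ) : Prop :=
  Tendsto ℓ atTop atTop ∧
  ∀ n : ℕ, IsOpen (Λs n) ∧ IsBounded (Λs n) ∧ IsLipschitzDomain r L (Λs n) ∧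
    ball 0 (ℓ n / C) ⊆ Λs n ∧ Λs n ⊆ ball 0 (ℓ n) ∧ FisherCond C (ℓ n) (Λs n)

/-- `e` is the thermodynamic limit function of the liquid drop model. -/
def IsThermoLimit (e : ℝ → ℝ) : Prop :=
  ∀ ρ : ℝ, 0 ≤ ρ → ρ ≤ 1 →
    ∀ (r L C : ℝ) (Λs : ℕ → Set E3) (ℓ : ℕ → ℝ), 0 < r → 0 < L → 0 < C →
      IsAdmissibleSeq r L C Λs ℓ →
      Tendsto (fun n => EE (Λs n) ρ / vol (Λs n)) atTop (𝓝 (e ρ))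

/-- The domain for the `N`-particle Jellium problem: `N^{1/3} Λ₁` with `Λ₁` the ball of
unit volume centered at the origin. -/
def jelDomain (N : ℕ) : Set E3 :=
  ball (0:E3) ((N : ℝ) ^ ((1:ℝ)/3) * (3 / (4 * Real.pi)) ^ ((1:ℝ)/3))

/-- The `N`-particle Jellium ground state energy. -/
def jelN (N : ℕ) : ℝ :=
  sInf {t : ℝ | ∃ x : Fin N → E3, (∀ j, x j ∈ jelDomain N) ∧
    t = (∑ j : Fin N, ∑ k : Fin N, if j < k then 1 / ‖x j - x k‖ else 0)
      - (∑ j : Fin N, ∫ y in jelDomain N, 1 / ‖x j - y‖)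
      + (1/2) * ∫ x' in jelDomain N, ∫ y in jelDomain N, 1 / ‖x' - y‖}

/-- `eJ` is the Jellium energy per particle in the thermodynamic limit. -/
def IsJelliumLimit (eJ : ℝ) : Prop :=
  Tendsto (fun N : ℕ => jelN N / (N : ℝ)) atTop (𝓝 eJ)

/-- The grand-canonical liquid drop energy `F_Λ(ρ)`. -/
def FF (Λ : Set E3) (ρ : ℝ) : ℝ :=
  sInf {t : ℝ | ∃ Ω : Set E3, MeasurableSet Ω ∧ Ω ⊆ Λ ∧ HasFinPer Ω ∧
    t = ldEnergy Λ ρ Ω - muStar * vol Ω}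

/-- A tetrahedron: the interior of the convex hull of four affinely independent points. -/
def IsTetra (Δ : Set E3) : Prop :=
  ∃ v : Fin 4 → E3, AffineIndependent ℝ v ∧ Δ = interior (convexHull ℝ (Set.range v))

/-- The open cube `(-L/2, L/2)³`. -/
def cubeL (Lside : ℝ) : Set E3 := {x : E3 | ∀ i, |x i| < Lside / 2}

/-- The grand-canonical Jellium energy of point particles of charge `m` in the domain `S`
with a uniform background of density one. -/
def pointJellium (m : ℝ) (S : Set E3) : ℝ :=
  sInf {t : ℝ | ∃ (n : ℕ) (x : Fin n → E3), (∀ j, x j ∈ S) ∧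
    t = (∑ j : Fin n, ∑ k : Fin n, if j < k then m^2 / ‖x j - x k‖ else 0)
      - m * (∑ j : Fin n, ∫ y in S, 1 / ‖x j - y‖)
      + (1/2) * ∫ x' in S, ∫ y in S, 1 / ‖x' - y‖}

/-- The conclusions of the decomposition theorem for minimizing sequences. -/
def IsDecomp (Ω : ℕ → Set E3) (m : ℝ) (K : ℕ) (Ωs : Fin K → Set E3)
    (a : ℕ → Fin K → E3) (R : ℝ) (φ : ℕ → ℕ) : Prop :=
  StrictMono φ ∧ 0 < R ∧
  (∀ j k : Fin K, j ≠ k → Tendsto (fun n => ‖a n j - a n k‖) atTop atTop) ∧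
  (∀ j, IsMinimizer (Ωs j)) ∧
  (∀ j, mStarStar ≤ vol (Ωs j) ∧ vol (Ωs j) ≤ mStar) ∧
  (∀ j, Tendsto
    (fun n => volume (symmDiff ({x : E3 | x + a n j ∈ Ω (φ n)} ∩ ball (0:E3) R) (Ωs j)))
    atTop (𝓝 0)) ∧
  Tendsto (fun n => volume (Ω (φ n) \ ⋃ j, ball (a n j) R)) atTop (𝓝 0) ∧
  Tendsto (fun n => per (Ω (φ n) \ ⋃ j, ball (a n j) R)) atTop (𝓝 0) ∧
  m = ∑ j, vol (Ωs j) ∧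
  (2 ≤ K → ∃ ε : ℕ → ℝ, Tendsto ε atTop (𝓝 0) ∧ ∀ n : ℕ,
    muStar * vol (Ω (φ n)) +
      (∑ j : Fin K, ∑ k : Fin K,
        if j < k then (vol (Ωs j) * vol (Ωs k) + ε n) / ‖a n j - a n k‖ else 0)
      ≤ II (Ω (φ n)))

instance : MeasurableSpace (Matrix (Fin 3) (Fin 3) ℝ) :=
  (inferInstance : MeasurableSpace (Fin 3 → Fin 3 → ℝ))

/-- The rotation group SO(3), as a set of matrices. -/
def SO3 : Set (Matrix (Fin 3) (Fin 3) ℝ) := {R | R * R.transpose = 1 ∧ R.det = 1}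

/-- The action of a matrix on Euclidean space. -/
def rot (R : Matrix (Fin 3) (Fin 3) ℝ) (x : E3) : E3 :=
  (EuclideanSpace.equiv (Fin 3) ℝ).symm (R.mulVec (EuclideanSpace.equiv (Fin 3) ℝ x))

/-- The image of a set under the rigid motion `x ↦ Rx + τ`. -/
def rigidImage (R : Matrix (Fin 3) (Fin 3) ℝ) (τ : E3) (S : Set E3) : Set E3 :=
  (fun x => rot R x + τ) '' S

/-- `μ` is the normalized Haar measure of SO(3): a probability measure concentrated on SO(3)
which is invariant under left multiplication by rotations. -/
def IsHaarSO3 (μ : Measure (Matrix (Fin 3) (Fin 3) ℝ)) : Prop :=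
  IsProbabilityMeasure μ ∧ μ SO3ᶜ = 0 ∧ ∀ S ∈ SO3, Measure.map (fun R => S * R) μ = μ

/-- The cube of the tiling of side length `ε` indexed by `z ∈ ℤ³`. -/
def cubeZ (ε : ℝ) (z : Fin 3 → ℤ) : Set E3 := {x : E3 | ∀ i, |x i - ε * (z i : ℝ)| < ε / 2}

/-- The distance between two sets. -/
def setDist (s t : Set E3) : ℝ := sInf {d : ℝ | ∃ p ∈ s, ∃ q ∈ t, d = dist p q}

/-- The outer cubic boundary layer of `Λ` at scale `ε`. -/
def outerLayer (Λ : Set E3) (ε : ℝ) : Set E3 :=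
  ⋃ z ∈ {z : Fin 3 → ℤ | setDist (cubeZ ε z) (frontier Λ) ≤ ε}, closure (cubeZ ε z \ Λ)

/-! ### Basic facts on the divergence and the perimeter -/

lemma divg_continuous {φ : E3 → E3} (h : ContDiff ℝ 1 φ) : Continuous (divg φ) := by
  have h1 : Continuous (fderiv ℝ φ) := h.continuous_fderiv one_ne_zero
  have h2 : Continuous (fun L : E3 →L[ℝ] E3 => LinearMap.trace ℝ E3 (L : E3 →ₗ[ℝ] E3)) :=
    LinearMap.continuous_of_finiteDimensional
      ((LinearMap.trace ℝ E3).comp (ContinuousLinearMap.coeLM ℝ))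
  exact h2.comp h1

lemma divg_compact {φ : E3 → E3} (hc : HasCompactSupport φ) : HasCompactSupport (divg φ) := by
  have := hc.fderiv (𝕜 := ℝ)
  exact this.comp_left (g := fun L : E3 →L[ℝ] E3 => LinearMap.trace ℝ E3 (L : E3 →ₗ[ℝ] E3))
    (by simp)

lemma divg_integrable {φ : E3 → E3} (h : ContDiff ℝ 1 φ) (hc : HasCompactSupport φ) :
    Integrable (divg φ) volume :=
  (divg_continuous h).integrable_of_hasCompactSupport (divg_compact hc)

lemma divg_bdd {φ : E3 → E3} (h : ContDiff ℝ 1 φ) (hc : HasCompactSupport φ) :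
    ∃ C, 0 ≤ C ∧ ∀ x, |divg φ x| ≤ C := by
  obtain ⟨C, hC⟩ := (divg_compact hc).exists_bound_of_continuous (divg_continuous h)
  exact ⟨C, (norm_nonneg _).trans (hC 0), hC⟩

lemma divg_add {φ ψ : E3 → E3} {x : E3} (h1 : DifferentiableAt ℝ φ x)
    (h2 : DifferentiableAt ℝ ψ x) : divg (fun y => φ y + ψ y) x = divg φ x + divg ψ x := by
  unfold divg
  rw [fderiv_fun_add h1 h2]
  simp

lemma divg_smul {η : E3 → ℝ} {φ : E3 → E3} {x : E3} (h1 : DifferentiableAt ℝ η x)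
    (h2 : DifferentiableAt ℝ φ x) :
    divg (fun y => η y • φ y) x = η x * divg φ x + fderiv ℝ η x (φ x) := by
  unfold divg
  rw [fderiv_fun_smul h1 h2]
  have : ((η x • fderiv ℝ φ x + (fderiv ℝ η x).smulRight (φ x) : E3 →L[ℝ] E3) : E3 →ₗ[ℝ] E3)
      = η x • (fderiv ℝ φ x : E3 →ₗ[ℝ] E3) +
        ((fderiv ℝ η x : E3 →ₗ[ℝ] ℝ)).smulRight (φ x) := by
    ext y; simp
  rw [this, map_add, map_smul, LinearMap.trace_smulRight]
  simp

lemma divg_comp_add (φ : E3 → E3) (c x : E3) : divg (fun y => φ (y + c)) x = divg φ (x + c) := by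
  unfold divg
  rw [fderiv_comp_add_right]

lemma zero_mem_perCand (Ω : Set E3) : (0:ℝ) ∈ perCand Ω := by
  refine ⟨fun _ => 0, contDiff_const, HasCompactSupport.zero, by simp, ?_⟩
  have : divg (fun _ : E3 => (0:E3)) = fun _ => 0 := by
    ext x; simp [divg]
  simp [this]

lemma per_nonneg (Ω : Set E3) : 0 ≤ per Ω := by
  by_cases h : BddAbove (perCand Ω)
  · exact le_csSup h (zero_mem_perCand Ω)
  · rw [per, Real.sSup_of_not_bddAbove h]

lemma le_per {Ω : Set E3} (h : HasFinPer Ω) {φ : E3 → E3} (h1 : ContDiff ℝ 1 φ)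
    (h2 : HasCompactSupport φ) (h3 : ∀ x, ‖φ x‖ ≤ 1) : ∫ x in Ω, divg φ x ≤ per Ω :=
  le_csSup h ⟨φ, h1, h2, h3, rfl⟩

lemma per_le_of {Ω : Set E3} {c : ℝ} (h : ∀ φ : E3 → E3, ContDiff ℝ 1 φ → HasCompactSupport φ →
    (∀ x, ‖φ x‖ ≤ 1) → ∫ x in Ω, divg φ x ≤ c) : HasFinPer Ω ∧ per Ω ≤ c := by
  have : c ∈ upperBounds (perCand Ω) := by
    rintro a ⟨φ, h1, h2, h3, rfl⟩
    exact h φ h1 h2 h3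
  exact ⟨⟨c, this⟩, csSup_le ⟨0, zero_mem_perCand Ω⟩ this⟩

/-- The translated set `Ω - c`. -/
def tr (c : E3) (Ω : Set E3) : Set E3 := {x : E3 | x + c ∈ Ω}

lemma tr_meas {Ω : Set E3} (h : MeasurableSet Ω) (c : E3) : MeasurableSet (tr c Ω) :=
  (measurable_add_const c) h

lemma tr_volume (Ω : Set E3) (c : E3) : volume (tr c Ω) = volume Ω :=
  measure_preimage_add_right volume c Ω

lemma tr_integral (Ω : Set E3) (c : E3) (f : E3 → ℝ) :
    ∫ x in tr c Ω, f (x + c) = ∫ x in Ω, f x := by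
  have h1 := measurePreserving_add_right (volume : Measure E3) c
  exact h1.setIntegral_preimage_emb (measurableEmbedding_addRight c) f Ω

lemma tr_perCand (Ω : Set E3) (c : E3) : perCand (tr c Ω) = perCand Ω := by
  have key : ∀ (Ω : Set E3) (c : E3), perCand Ω ⊆ perCand (tr c Ω) := by
    rintro Ω c a ⟨φ, h1, h2, h3, rfl⟩
    refine ⟨fun x => φ (x + c), h1.comp (contDiff_id.add contDiff_const), ?_, fun x => h3 _, ?_⟩
    · exact h2.comp_homeomorph (Homeomorph.addRight c)
    · simp_rw [divg_comp_add]
      exact (tr_integral Ω c _).symm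
  refine Subset.antisymm ?_ (key Ω c)
  have := key (tr c Ω) (-c)
  have e : tr (-c) (tr c Ω) = Ω := by ext x; simp [tr]
  rwa [e] at this

lemma tr_per (Ω : Set E3) (c : E3) : per (tr c Ω) = per Ω := by rw [per, per, tr_perCand]

lemma tr_finPer {Ω : Set E3} (h : HasFinPer Ω) (c : E3) : HasFinPer (tr c Ω) := by
  rw [HasFinPer, tr_perCand]; exact h

/-! ### Translation estimate -/

lemma per_bound_dir {Ω : Set E3} (h : HasFinPer Ω) {φ : E3 → ℝ} (h1 : ContDiff ℝ 1 φ)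
    (h2 : HasCompactSupport φ) (h3 : ∀ x, |φ x| ≤ 1) (v : E3) :
    ∫ x in Ω, fderiv ℝ φ x v ≤ ‖v‖ * per Ω := by
  rcases eq_or_ne v 0 with rfl | hv
  · simp
  have hv' : 0 < ‖v‖ := norm_pos_iff.2 hv
  set w : E3 := (‖v‖⁻¹) • v with hw
  have hw1 : ‖w‖ = 1 := by rw [hw, norm_smul, norm_inv, norm_norm]; field_simp
  have := le_per h (φ := fun x => φ x • w) (h1.smul contDiff_const)
    (h2.smul_right) (by intro x; rw [norm_smul, hw1, mul_one]; exact h3 x)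
  have e : ∀ x, divg (fun x => φ x • w) x = ‖v‖⁻¹ * fderiv ℝ φ x v := by
    intro x
    rw [divg_smul (h1.differentiable one_ne_zero x) (differentiableAt_const _)]
    simp [divg, hw]
  simp_rw [e] at this
  rw [integral_const_mul] at this
  calc _ = ‖v‖ * (‖v‖⁻¹ * ∫ x in Ω, fderiv ℝ φ x v) := by field_simp
    _ ≤ _ := by gcongr

lemma per_bound_trans {Ω : Set E3} (hΩ : MeasurableSet Ω) (hf : volume Ω < ⊤) (h : HasFinPer Ω)
    {φ : E3 → ℝ} (h1 : ContDiff ℝ 1 φ)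
    (h2 : HasCompactSupport φ) (h3 : ∀ x, |φ x| ≤ 1) (v : E3) :
    (∫ x in Ω, φ (x + v)) - ∫ x in Ω, φ x ≤ ‖v‖ * per Ω := by
  haveI : IsFiniteMeasure (volume.restrict Ω) := ⟨by simpa using hf⟩
  have hcd : Continuous (fderiv ℝ φ) := h1.continuous_fderiv one_ne_zero
  obtain ⟨C, hC⟩ := (h2.fderiv (𝕜 := ℝ)).exists_bound_of_continuous hcd
  have hder : ∀ t : ℝ, HasDerivAt (fun t : ℝ => ∫ x in Ω, φ (x + t • v))
      (∫ x in Ω, fderiv ℝ φ (x + t • v) v) t := by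
    intro t
    refine (hasDerivAt_integral_of_dominated_loc_of_deriv_le (μ := volume.restrict Ω)
      (F := fun t x => φ (x + t • v)) (F' := fun t x => fderiv ℝ φ (x + t • v) v)
      (bound := fun _ => C * ‖v‖) (s := univ) univ_mem ?_ ?_ ?_ ?_ ?_ ?_).2
    · refine Eventually.of_forall fun s => ?_
      exact (h1.continuous.comp (by fun_prop)).aestronglyMeasurable
    · refine Integrable.mono' (integrable_const (1:ℝ))
        (h1.continuous.comp (by fun_prop)).aestronglyMeasurable ?_
      exact Eventually.of_forall fun x => h3 _
    · have : Continuous fun x => fderiv ℝ φ (x + t • v) v :=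
        (hcd.comp (by fun_prop : Continuous fun x : E3 => x + t • v)).clm_apply continuous_const
      exact this.aestronglyMeasurable
    · refine Eventually.of_forall fun x s _ => ?_
      exact (ContinuousLinearMap.le_opNorm _ _).trans (by gcongr; exact hC _)
    · exact integrable_const _
    · refine Eventually.of_forall fun x s _ => ?_
      have e1 : HasFDerivAt φ (fderiv ℝ φ (x + s • v)) (x + s • v) :=
        (h1.differentiable one_ne_zero _).hasFDerivAt
      have e2 : HasDerivAt (fun s : ℝ => x + s • v) v s := by
        simpa using ((hasDerivAt_id s).smul_const v).const_add x
      exact e1.comp_hasDerivAt s e2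
  have hle : ∀ t : ℝ, ∫ x in Ω, fderiv ℝ φ (x + t • v) v ≤ ‖v‖ * per Ω := by
    intro t
    have := per_bound_dir h (φ := fun x => φ (x + t • v))
      (h1.comp (contDiff_id.add contDiff_const)) (h2.comp_homeomorph (Homeomorph.addRight (t • v)))
      (fun x => h3 _) v
    simpa only [fderiv_comp_add_right] using this
  have := Convex.image_sub_le_mul_sub_of_deriv_le (convex_univ) (f := fun t : ℝ => ∫ x in Ω, φ (x + t • v))
    (C := ‖v‖ * per Ω) (fun t _ => (hder t).continuousAt.continuousWithinAt)
    (fun t _ => (hder t).differentiableAt.differentiableWithinAt)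
    (fun t _ => by rw [(hder t).deriv]; exact hle t) 0 (mem_univ _) 1 (mem_univ _) zero_le_one
  simpa using this

lemma exists_bump {K U : Set E3} (hK : IsCompact K) (hU : IsOpen U) (hKU : K ⊆ U) :
    ∃ φ : E3 → ℝ, ContDiff ℝ 1 φ ∧ HasCompactSupport φ ∧ (∀ x, 0 ≤ φ x ∧ φ x ≤ 1) ∧
      (∀ x ∈ K, φ x = 1) ∧ (∀ x, x ∉ U → φ x = 0) := by
  obtain ⟨L, hL, hKL, hLU⟩ := exists_compact_between hK hU hKU
  obtain ⟨f, hf0, hf1, hf⟩ := exists_contMDiffMap_zero_one_of_isClosed (n := 1) (modelWithCornersSelf ℝ E3)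
    (s := (interior L)ᶜ) (t := K) isOpen_interior.isClosed_compl hK.isClosed
    (disjoint_left.2 fun x hx hxK => hx (hKL hxK))
  refine ⟨f, f.contMDiff.contDiff, ?_, fun x => hf x, fun x hx => hf1 hx, fun x hx => hf0 ?_⟩
  · refine HasCompactSupport.intro hL fun x hx => hf0 ?_
    exact fun h => hx (interior_subset h)
  · exact fun h => hx (hLU (interior_subset h))

/-- `|Ω \ (Ω - v)| ≤ |v| Per(Ω)`. -/
lemma trans_est {Ω : Set E3} (hΩ : MeasurableSet Ω) (hf : volume Ω < ⊤) (h : HasFinPer Ω)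
    (v : E3) : volume (tr v Ω \ Ω) ≤ ENNReal.ofReal (‖v‖ * per Ω) := by
  have hA : MeasurableSet (tr v Ω \ Ω) := (tr_meas hΩ v).diff hΩ
  have hAf : volume (tr v Ω \ Ω) < ⊤ := by
    refine (measure_mono sdiff_subset).trans_lt ?_
    rwa [tr_volume]
  rw [hA.measure_eq_iSup_isCompact_of_ne_top hAf.ne]
  refine iSup₂_le fun K hKA => iSup_le fun hK => ?_
  refine ENNReal.le_of_forall_pos_le_add fun ε hε _ => ?_
  have hKf : volume K < ⊤ := hK.measure_lt_top
  obtain ⟨U, hKU, hU, hUm⟩ := K.exists_isOpen_lt_add hKf.ne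
    (ε := (ε : ℝ≥0∞)) (by simpa using hε.ne')
  obtain ⟨φ, h1, h2, h3, h4, h5⟩ := exists_bump hK hU hKU
  have hUf : volume U < ⊤ := hUm.trans (ENNReal.add_lt_top.2 ⟨hKf, ENNReal.coe_lt_top⟩)
  have hφi : Integrable φ volume := h1.continuous.integrable_of_hasCompactSupport h2
  have e := per_bound_trans hΩ hf h h1 h2
    (fun x => abs_le.2 ⟨by linarith [(h3 x).1], (h3 x).2⟩) (-v)
  have e1 : ∫ x in Ω, φ (x + -v) = ∫ x in tr v Ω, φ x := by
    have := tr_integral Ω v (fun x => φ (x + -v))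
    rw [← this]; simp
  rw [e1, norm_neg] at e
  have e2 : volume.real K ≤ ∫ x in tr v Ω, φ x := by
    calc volume.real K = ∫ x in K, φ x := by
          rw [setIntegral_congr_fun hK.measurableSet (g := fun _ => (1:ℝ)) (fun x hx => h4 x hx)]
          simp
      _ ≤ _ := by
          refine setIntegral_mono_set hφi.integrableOn (Eventually.of_forall fun x => (h3 x).1)
            (HasSubset.Subset.eventuallyLE ?_)
          exact hKA.trans sdiff_subset
  have e3 : ∫ x in Ω, φ x ≤ ε := by
    have hsub : ∀ x, x ∈ Ω → φ x ≤ (U \ K).indicator (fun _ => (1:ℝ)) x := by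
      intro x hx
      have hxK : x ∉ K := fun hk => (hKA hk).2 hx
      by_cases hxU : x ∈ U
      · rw [indicator_of_mem (show x ∈ U \ K from ⟨hxU, hxK⟩)]; exact (h3 x).2
      · rw [h5 x hxU]; exact indicator_nonneg (fun _ _ => zero_le_one) _
    have hUK : MeasurableSet (U \ K) := hU.measurableSet.diff hK.measurableSet
    have hUKf : volume (U \ K) < ⊤ := (measure_mono sdiff_subset).trans_lt hUf
    have hi : Integrable ((U \ K).indicator (fun _ => (1:ℝ))) (volume : Measure E3) :=
      (integrable_indicator_iff hUK).2 (integrableOn_const hUKf.ne)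
    calc ∫ x in Ω, φ x ≤ ∫ x in Ω, (U \ K).indicator (fun _ => (1:ℝ)) x :=
          setIntegral_mono_on hφi.integrableOn hi.integrableOn hΩ hsub
      _ ≤ ∫ x, (U \ K).indicator (fun _ => (1:ℝ)) x :=
          setIntegral_le_integral hi (Eventually.of_forall fun x =>
            indicator_nonneg (fun _ _ => zero_le_one) _)
      _ = volume.real (U \ K) := by rw [integral_indicator hUK]; simp
      _ ≤ ε := by
          have : volume (U \ K) ≤ ε := by
            rw [measure_sdiff hKU hK.measurableSet.nullMeasurableSet hKf.ne]
            exact tsub_le_iff_left.2 hUm.le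
          exact ENNReal.toReal_le_of_le_ofReal ε.2 (by simpa using this)
  have e4 : volume.real K ≤ ‖v‖ * per Ω + ε := by linarith
  calc volume K = ENNReal.ofReal (volume.real K) := (ENNReal.ofReal_toReal hKf.ne).symm
    _ ≤ ENNReal.ofReal (‖v‖ * per Ω + ε) := ENNReal.ofReal_le_ofReal e4
    _ = _ := by
      rw [ENNReal.ofReal_add (mul_nonneg (norm_nonneg _) (per_nonneg _)) (NNReal.coe_nonneg ε)]; simp

/-! ### Cutting by level sets -/

lemma exists_C0 : ∃ C : ℝ, 0 < C ∧ ∀ x, |deriv Real.smoothTransition x| ≤ C := by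
  have hcd : ContDiff ℝ 1 Real.smoothTransition := Real.smoothTransition.contDiff
  have hc : Continuous (deriv Real.smoothTransition) := hcd.continuous_deriv le_rfl
  obtain ⟨C, hC⟩ := (isCompact_Icc (a := (0:ℝ)) (b := 1)).exists_bound_of_continuousOn hc.continuousOn
  refine ⟨|C| + 1, by positivity, fun x => ?_⟩
  by_cases hx : x ∈ Icc (0:ℝ) 1
  · exact (hC x hx).trans (by linarith [le_abs_self C])
  · have : deriv Real.smoothTransition x = 0 := by
      rw [mem_Icc, not_and_or, not_le, not_le] at hx
      rcases hx with hx | hx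
      · have : Real.smoothTransition =ᶠ[𝓝 x] fun _ => 0 := by
          filter_upwards [Iio_mem_nhds hx] with y hy
          exact Real.smoothTransition.zero_of_nonpos (le_of_lt hy)
        rw [this.deriv_eq]; simp
      · have : Real.smoothTransition =ᶠ[𝓝 x] fun _ => 1 := by
          filter_upwards [Ioi_mem_nhds hx] with y hy
          exact Real.smoothTransition.one_of_one_le (le_of_lt hy)
        rw [this.deriv_eq]; simp
    rw [this]; simp; positivity

/-- A bound for the derivative of the standard transition function. -/
def C0 : ℝ := exists_C0.choose
lemma C0_pos : 0 < C0 := exists_C0.choose_spec.1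
lemma C0_bound (x : ℝ) : |deriv Real.smoothTransition x| ≤ C0 := exists_C0.choose_spec.2 x

/-- The area of the slice of `Ω` at the level `t` of `u` is at most `s` (in a weak sense). -/
def SliceLe (Ω : Set E3) (u : E3 → ℝ) (t s : ℝ) : Prop :=
  ∃ᶠ h in 𝓝[>] (0:ℝ), volume (Ω ∩ {x | t - h ≤ u x ∧ u x < t}) ≤ ENNReal.ofReal (s * h)

lemma SliceLe.mono {Ω Ω' : Set E3} {u : E3 → ℝ} {t s : ℝ} (h : SliceLe Ω u t s) (hs : Ω' ⊆ Ω) :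
    SliceLe Ω' u t s :=
  Frequently.mono h fun _ hh => (measure_mono (inter_subset_inter_left _ hs)).trans hh

lemma hcs_smul {η : E3 → ℝ} {φ : E3 → E3} (h : HasCompactSupport φ) :
    HasCompactSupport (fun x => η x • φ x) := by
  refine h.mono fun x hx => ?_
  rw [Function.mem_support] at hx ⊢
  intro h0
  exact hx (by rw [h0, smul_zero])

lemma hcs_mul {η φ : E3 → ℝ} (h : HasCompactSupport φ) :
    HasCompactSupport (fun x => η x * φ x) := by
  refine h.mono fun x hx => ?_
  rw [Function.mem_support] at hx ⊢
  intro h0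
  exact hx (by rw [h0, mul_zero])

set_option maxHeartbeats 1000000 in
lemma cut_aux {Ω : Set E3} (hΩ : MeasurableSet Ω) (hf : volume Ω < ⊤) (hp : HasFinPer Ω)
    {u : E3 → ℝ} (hu : ContDiff ℝ 1 u) (hL : LipschitzWith 1 u) {t s : ℝ} (hs0 : 0 ≤ s)
    (hs : SliceLe Ω u t s) {φ ψ : E3 → E3}
    (h1 : ContDiff ℝ 1 φ) (h2 : HasCompactSupport φ) (h3 : ∀ x, ‖φ x‖ ≤ 1)
    (k1 : ContDiff ℝ 1 ψ) (k2 : HasCompactSupport ψ) (k3 : ∀ x, ‖ψ x‖ ≤ 1) :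
    (∫ x in Ω ∩ {x | u x < t}, divg φ x) + ∫ x in Ω \ {x | u x < t}, divg ψ x
      ≤ per Ω + 2 * C0 * s := by
  haveI : IsFiniteMeasure (volume.restrict Ω) := ⟨by simpa using hf⟩
  set η : ℝ → E3 → ℝ := fun h x => Real.smoothTransition ((t - u x) / h) with hη
  have hST : ContDiff ℝ 1 Real.smoothTransition := Real.smoothTransition.contDiff
  have hηc : ∀ h, ContDiff ℝ 1 (η h) := fun h =>
    hST.comp ((contDiff_const.sub hu).div_const h)
  have hηc2 : ∀ h, ContDiff ℝ 1 (fun x => 1 - η h x) := fun h => contDiff_const.sub (hηc h)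
  have hηd : ∀ h x, fderiv ℝ (η h) x =
      (-(deriv Real.smoothTransition ((t - u x) / h)) / h) • fderiv ℝ u x := by
    intro h x
    have a1 : HasFDerivAt u (fderiv ℝ u x) x := (hu.differentiable one_ne_zero x).hasFDerivAt
    have a2 : HasFDerivAt (fun y => (t - u y) / h) (h⁻¹ • (-(fderiv ℝ u x))) x := by
      have := (a1.const_sub t).const_mul h⁻¹
      simpa only [div_eq_inv_mul] using this
    have a3 := (hST.differentiable one_ne_zero ((t - u x) / h)).hasDerivAt.comp_hasFDerivAt x a2
    rw [show fderiv ℝ (η h) x = _ from a3.fderiv]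
    ext y; simp; ring
  have hη0 : ∀ h x, 0 < h → t ≤ u x → η h x = 0 := by
    intro h x hh hx
    exact Real.smoothTransition.zero_of_nonpos (div_nonpos_of_nonpos_of_nonneg (by linarith) hh.le)
  have hderiv0 : ∀ h x, 0 < h → ¬ (t - h ≤ u x ∧ u x < t) →
      deriv Real.smoothTransition ((t - u x) / h) = 0 := by
    intro h x hh hx
    have hc : Continuous (deriv Real.smoothTransition) := hST.continuous_deriv le_rfl
    by_cases hlt : u x < t
    · have : u x < t - h := by by_contra h'; exact hx ⟨by linarith, hlt⟩
      have h1' : 1 < (t - u x) / h := by rw [lt_div_iff₀ hh]; linarith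
      have : Real.smoothTransition =ᶠ[𝓝 ((t - u x) / h)] fun _ => 1 := by
        filter_upwards [Ioi_mem_nhds h1'] with y hy
        exact Real.smoothTransition.one_of_one_le (le_of_lt hy)
      rw [this.deriv_eq]; simp
    · have h1' : (t - u x) / h ≤ 0 := div_nonpos_of_nonpos_of_nonneg (by linarith) hh.le
      have hz : ∀ y < (0:ℝ), deriv Real.smoothTransition y = 0 := by
        intro y hy
        have : Real.smoothTransition =ᶠ[𝓝 y] fun _ => 0 := by
          filter_upwards [Iio_mem_nhds hy] with y hy
          exact Real.smoothTransition.zero_of_nonpos (le_of_lt hy)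
        rw [this.deriv_eq]; simp
      rcases h1'.lt_or_eq with h' | h'
      · exact hz _ h'
      · rw [h']
        have : IsLocalMin Real.smoothTransition 0 := by
          refine Eventually.of_forall fun y => ?_
          rw [Real.smoothTransition.zero]; exact Real.smoothTransition.nonneg y
        exact this.deriv_eq_zero
  -- the combined vector field
  have main : ∀ h, 0 < h → volume (Ω ∩ {x | t - h ≤ u x ∧ u x < t}) ≤ ENNReal.ofReal (s * h) →
      (∫ x in Ω, (η h x * divg φ x + (1 - η h x) * divg ψ x)) ≤ per Ω + 2 * C0 * s := by
    intro h hh hv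
    have c1 : ContDiff ℝ 1 (fun x => η h x • φ x) := (hηc h).smul h1
    have c2 : ContDiff ℝ 1 (fun x => (1 - η h x) • ψ x) := (hηc2 h).smul k1
    have s1 : HasCompactSupport (fun x => η h x • φ x) := hcs_smul h2
    have s2 : HasCompactSupport (fun x => (1 - η h x) • ψ x) := hcs_smul k2
    have hle := le_per hp (φ := fun x => η h x • φ x + (1 - η h x) • ψ x) (c1.add c2)
      (s1.add s2) (by
        intro x
        have z0 : 0 ≤ η h x := Real.smoothTransition.nonneg _
        have z1 : 0 ≤ 1 - η h x := sub_nonneg.2 (Real.smoothTransition.le_one _)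
        calc _ ≤ ‖η h x • φ x‖ + ‖(1 - η h x) • ψ x‖ := norm_add_le _ _
          _ ≤ η h x * 1 + (1 - η h x) * 1 := by
            rw [norm_smul, norm_smul, Real.norm_of_nonneg z0, Real.norm_of_nonneg z1]
            gcongr
            · exact h3 x
            · exact k3 x
          _ = 1 := by ring)
    have hd : ∀ x, divg (fun x => η h x • φ x + (1 - η h x) • ψ x) x
        = (η h x * divg φ x + (1 - η h x) * divg ψ x) + fderiv ℝ (η h) x (φ x - ψ x) := by
      intro x
      have d1 := (hηc h).differentiable one_ne_zero x
      have d2 : DifferentiableAt ℝ (fun y => 1 - η h y) x := (differentiableAt_const _).sub d1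
      rw [divg_add (c1.differentiable one_ne_zero x) (c2.differentiable one_ne_zero x),
        divg_smul d1 (h1.differentiable one_ne_zero x),
        divg_smul d2 (k1.differentiable one_ne_zero x), fderiv_const_sub, map_sub]
      simp; ring
    set S : Set E3 := {x | t - h ≤ u x ∧ u x < t} with hS
    have hSm : MeasurableSet S :=
      (measurableSet_le measurable_const hu.continuous.measurable).inter
        (measurableSet_lt hu.continuous.measurable measurable_const)
    have hb : ∀ x, |fderiv ℝ (η h) x (φ x - ψ x)| ≤ S.indicator (fun _ => 2 * C0 / h) x := by
      intro x
      by_cases hx : x ∈ S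
      · rw [indicator_of_mem hx, hηd]
        have b1 : ‖fderiv ℝ u x‖ ≤ 1 := norm_fderiv_le_of_lipschitz ℝ hL
        have b2 : |fderiv ℝ u x (φ x - ψ x)| ≤ 2 := by
          calc |fderiv ℝ u x (φ x - ψ x)| ≤ ‖fderiv ℝ u x‖ * ‖φ x - ψ x‖ :=
                by simpa only [Real.norm_eq_abs] using (fderiv ℝ u x).le_opNorm (φ x - ψ x)
            _ ≤ 1 * (1 + 1) := by
                gcongr
                exact (norm_sub_le _ _).trans (add_le_add (h3 x) (k3 x))
            _ = 2 := by norm_num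
        rw [smul_apply, smul_eq_mul, abs_mul, abs_div, abs_neg, abs_of_pos hh]
        calc _ ≤ C0 / h * 2 := by
              gcongr
              · exact div_nonneg C0_pos.le hh.le
              · exact C0_bound _
          _ = _ := by ring
      · rw [indicator_of_notMem hx, hηd, hderiv0 h x hh hx]; simp
    have hi1 : Integrable (fun x => η h x * divg φ x + (1 - η h x) * divg ψ x) (volume.restrict Ω) := by
      refine Integrable.add ?_ ?_
      · exact (((hηc h).continuous.mul (divg_continuous h1)).integrable_of_hasCompactSupport
          (hcs_mul (divg_compact h2))).integrableOn
      · exact (((continuous_const.sub (hηc h).continuous).mul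
          (divg_continuous k1)).integrable_of_hasCompactSupport
          (hcs_mul (divg_compact k2))).integrableOn
    have hi3 : Integrable (S.indicator (fun _ => 2 * C0 / h)) (volume.restrict Ω) :=
      (integrable_const _).indicator hSm
    have hcont : Continuous fun x => fderiv ℝ (η h) x (φ x - ψ x) :=
      ((hηc h).continuous_fderiv one_ne_zero).clm_apply (h1.continuous.sub k1.continuous)
    have hi2 : Integrable (fun x => fderiv ℝ (η h) x (φ x - ψ x)) (volume.restrict Ω) :=
      hi3.mono' hcont.aestronglyMeasurable (Eventually.of_forall hb)
    simp_rw [hd] at hle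
    rw [integral_add hi1 hi2] at hle
    have hb2 : -(2 * C0 * s) ≤ ∫ x in Ω, fderiv ℝ (η h) x (φ x - ψ x) := by
      have e1 : |∫ x in Ω, fderiv ℝ (η h) x (φ x - ψ x)| ≤ ∫ x in Ω, S.indicator (fun _ => 2 * C0 / h) x :=
        by simpa only [Real.norm_eq_abs] using norm_integral_le_of_norm_le hi3
            (f := fun x => fderiv ℝ (η h) x (φ x - ψ x)) (Eventually.of_forall hb)
      have e2 : ∫ x in Ω, S.indicator (fun _ => 2 * C0 / h) x = volume.real (Ω ∩ S) * (2 * C0 / h) := by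
        rw [integral_indicator hSm, Measure.restrict_restrict hSm, inter_comm S Ω]
        simp
      have e3 : volume.real (Ω ∩ S) ≤ s * h := ENNReal.toReal_le_of_le_ofReal (by positivity) hv
      have e4 : volume.real (Ω ∩ S) * (2 * C0 / h) ≤ 2 * C0 * s := by
        calc _ ≤ s * h * (2 * C0 / h) := by
              gcongr
              exact div_nonneg (by linarith [C0_pos]) hh.le
          _ = _ := by field_simp
      have := abs_le.1 (e1.trans (e2.trans_le e4))
      exact this.1
    linarith
  -- extract a sequence of `h`
  obtain ⟨hs', hs1, hs2⟩ : ∃ hs' : ℕ → ℝ, Tendsto hs' atTop (𝓝[>] 0) ∧ ∀ n, volume (Ω ∩ {x | t - hs' n ≤ u x ∧ u x < t}) ≤ ENNReal.ofReal (s * hs' n) :=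
    exists_seq_forall_of_frequently hs
  have hU : MeasurableSet {x | u x < t} := measurableSet_lt hu.continuous.measurable measurable_const
  have hlim : Tendsto (fun n => ∫ x in Ω, (η (hs' n) x * divg φ x + (1 - η (hs' n) x) * divg ψ x)) atTop
      (𝓝 (∫ x in Ω, ({x | u x < t}.indicator (divg φ) x + {x | u x < t}ᶜ.indicator (divg ψ) x))) := by
    refine tendsto_integral_of_dominated_convergence (fun x => |divg φ x| + |divg ψ x|) ?_ ?_ ?_ ?_
    · intro n
      refine Continuous.aestronglyMeasurable ?_
      exact ((hηc _).continuous.mul (divg_continuous h1)).add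
        ((continuous_const.sub (hηc _).continuous).mul (divg_continuous k1))
    · exact ((divg_integrable h1 h2).abs.add (divg_integrable k1 k2).abs).integrableOn
    · intro n
      refine Eventually.of_forall fun x => ?_
      have z0 : 0 ≤ η (hs' n) x := Real.smoothTransition.nonneg _
      have z2 : η (hs' n) x ≤ 1 := Real.smoothTransition.le_one _
      have z1 : 0 ≤ 1 - η (hs' n) x := sub_nonneg.2 z2
      calc _ ≤ |η (hs' n) x * divg φ x| + |(1 - η (hs' n) x) * divg ψ x| := abs_add_le _ _
        _ ≤ 1 * |divg φ x| + 1 * |divg ψ x| := by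
          rw [abs_mul, abs_mul, abs_of_nonneg z0, abs_of_nonneg z1]
          gcongr; linarith
        _ = _ := by ring
    · refine Eventually.of_forall fun x => ?_
      refine tendsto_const_nhds.congr' ?_
      have hpos : ∀ᶠ n in atTop, hs' n ∈ Ioi (0:ℝ) := hs1.eventually self_mem_nhdsWithin
      by_cases hx : u x < t
      · have : ∀ᶠ n in atTop, hs' n < t - u x :=
          (hs1.mono_right nhdsWithin_le_nhds).eventually (Iio_mem_nhds (by linarith))
        filter_upwards [hpos, this] with n hn hn2
        have : η (hs' n) x = 1 := Real.smoothTransition.one_of_one_le (by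
          rw [le_div_iff₀ hn]; linarith)
        rw [this]
        simp [hx]
      · filter_upwards [hpos] with n hn
        rw [hη0 _ _ hn (not_lt.1 hx)]
        simp [hx]
  have hfin := le_of_tendsto hlim (by
    filter_upwards [hs1.eventually self_mem_nhdsWithin] with n hn
    exact main _ hn (hs2 n))
  rw [integral_add, setIntegral_indicator hU, setIntegral_indicator hU.compl] at hfin
  · rw [sdiff_eq]; exact hfin
  · exact ((divg_integrable h1 h2).integrableOn).indicator hU
  · exact ((divg_integrable k1 k2).integrableOn).indicator hU.compl

lemma cut_per {Ω : Set E3} (hΩ : MeasurableSet Ω) (hf : volume Ω < ⊤) (hp : HasFinPer Ω)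
    {u : E3 → ℝ} (hu : ContDiff ℝ 1 u) (hL : LipschitzWith 1 u) {t s : ℝ} (hs0 : 0 ≤ s)
    (hs : SliceLe Ω u t s) :
    HasFinPer (Ω ∩ {x | u x < t}) ∧ HasFinPer (Ω \ {x | u x < t}) ∧
    per (Ω ∩ {x | u x < t}) + per (Ω \ {x | u x < t}) ≤ per Ω + 2 * C0 * s := by
  have key := fun φ ψ => @cut_aux Ω hΩ hf hp u hu hL t s hs0 hs φ ψ
  have z : ∀ S : Set E3, ∫ x in S, divg (fun _ : E3 => (0:E3)) x = 0 := by
    intro S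
    have : divg (fun _ : E3 => (0:E3)) = fun _ => 0 := by ext x; simp [divg]
    simp [this]
  have a : ∀ ψ : E3 → E3, ContDiff ℝ 1 ψ → HasCompactSupport ψ → (∀ x, ‖ψ x‖ ≤ 1) →
      HasFinPer (Ω ∩ {x | u x < t}) ∧
      per (Ω ∩ {x | u x < t}) ≤ per Ω + 2 * C0 * s - ∫ x in Ω \ {x | u x < t}, divg ψ x := by
    intro ψ k1 k2 k3
    refine per_le_of fun φ h1 h2 h3 => ?_
    linarith [key φ ψ h1 h2 h3 k1 k2 k3]
  have b : HasFinPer (Ω \ {x | u x < t}) ∧ per (Ω \ {x | u x < t}) ≤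
      per Ω + 2 * C0 * s - per (Ω ∩ {x | u x < t}) := by
    refine per_le_of fun ψ k1 k2 k3 => ?_
    linarith [(a ψ k1 k2 k3).2]
  exact ⟨(a (fun _ => 0) contDiff_const HasCompactSupport.zero (by simp)).1, b.1, by linarith [b.2]⟩

/-! ### Finding good slices -/

lemma mono_slice {G : ℝ → ℝ} (hG : Monotone G) {α β s : ℝ} (hab : α < β)
    (hs : G β - G α < s * (β - α)) :
    ∃ t ∈ Ioo α β, ∀ᶠ h in 𝓝[>] (0:ℝ), G t - G (t - h) ≤ s * h := by
  by_contra hcon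
  push Not at hcon
  have hd := hG.ae_differentiableAt
  have hge : ∀ᵐ t : ℝ, t ∈ Ioo α β → s ≤ deriv G t := by
    filter_upwards [hd] with t ht hmem
    by_contra hlt
    push Not at hlt
    have h1 := ht.hasDerivAt
    have h2 := hasDerivAt_iff_tendsto_slope.1 h1
    have h3 : ∀ᶠ y in 𝓝[≠] t, slope G t y < s := h2.eventually (Iio_mem_nhds hlt)
    have h4 : Tendsto (fun h : ℝ => t - h) (𝓝[>] 0) (𝓝[≠] t) := by
      refine tendsto_nhdsWithin_iff.2 ⟨?_, ?_⟩
      · have : Tendsto (fun h : ℝ => t - h) (𝓝 0) (𝓝 (t - 0)) := by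
          exact (continuous_const.sub continuous_id).tendsto 0
        rw [sub_zero] at this
        exact this.mono_left nhdsWithin_le_nhds
      · filter_upwards [self_mem_nhdsWithin] with h hh
        simp only [mem_compl_iff, mem_singleton_iff]
        have : (0:ℝ) < h := hh
        linarith
    have h5 := h4.eventually h3
    have : ∀ᶠ h in 𝓝[>] (0:ℝ), G t - G (t - h) ≤ s * h := by
      filter_upwards [h5, self_mem_nhdsWithin] with h hh hpos
      have hpos' : (0:ℝ) < h := hpos
      rw [slope_def_field] at hh
      rw [show t - h - t = -h by ring, div_neg, ← neg_div, div_lt_iff₀ hpos'] at hh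
      linarith
    obtain ⟨h, h6, h7⟩ := ((hcon t hmem).and_eventually this).exists
    linarith
  have hmo : MonotoneOn G (uIcc α β) := hG.monotoneOn _
  have i1 := hmo.intervalIntegrable_deriv
  have i2 := hmo.intervalIntegral_deriv_mem_uIcc
  rw [uIcc_of_le (by linarith [hG hab.le])] at i2
  have i3 : ∫ x in α..β, s ≤ ∫ x in α..β, deriv G x := by
    rw [intervalIntegral.integral_of_le hab.le, intervalIntegral.integral_of_le hab.le,
      integral_Ioc_eq_integral_Ioo, integral_Ioc_eq_integral_Ioo]
    refine setIntegral_mono_on_ae (integrableOn_const (by simp)) ?_ measurableSet_Ioo hge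
    exact ((intervalIntegrable_iff_integrableOn_Ioo_of_le hab.le).1 i1)
  rw [intervalIntegral.integral_const, smul_eq_mul] at i3
  linarith [i2.2]

/-! ### The Coulomb energy -/

/-- The Coulomb kernel. -/
def kk (x y : E3) : ℝ≥0∞ := ENNReal.ofReal (1 / ‖x - y‖)

lemma kk_meas : Measurable (fun p : E3 × E3 => kk p.1 p.2) := by
  unfold kk
  fun_prop

lemma kk_symm (x y : E3) : kk x y = kk y x := by rw [kk, kk, norm_sub_rev]

/-- The mutual Coulomb energy. -/
def DD (A B : Set E3) : ℝ≥0∞ := ∫⁻ x in A, ∫⁻ y in B, kk x y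

lemma pot_meas (B : Set E3) : Measurable (fun x => ∫⁻ y in B, kk x y) :=
  Measurable.lintegral_prod_right' kk_meas

lemma ball_pot_fin : ∫⁻ y in ball (0:E3) 1, ENNReal.ofReal (1 / ‖y‖) < ⊤ := by
  have h : IntegrableOn (fun x : E3 => (fun r : ℝ => 1 / r) ‖x‖) (ball 0 1) volume := by
    rw [integrableOn_fun_norm_addHaar]
    have e : Module.finrank ℝ E3 = 3 := by simp
    rw [e]
    have hc : IntegrableOn (fun y : ℝ => y) (Ioo 0 1) volume :=
      (continuous_id.integrableOn_Icc (a := (0:ℝ)) (b := 1)).mono_set Ioo_subset_Icc_self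
    refine hc.congr_fun ?_ measurableSet_Ioo
    intro y hy
    have : y ≠ 0 := hy.1.ne'
    simp; field_simp
  have := h.2
  rw [hasFiniteIntegral_iff_ofReal (Eventually.of_forall fun x => by simp)] at this
  exact this

/-- The constant in the bound of potentials. -/
def cP : ℝ≥0∞ := ∫⁻ y in ball (0:E3) 1, ENNReal.ofReal (1 / ‖y‖)

lemma cP_lt : cP < ⊤ := ball_pot_fin

lemma pot_ball (x : E3) : ∫⁻ y, (ball x 1).indicator (fun y => kk x y) y = cP := by
  unfold cP
  rw [← lintegral_indicator measurableSet_ball]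
  have := lintegral_add_right_eq_self (μ := (volume : Measure E3))
    (fun y => (ball x 1).indicator (fun y => kk x y) y) x
  rw [← this]
  refine lintegral_congr fun y => ?_
  have e1 : y + x ∈ ball x 1 ↔ y ∈ ball (0:E3) 1 := by simp
  have e2 : kk x (y + x) = ENNReal.ofReal (1 / ‖y‖) := by
    unfold kk
    rw [show x - (y + x) = -y by abel, norm_neg]
  by_cases hy : y ∈ ball (0:E3) 1
  · rw [indicator_of_mem hy, indicator_of_mem (e1.2 hy), e2]
  · rw [indicator_of_notMem hy, indicator_of_notMem (fun h => hy (e1.1 h))]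

lemma kk_le_one {x y : E3} (hy : y ∉ ball x 1) : kk x y ≤ 1 := by
  unfold kk
  rw [mem_ball, not_lt, dist_comm, dist_eq_norm] at hy
  refine ENNReal.ofReal_le_one.2 ?_
  rw [div_le_one (by linarith)]
  exact hy

lemma pot_le (x : E3) (B : Set E3) : ∫⁻ y in B, kk x y ≤ cP + volume B := by
  have h1 : ∀ y, kk x y ≤ (ball x 1).indicator (fun y => kk x y) y + 1 := by
    intro y
    by_cases hy : y ∈ ball x 1
    · rw [indicator_of_mem hy]; exact le_self_add
    · rw [indicator_of_notMem hy, zero_add]; exact kk_le_one hy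
  calc ∫⁻ y in B, kk x y ≤ ∫⁻ y in B, ((ball x 1).indicator (fun y => kk x y) y + 1) :=
        lintegral_mono h1
    _ = (∫⁻ y in B, (ball x 1).indicator (fun y => kk x y) y) + volume B := by
        rw [lintegral_add_right _ measurable_const]; simp
    _ ≤ (∫⁻ y, (ball x 1).indicator (fun y => kk x y) y) + volume B := by
        gcongr; exact Measure.restrict_le_self
    _ = cP + volume B := by rw [pot_ball]

lemma DD_le (A B : Set E3) : DD A B ≤ volume A * (cP + volume B) := by
  calc DD A B ≤ ∫⁻ x in A, (cP + volume B) := lintegral_mono fun x => pot_le x B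
    _ = _ := by simp [mul_comm]

lemma DD_fin {A B : Set E3} (hA : volume A < ⊤) (hB : volume B < ⊤) : DD A B < ⊤ :=
  (DD_le A B).trans_lt (ENNReal.mul_lt_top hA (ENNReal.add_lt_top.2 ⟨cP_lt, hB⟩))

lemma DD_symm (A B : Set E3) : DD A B = DD B A := by
  unfold DD
  rw [lintegral_lintegral_swap kk_meas.aemeasurable]
  simp_rw [kk_symm]

lemma DD_mono {A A' B B' : Set E3} (h : A ⊆ A') (h' : B ⊆ B') : DD A B ≤ DD A' B' := by
  unfold DD
  refine lintegral_mono' (Measure.restrict_mono h le_rfl) fun x => ?_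
  exact lintegral_mono' (Measure.restrict_mono h' le_rfl) le_rfl

lemma DD_union_left {A A' : Set E3} (B : Set E3) (h : MeasurableSet A') (hd : Disjoint A A') :
    DD (A ∪ A') B = DD A B + DD A' B := lintegral_union h hd

lemma DD_split {P Q : Set E3} (hQ : MeasurableSet Q) (hd : Disjoint P Q) :
    DD (P ∪ Q) (P ∪ Q) = DD P P + DD Q Q + 2 * DD P Q := by
  rw [DD_union_left _ hQ hd, DD_symm P, DD_symm Q, DD_union_left _ hQ hd, DD_union_left _ hQ hd,
    DD_symm Q P, two_mul]
  ring

lemma DD_diff {X Y : Set E3} (hX : MeasurableSet X) (hY : MeasurableSet Y) :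
    DD X X ≤ DD Y Y + 2 * (volume (X \ Y) * (cP + volume X)) := by
  have e : DD X X = DD (X ∩ Y ∪ X \ Y) (X ∩ Y ∪ X \ Y) := by rw [inter_union_sdiff]
  rw [e, DD_split (hX.diff hY) (disjoint_sdiff_inter.symm)]
  have a1 : DD (X ∩ Y) (X ∩ Y) ≤ DD Y Y := DD_mono inter_subset_right inter_subset_right
  have a2 : DD (X \ Y) (X \ Y) + 2 * DD (X ∩ Y) (X \ Y) ≤ 2 * DD (X \ Y) X := by
    have h3 : DD (X \ Y) X = DD (X ∩ Y) (X \ Y) + DD (X \ Y) (X \ Y) := by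
      rw [DD_symm, ← DD_union_left _ (hX.diff hY) (disjoint_sdiff_inter.symm), inter_union_sdiff]
    rw [h3, mul_add, two_mul (DD (X \ Y) (X \ Y)), add_comm]
    gcongr
    exact le_self_add
  calc _ = DD (X ∩ Y) (X ∩ Y) + (DD (X \ Y) (X \ Y) + 2 * DD (X ∩ Y) (X \ Y)) := by ring
    _ ≤ DD Y Y + 2 * DD (X \ Y) X := add_le_add a1 a2
    _ ≤ _ := by gcongr; exact DD_le _ _

lemma DD_tr (A B : Set E3) (c : E3) : DD (tr c A) (tr c B) = DD A B := by
  have h1 := measurePreserving_add_right (volume : Measure E3) c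
  have key : ∀ (S : Set E3) (f : E3 → ℝ≥0∞), ∫⁻ x in tr c S, f (x + c) = ∫⁻ x in S, f x :=
    fun S f => h1.setLIntegral_comp_preimage_emb (measurableEmbedding_addRight c) f S
  unfold DD
  rw [← key A]
  refine lintegral_congr fun x => ?_
  rw [← key B]
  refine lintegral_congr fun y => ?_
  simp [kk]

lemma II_eq {Ω : Set E3} (hf : volume Ω < ⊤) : II Ω = per Ω + (1/2) * (DD Ω Ω).toReal := by
  have hp : ∀ x, ∫⁻ y in Ω, kk x y < ⊤ := fun x =>
    (pot_le x Ω).trans_lt (ENNReal.add_lt_top.2 ⟨cP_lt, hf⟩)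
  have h1 : ∀ x, ∫ y in Ω, 1 / ‖x - y‖ = (∫⁻ y in Ω, kk x y).toReal := by
    intro x
    rw [integral_eq_lintegral_of_nonneg_ae (Eventually.of_forall fun y => by positivity)]
    · rfl
    · have : Measurable (fun y : E3 => 1 / ‖x - y‖) := by fun_prop
      exact this.aestronglyMeasurable
  unfold II
  congr 2
  simp_rw [h1]
  rw [integral_toReal (pot_meas Ω).aemeasurable (Eventually.of_forall hp)]
  rfl

lemma II_tr {Ω : Set E3} (hf : volume Ω < ⊤) (c : E3) : II (tr c Ω) = II Ω := by
  rw [II_eq hf, II_eq (by rwa [tr_volume]), tr_per, DD_tr]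

lemma II_nonneg {Ω : Set E3} (hf : volume Ω < ⊤) : 0 ≤ II Ω := by
  rw [II_eq hf]
  have := per_nonneg Ω
  positivity

lemma per_le_II {Ω : Set E3} (hf : volume Ω < ⊤) : per Ω ≤ II Ω := by
  rw [II_eq hf]
  have : 0 ≤ (DD Ω Ω).toReal := by positivity
  linarith

lemma vol_nonneg (Ω : Set E3) : 0 ≤ vol Ω := ENNReal.toReal_nonneg

lemma vol_tr (Ω : Set E3) (c : E3) : vol (tr c Ω) = vol Ω := by rw [vol, vol, tr_volume]

lemma muStar_mem_nonneg : ∀ t ∈ {t : ℝ | ∃ Ω : Set E3, MeasurableSet Ω ∧ HasFinPer Ω ∧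
    0 < volume Ω ∧ volume Ω < ⊤ ∧ t = II Ω / vol Ω}, 0 ≤ t := by
  rintro t ⟨Ω, -, -, -, h, rfl⟩
  exact div_nonneg (II_nonneg h) (vol_nonneg Ω)

lemma muStar_nonneg : 0 ≤ muStar := Real.sInf_nonneg muStar_mem_nonneg

lemma muStar_le {Ω : Set E3} (hΩ : MeasurableSet Ω) (hp : HasFinPer Ω) (hf : volume Ω < ⊤) :
    muStar * vol Ω ≤ II Ω := by
  rcases eq_or_ne (volume Ω) 0 with h0 | h0
  · rw [vol, h0]; simpa using II_nonneg hf
  · have hpos : 0 < vol Ω := ENNReal.toReal_pos h0 hf.ne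
    rw [← le_div_iff₀ hpos]
    exact csInf_le ⟨0, muStar_mem_nonneg⟩ ⟨Ω, hΩ, hp, pos_iff_ne_zero.2 h0, hf, rfl⟩

lemma vol_inter_add_diff {Ω U : Set E3} (hf : volume Ω < ⊤) (hU : MeasurableSet U) :
    vol (Ω ∩ U) + vol (Ω \ U) = vol Ω :=
  measureReal_inter_add_sdiff hU hf.ne

lemma fin_inter {Ω : Set E3} (hf : volume Ω < ⊤) (U : Set E3) : volume (Ω ∩ U) < ⊤ :=
  (measure_mono inter_subset_left).trans_lt hf

lemma fin_diff {Ω : Set E3} (hf : volume Ω < ⊤) (U : Set E3) : volume (Ω \ U) < ⊤ :=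
  (measure_mono sdiff_subset).trans_lt hf

lemma DD_toReal_split {Ω U : Set E3} (hΩ : MeasurableSet Ω) (hf : volume Ω < ⊤)
    (hU : MeasurableSet U) :
    (DD Ω Ω).toReal = (DD (Ω ∩ U) (Ω ∩ U)).toReal + (DD (Ω \ U) (Ω \ U)).toReal
      + 2 * (DD (Ω ∩ U) (Ω \ U)).toReal := by
  have e : DD Ω Ω = DD (Ω ∩ U ∪ Ω \ U) (Ω ∩ U ∪ Ω \ U) := by rw [inter_union_sdiff]
  rw [e, DD_split (hΩ.diff hU) (disjoint_sdiff_inter.symm)]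
  have f1 := (DD_fin (fin_inter hf U) (fin_inter hf U)).ne
  have f2 := (DD_fin (fin_diff hf U) (fin_diff hf U)).ne
  have f3 := (DD_fin (fin_inter hf U) (fin_diff hf U)).ne
  rw [ENNReal.toReal_add (ENNReal.add_ne_top.2 ⟨f1, f2⟩) (ENNReal.mul_ne_top (by simp) f3),
    ENNReal.toReal_add f1 f2, ENNReal.toReal_mul]
  simp

lemma cut_II {Ω : Set E3} (hΩ : MeasurableSet Ω) (hf : volume Ω < ⊤) (hp : HasFinPer Ω)
    {u : E3 → ℝ} (hu : ContDiff ℝ 1 u) (hL : LipschitzWith 1 u) {t s : ℝ} (hs0 : 0 ≤ s)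
    (hs : SliceLe Ω u t s) :
    HasFinPer (Ω ∩ {x | u x < t}) ∧ HasFinPer (Ω \ {x | u x < t}) ∧
    II (Ω ∩ {x | u x < t}) + II (Ω \ {x | u x < t})
      + (DD (Ω ∩ {x | u x < t}) (Ω \ {x | u x < t})).toReal ≤ II Ω + 2 * C0 * s := by
  obtain ⟨a, b, c⟩ := cut_per hΩ hf hp hu hL hs0 hs
  refine ⟨a, b, ?_⟩
  have hU : MeasurableSet {x | u x < t} := measurableSet_lt hu.continuous.measurable measurable_const
  rw [II_eq hf, II_eq (fin_inter hf _), II_eq (fin_diff hf _), DD_toReal_split hΩ hf hU]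
  linarith

/-! ### The isoperimetric-type estimate -/

/-- `∫_A |B(x,r) \ A| dx ≤ |B_r| r Per(A)`. -/
lemma J_est {A : Set E3} (hA : MeasurableSet A) (hf : volume A < ⊤) (hp : HasFinPer A) {r : ℝ}
    (hr : 0 ≤ r) : ∫⁻ x in Aᶜ, volume (A ∩ ball x r) ≤
      volume (ball (0:E3) r) * ENNReal.ofReal (r * per A) := by
  have e1 : ∀ x, volume (A ∩ ball x r) = ∫⁻ y in ball (0:E3) r, A.indicator 1 (x + y) := by
    intro x
    rw [← lintegral_indicator measurableSet_ball, ← lintegral_indicator_one (hA.inter measurableSet_ball)]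
    rw [← lintegral_add_left_eq_self _ x]
    refine lintegral_congr fun y => ?_
    simp only [indicator, mem_inter_iff, mem_ball, dist_self_add_left, dist_zero_right, Pi.one_apply]
    by_cases h1 : x + y ∈ A <;> by_cases h2 : ‖y‖ < r <;> simp [h1, h2]
  simp_rw [e1]
  rw [lintegral_lintegral_swap]
  · calc _ ≤ ∫⁻ y in ball (0:E3) r, ENNReal.ofReal (r * per A) := by
          refine setLIntegral_mono measurable_const fun y hy => ?_
          have e2 : ∫⁻ x in Aᶜ, A.indicator (1 : E3 → ℝ≥0∞) (x + y) = volume (tr y A \ A) := by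
            rw [← lintegral_indicator hA.compl, ← lintegral_indicator_one ((tr_meas hA y).diff hA)]
            refine lintegral_congr fun x => ?_
            by_cases h1 : x + y ∈ A <;> by_cases h2 : x ∈ A <;> simp [tr, h1, h2]
          rw [e2]
          refine (trans_est hA hf hp y).trans (ENNReal.ofReal_le_ofReal ?_)
          have : ‖y‖ < r := by simpa using hy
          have := per_nonneg A
          gcongr
      _ = _ := by simp [mul_comm]
  · refine Measurable.aemeasurable ?_
    exact (measurable_one.indicator hA).comp (measurable_fst.add measurable_snd)

lemma J_symm {A : Set E3} (hA : MeasurableSet A) (r : ℝ) :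
    ∫⁻ x in A, volume (ball x r \ A) = ∫⁻ x in Aᶜ, volume (A ∩ ball x r) := by
  have e1 : ∀ x, volume (ball x r \ A) = ∫⁻ y in Aᶜ, (ball x r).indicator 1 y := by
    intro x
    rw [lintegral_indicator_one measurableSet_ball, Measure.restrict_apply measurableSet_ball, sdiff_eq]
  have e2 : ∀ x, volume (A ∩ ball x r) = ∫⁻ y in A, (ball x r).indicator 1 y := by
    intro x
    rw [lintegral_indicator_one measurableSet_ball, Measure.restrict_apply measurableSet_ball, inter_comm]
  simp_rw [e1, e2]
  rw [lintegral_lintegral_swap]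
  · refine lintegral_congr fun x => lintegral_congr fun y => ?_
    simp only [indicator, mem_ball, dist_comm, Pi.one_apply]
  · refine Measurable.aemeasurable ?_
    have : (Function.uncurry fun (x y : E3) => (ball x r).indicator (1 : E3 → ℝ≥0∞) y)
      = {p : E3 × E3 | dist p.2 p.1 < r}.indicator 1 := by
      ext p; simp [Function.uncurry, indicator]
    rw [this]
    exact measurable_one.indicator (measurableSet_lt (by fun_prop) measurable_const)

lemma J_est2 {A : Set E3} (hA : MeasurableSet A) (hf : volume A < ⊤) (hp : HasFinPer A) {r : ℝ}
    (hr : 0 ≤ r) : ∫⁻ x in A, volume (ball x r \ A) ≤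
      volume (ball (0:E3) r) * ENNReal.ofReal (r * per A) := by
  rw [J_symm hA]; exact J_est hA hf hp hr

/-- Non-vanishing: a point of `S ⊆ A` where the density of `A` is not small. -/
lemma exists_dense {A S : Set E3} (hA : MeasurableSet A) (hf : volume A < ⊤) (hp : HasFinPer A)
    (hS : MeasurableSet S)
    (hSA : S ⊆ A) {r θ : ℝ} (hr : 0 < r) (hr2 : r * per A < θ * vol S) (hθ : 0 ≤ θ) :
    ∃ x ∈ S, (1 - θ) * vol (ball (0:E3) r) ≤ vol (A ∩ ball x r) := by
  by_contra hcon
  push Not at hcon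
  have hSf : volume S < ⊤ := (measure_mono hSA).trans_lt hf
  have hb : ∀ x, volume (ball x r) = volume (ball (0:E3) r) := fun x =>
    Measure.addHaar_ball_center volume x r
  have hbf : volume (ball (0:E3) r) < ⊤ := measure_ball_lt_top
  have hbpos : 0 < vol (ball (0:E3) r) := ENNReal.toReal_pos (measure_ball_pos _ _ hr).ne' hbf.ne
  have h1 : ∀ x ∈ S, ENNReal.ofReal (θ * vol (ball (0:E3) r)) ≤ volume (ball x r \ A) := by
    intro x hx
    have h2 := hcon x hx
    have h3 : vol (ball x r ∩ A) + vol (ball x r \ A) = vol (ball x r) :=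
      vol_inter_add_diff measure_ball_lt_top hA
    rw [inter_comm] at h3
    have h4 : vol (ball x r) = vol (ball (0:E3) r) := by rw [vol, vol, hb]
    refine ENNReal.ofReal_le_of_le_toReal ?_
    change _ ≤ vol (ball x r \ A)
    linarith
  have h2 : ENNReal.ofReal (θ * vol (ball (0:E3) r)) * volume S ≤
      volume (ball (0:E3) r) * ENNReal.ofReal (r * per A) := by
    calc _ = ∫⁻ x in S, ENNReal.ofReal (θ * vol (ball (0:E3) r)) := by simp
      _ ≤ ∫⁻ x in S, volume (ball x r \ A) := setLIntegral_mono' hS h1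
      _ ≤ ∫⁻ x in A, volume (ball x r \ A) := lintegral_mono_set hSA
      _ ≤ _ := J_est2 hA hf hp hr.le
  have h3 := ENNReal.toReal_mono (ENNReal.mul_ne_top hbf.ne ENNReal.ofReal_ne_top) h2
  rw [ENNReal.toReal_mul, ENNReal.toReal_mul, ENNReal.toReal_ofReal (by positivity),
    ENNReal.toReal_ofReal (mul_nonneg hr.le (per_nonneg A))] at h3
  change θ * vol (ball (0:E3) r) * vol S ≤ vol (ball (0:E3) r) * (r * per A) at h3
  have : θ * vol S ≤ r * per A := by
    refine le_of_mul_le_mul_left ?_ hbpos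
    linarith
  linarith

/-- A smooth substitute for the distance to `a`. -/
def ub (a x : E3) : ℝ := √(1 + ‖x - a‖ ^ 2)

lemma ub_contDiff (a : E3) : ContDiff ℝ 1 (ub a) := by
  unfold ub
  refine ContDiff.sqrt ?_ fun x => by positivity
  exact contDiff_const.add ((contDiff_id.sub contDiff_const).norm_sq ℝ)

lemma ub_lip (a : E3) : LipschitzWith 1 (ub a) := by
  refine LipschitzWith.of_le_add fun x y => ?_
  unfold ub
  rw [dist_eq_norm]
  have h1 : ‖x - a‖ ≤ ‖y - a‖ + ‖x - y‖ := by
    have : x - a = (y - a) + (x - y) := by abel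
    rw [this]; exact norm_add_le _ _
  have h2 : ‖y - a‖ ≤ √(1 + ‖y - a‖ ^ 2) := Real.le_sqrt_of_sq_le (by linarith)
  have h3 : √(1 + ‖y - a‖ ^ 2) ^ 2 = 1 + ‖y - a‖ ^ 2 := Real.sq_sqrt (by positivity)
  have h4 := norm_nonneg (x - a)
  have h5 := norm_nonneg (x - y)
  have h6 := norm_nonneg (y - a)
  rw [Real.sqrt_le_left (by positivity)]
  nlinarith [mul_nonneg h5 (sub_nonneg.2 h2)]

lemma ub_le (a x : E3) : ub a x ≤ 1 + ‖x - a‖ := by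
  unfold ub
  have h4 := norm_nonneg (x - a)
  rw [Real.sqrt_le_left (by positivity)]
  nlinarith

lemma le_ub (a x : E3) : ‖x - a‖ ≤ ub a x :=
  Real.le_sqrt_of_sq_le (by linarith)

lemma ub_lt {t : ℝ} (ht : 1 ≤ t) (a : E3) : {x | ub a x < t} = ball a (√(t ^ 2 - 1)) := by
  ext x
  rw [mem_setOf_eq, mem_ball, dist_eq_norm, ub, Real.sqrt_lt' (by linarith),
    Real.lt_sqrt (norm_nonneg _)]
  constructor <;> intro h <;> linarith

lemma ball_sub_ub (a : E3) (t : ℝ) : ball a (t - 1) ⊆ {x | ub a x < t} := by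
  intro x hx
  rw [mem_ball, dist_eq_norm] at hx
  have := ub_le a x
  rw [mem_setOf_eq]; linarith

lemma ub_sub_ball (a : E3) (t : ℝ) : {x | ub a x < t} ⊆ ball a t := by
  intro x hx
  rw [mem_setOf_eq] at hx
  rw [mem_ball, dist_eq_norm]
  exact (le_ub a x).trans_lt hx

lemma sub_meas {u : E3 → ℝ} (hu : Measurable u) (t : ℝ) : MeasurableSet {x | u x < t} :=
  measurableSet_lt hu measurable_const

lemma ub_meas (a : E3) : Measurable (ub a) := (ub_contDiff a).continuous.measurable

lemma vol_mono {A B : Set E3} (h : A ⊆ B) (hB : volume B < ⊤) : vol A ≤ vol B :=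
  ENNReal.toReal_mono hB.ne (measure_mono h)

/-- Simultaneous good levels for a (weighted) countable family of sets and functions. -/
lemma exists_slices {ι : Type*} (Ω : ι → Set E3) (u : ι → E3 → ℝ)
    (hf : ∀ i, volume (Ω i) < ⊤) (hu : ∀ i, Measurable (u i)) (w : ι → ℝ) (hw : ∀ i, 0 < w i)
    {α β s : ℝ} (hab : α < β)
    (hsum : Summable fun i => w i * vol (Ω i ∩ {x | α ≤ u i x ∧ u i x < β}))
    (hs : ∑' i, w i * vol (Ω i ∩ {x | α ≤ u i x ∧ u i x < β}) < s * (β - α)) :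
    ∃ t ∈ Ioo α β, ∀ i, SliceLe (Ω i) (u i) t (s / w i) := by
  set g : ι → ℝ → ℝ := fun i t => vol (Ω i ∩ {x | α ≤ u i x ∧ u i x < min t β}) with hg
  have gmono : ∀ i, Monotone (g i) := by
    intro i t t' h
    refine vol_mono (inter_subset_inter_right _ fun x hx => ⟨hx.1, hx.2.trans_le ?_⟩)
      (fin_inter (hf i) _)
    exact min_le_min_right _ h
  have gle : ∀ i t, w i * g i t ≤ w i * vol (Ω i ∩ {x | α ≤ u i x ∧ u i x < β}) := by
    intro i t
    refine mul_le_mul_of_nonneg_left ?_ (hw i).le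
    exact vol_mono (inter_subset_inter_right _ fun x hx => ⟨hx.1, hx.2.trans_le (min_le_right _ _)⟩)
      (fin_inter (hf i) _)
  have gsum : ∀ t, Summable fun i => w i * g i t := fun t =>
    Summable.of_nonneg_of_le (fun i => mul_nonneg (hw i).le (vol_nonneg _)) (fun i => gle i t) hsum
  have Gm : Monotone fun t => ∑' i, w i * g i t := fun t t' h =>
    (gsum t).tsum_le_tsum (fun i => mul_le_mul_of_nonneg_left (gmono i h) (hw i).le) (gsum t')
  have Gα : ∑' i, w i * g i α = 0 := by
    have : ∀ i, w i * g i α = 0 := by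
      intro i
      have : {x | α ≤ u i x ∧ u i x < min α β} = ∅ := by
        ext x; simp only [mem_setOf_eq, mem_empty_iff_false, iff_false, min_eq_left hab.le]
        rintro ⟨h1, h2⟩; linarith
      simp only [hg, this, vol, inter_empty, measure_empty, ENNReal.toReal_zero, mul_zero]
    simp [this]
  have Gβ : ∑' i, w i * g i β = ∑' i, w i * vol (Ω i ∩ {x | α ≤ u i x ∧ u i x < β}) := by
    simp [hg]
  obtain ⟨t, ht, hev⟩ := mono_slice Gm (s := s) hab (by rw [Gα, Gβ]; linarith)
  refine ⟨t, ht, fun i => ?_⟩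
  have hev2 : ∀ᶠ h in 𝓝[>] (0:ℝ), h < t - α :=
    nhdsWithin_le_nhds (Iio_mem_nhds (by linarith [ht.1]))
  refine Eventually.frequently ?_
  filter_upwards [hev, hev2, self_mem_nhdsWithin] with h h1 h2 h3
  have h3 : 0 < h := h3
  have e1 : w i * (g i t - g i (t - h)) ≤ s * h := by
    refine le_trans ?_ h1
    rw [← (gsum t).tsum_sub (gsum (t-h)), mul_sub]
    refine ((gsum t).sub (gsum (t-h))).le_tsum (f := fun i => w i * g i t - w i * g i (t-h)) i ?_
    intro j _
    rw [← mul_sub]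
    exact mul_nonneg (hw j).le (sub_nonneg.2 (gmono j (by linarith)))
  have e2 : vol (Ω i ∩ {x | t - h ≤ u i x ∧ u i x < t}) = g i t - g i (t - h) := by
    have := vol_inter_add_diff (Ω := Ω i ∩ {x | α ≤ u i x ∧ u i x < min t β})
      (fin_inter (hf i) _) (sub_meas (hu i) (t - h))
    simp only [hg]
    rw [← this]
    have q1 : Ω i ∩ {x | α ≤ u i x ∧ u i x < min t β} ∩ {x | u i x < t - h}
        = Ω i ∩ {x | α ≤ u i x ∧ u i x < min (t - h) β} := by
      ext x
      have := ht.2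
      simp only [mem_inter_iff, mem_setOf_eq, min_eq_left ht.2.le, min_eq_left (show t - h ≤ β by linarith)]
      constructor
      · rintro ⟨⟨a, b, c⟩, d⟩; exact ⟨a, b, d⟩
      · rintro ⟨a, b, c⟩; exact ⟨⟨a, b, by linarith⟩, c⟩
    have q2 : (Ω i ∩ {x | α ≤ u i x ∧ u i x < min t β}) \ {x | u i x < t - h}
        = Ω i ∩ {x | t - h ≤ u i x ∧ u i x < t} := by
      ext x
      simp only [mem_inter_iff, Set.mem_sdiff, mem_setOf_eq, min_eq_left ht.2.le, not_lt]
      constructor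
      · rintro ⟨⟨a, b, c⟩, d⟩; exact ⟨a, d, c⟩
      · rintro ⟨a, b, c⟩; exact ⟨⟨a, by linarith, c⟩, b⟩
    rw [q1, q2]; ring
  rw [← ENNReal.ofReal_toReal (fin_inter (hf i) _).ne]
  refine ENNReal.ofReal_le_ofReal ?_
  change vol _ ≤ _
  rw [e2, div_mul_eq_mul_div, le_div_iff₀ (hw i), mul_comm]
  exact e1

lemma exists_slice {Ω : Set E3} {u : E3 → ℝ} (hf : volume Ω < ⊤) (hu : Measurable u)
    {α β s : ℝ} (hab : α < β)
    (hs : vol (Ω ∩ {x | α ≤ u x ∧ u x < β}) < s * (β - α)) :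
    ∃ t ∈ Ioo α β, SliceLe Ω u t s := by
  obtain ⟨t, ht, h⟩ := exists_slices (ι := Unit) (fun _ => Ω) (fun _ => u) (fun _ => hf)
    (fun _ => hu) (fun _ => 1) (fun _ => one_pos) (s := s) hab ((hasSum_fintype _).summable) (by simpa using hs)
  exact ⟨t, ht, by simpa using h ()⟩

lemma vol_ball (x : E3) (r : ℝ) : vol (ball x r) = vol (ball (0:E3) r) := by
  rw [vol, vol, Measure.addHaar_ball_center volume x r]

lemma vol_ball_pos {r : ℝ} (hr : 0 < r) (x : E3) : 0 < vol (ball x r) :=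
  ENNReal.toReal_pos (measure_ball_pos volume x hr).ne' measure_ball_lt_top.ne

lemma vol_ball_eq {r : ℝ} (hr : 0 ≤ r) : vol (ball (0:E3) r) = r ^ 3 * vol (ball (0:E3) 1) := by
  have := Measure.addHaar_ball (μ := (volume : Measure E3)) 0 hr
  rw [vol, this, ENNReal.toReal_mul, ENNReal.toReal_ofReal (by positivity)]
  simp [vol]

/-- A set with small perimeter relative to its volume has a volume bounded below. -/
lemma vol_lower {A : Set E3} (hA : MeasurableSet A) (hf : volume A < ⊤) (hp : HasFinPer A)
    {r : ℝ} (hr : 0 < r) (h : r * per A < (1/2) * vol A) : (1/2) * vol (ball (0:E3) r) ≤ vol A := by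
  obtain ⟨x, -, hx⟩ := exists_dense hA hf hp hA subset_rfl hr (θ := 1/2) h (by norm_num)
  have := vol_mono (A := A ∩ ball x r) inter_subset_left hf
  linarith

/-- universal radius -/
def r0 : ℝ := 1 / (4 * (muStar + 1))

lemma r0_pos : 0 < r0 := by
  have := muStar_nonneg
  unfold r0; positivity

def m0 : ℝ := (1/2) * vol (ball (0:E3) r0)
lemma m0_pos : 0 < m0 := mul_pos (by norm_num) (vol_ball_pos r0_pos 0)

lemma IsMinimizer.vol_pos {A : Set E3} (h : IsMinimizer A) : 0 < vol A :=
  ENNReal.toReal_pos h.2.2.1.ne' h.2.2.2.1.ne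

lemma IsMinimizer.m0_le {A : Set E3} (h : IsMinimizer A) : m0 ≤ vol A := by
  refine vol_lower h.1 h.2.2.2.1 h.2.1 r0_pos ?_
  have h1 : per A ≤ muStar * vol A := h.2.2.2.2 ▸ per_le_II h.2.2.2.1
  have h2 := h.vol_pos
  have h3 := muStar_nonneg
  calc r0 * per A ≤ r0 * (muStar * vol A) := mul_le_mul_of_nonneg_left h1 r0_pos.le
    _ = (muStar / (4 * (muStar + 1))) * vol A := by unfold r0; field_simp
    _ < 1/2 * vol A := by
      refine mul_lt_mul_of_pos_right ?_ h2
      rw [div_lt_iff₀ (by positivity)]; linarith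

lemma bddBelow_masses : BddBelow minimizerMasses := by
  refine ⟨0, ?_⟩
  rintro _ ⟨A, -, rfl⟩
  exact vol_nonneg A

lemma tail_small {A : Set E3} (hA : MeasurableSet A) (hf : volume A < ⊤) {ε : ℝ} (hε : 0 < ε) :
    ∃ R0 : ℝ, 0 < R0 ∧ ∀ R, R0 ≤ R → vol (A \ ball 0 R) < ε := by
  have h : Tendsto (fun n : ℕ => volume (A \ ball (0:E3) n)) atTop
      (𝓝 (volume (⋂ n : ℕ, A \ ball (0:E3) n))) := by
    refine tendsto_measure_iInter_atTop (fun n => (hA.diff measurableSet_ball).nullMeasurableSet) ?_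
      ⟨0, (fin_diff hf _).ne⟩
    intro n m hnm
    exact sdiff_subset_sdiff_right (ball_subset_ball (by exact_mod_cast hnm))
  have e : (⋂ n : ℕ, A \ ball (0:E3) n) = ∅ := by
    rw [eq_empty_iff_forall_notMem]
    intro x hx
    obtain ⟨n, hn⟩ := exists_nat_gt ‖x‖
    have := (mem_iInter.1 hx n).2
    exact this (by simpa using hn)
  rw [e, measure_empty] at h
  obtain ⟨n, hn⟩ := ((h.eventually (gt_mem_nhds (ENNReal.ofReal_pos.2 hε))).and
    (eventually_ge_atTop 1)).exists
  refine ⟨n, by exact_mod_cast hn.2, fun R hR => ?_⟩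
  have h1 : vol (A \ ball 0 R) ≤ vol (A \ ball 0 (n:ℝ)) :=
    vol_mono (sdiff_subset_sdiff_right (ball_subset_ball hR)) (fin_diff hf _)
  refine h1.trans_lt ?_
  have := (ENNReal.toReal_lt_toReal (fin_diff hf _).ne ENNReal.ofReal_ne_top).2 hn.1
  rwa [ENNReal.toReal_ofReal hε.le] at this

/-- the energy of a piece cut off from a minimizer -/
lemma min_cut {A : Set E3} (h : IsMinimizer A) {u : E3 → ℝ} (hu : ContDiff ℝ 1 u)
    (hL : LipschitzWith 1 u) {t s : ℝ} (hs0 : 0 ≤ s) (hs : SliceLe A u t s) :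
    HasFinPer (A \ {x | u x < t}) ∧
    II (A \ {x | u x < t}) ≤ muStar * vol (A \ {x | u x < t}) + 2 * C0 * s ∧
    (DD (A ∩ {x | u x < t}) (A \ {x | u x < t})).toReal ≤ 2 * C0 * s := by
  obtain ⟨hA, hp, -, hf, hI⟩ := h
  obtain ⟨h1, h2, h3⟩ := cut_II hA hf hp hu hL hs0 hs
  have hm := sub_meas hu.continuous.measurable t
  have e := vol_inter_add_diff hf hm
  have b1 := muStar_le (hA.inter hm) h1 (fin_inter hf _)
  have b2 := muStar_le (hA.diff hm) h2 (fin_diff hf _)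
  have b3 : 0 ≤ (DD (A ∩ {x | u x < t}) (A \ {x | u x < t})).toReal := ENNReal.toReal_nonneg
  rw [hI, ← e, mul_add] at h3
  exact ⟨h2, by linarith, by linarith⟩

def kap : ℝ := 1 / (128 * C0 + 4 * (muStar + 1))
lemma kap_pos : 0 < kap := by
  have := C0_pos
  have := muStar_nonneg
  unfold kap; positivity
lemma kap1 : kap * muStar ≤ 1/4 := by
  have := C0_pos
  have := muStar_nonneg
  unfold kap
  rw [div_mul_eq_mul_div, div_le_div_iff₀ (by positivity) (by norm_num)]; linarith
lemma kap2 : 128 * C0 * kap ≤ 1 := by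
  have := C0_pos
  have := muStar_nonneg
  unfold kap
  rw [mul_one_div, div_le_one (by positivity)]; linarith

lemma bdd_step {A : Set E3} (hM : IsMinimizer A) {t h : ℝ} (h0 : 0 < h) (h1 : h ≤ 1)
    (hv : vol (A \ {x | ub 0 x < t}) < 1/2 * ((kap * h) ^ 3 * vol (ball (0:E3) 1))) :
    vol (A \ {x | ub 0 x < t + h}) ≤ vol (A \ {x | ub 0 x < t}) / 8 := by
  obtain ⟨hA, hp, -, hf, hI⟩ := id hM
  set v := vol (A \ {x | ub 0 x < t}) with hvdef
  have hC := C0_pos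
  have mono : ∀ t', t ≤ t' → vol (A \ {x | ub 0 x < t'}) ≤ v := fun t' ht =>
    vol_mono (sdiff_subset_sdiff_right fun x hx => lt_of_lt_of_le hx ht) (fin_diff hf _)
  have v0 : 0 ≤ v := vol_nonneg _
  rcases v0.eq_or_lt with hz | hpos
  · have := mono (t + h) (by linarith)
    rw [← hz] at this ⊢
    linarith
  obtain ⟨t', ht', hsl⟩ := exists_slice (Ω := A) (u := ub 0) hf (ub_meas 0) (α := t) (β := t + h)
    (s := 2 * v / h) (by linarith) (by
      have e1 : vol (A ∩ {x | t ≤ ub 0 x ∧ ub 0 x < t + h}) ≤ v :=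
        vol_mono (fun x hx => ⟨hx.1, not_lt.2 hx.2.1⟩) (fin_diff hf _)
      have e2 : 2 * v / h * (t + h - t) = 2 * v := by field_simp; ring
      rw [e2]; linarith)
  obtain ⟨q1, q2, -⟩ := min_cut hM (ub_contDiff 0) (ub_lip 0) (by positivity) hsl
  have hv' := mono t' ht'.1.le
  have q3 := (per_le_II (fin_diff hf _)).trans q2
  set B := A \ {x | ub 0 x < t'} with hB
  have hmono2 : vol (A \ {x | ub 0 x < t + h}) ≤ vol B :=
    vol_mono (sdiff_subset_sdiff_right fun x hx => lt_trans hx ht'.2) (fin_diff hf _)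
  have hk := kap_pos
  have key : ¬ (kap * h * per B < 1/2 * vol B) := by
    intro hlt
    have := vol_lower (hA.diff (sub_meas (ub_meas 0) t')) (fin_diff hf _) q1 (r := kap * h)
      (by positivity) hlt
    rw [vol_ball_eq (by positivity)] at this
    linarith
  have hB0 : 0 ≤ vol B := vol_nonneg _
  have k1 := kap1
  have k2 := kap2
  push Not at key
  have k3 : kap * h * per B ≤ kap * h * (muStar * vol B + 2 * C0 * (2 * v / h)) :=
    mul_le_mul_of_nonneg_left q3 (by positivity)
  have k4 : kap * h * (muStar * vol B + 2 * C0 * (2 * v / h))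
      = h * (kap * muStar) * vol B + (128 * C0 * kap) * v / 32 := by field_simp; ring
  have k5 : h * (kap * muStar) * vol B ≤ 1/4 * vol B := by
    refine mul_le_mul_of_nonneg_right ?_ hB0
    have := mul_nonneg hk.le muStar_nonneg
    nlinarith
  have k6 : (128 * C0 * kap) * v ≤ 1 * v := mul_le_mul_of_nonneg_right k2 v0
  linarith

lemma minimizer_bdd {A : Set E3} (hM : IsMinimizer A) : ∃ R : ℝ, 0 < R ∧ volume (A \ ball 0 R) = 0 := by
  obtain ⟨hA, hp, -, hf, hI⟩ := id hM
  have hk := kap_pos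
  have hb := vol_ball_pos one_pos (0:E3)
  obtain ⟨R0, hR0, hR⟩ := tail_small hA hf
    (ε := 1/2 * (kap ^ 3 * vol (ball (0:E3) 1))) (by positivity)
  have key : ∀ k : ℕ, vol (A \ {x | ub 0 x < (R0 + 1) + 2 - 2 * (1/2) ^ k})
      < 1/2 * ((kap * (1/2) ^ k) ^ 3 * vol (ball (0:E3) 1)) := by
    intro k
    induction k with
    | zero =>
      refine lt_of_le_of_lt ?_ ((hR R0 le_rfl).trans_eq (by ring))
      refine vol_mono (sdiff_subset_sdiff_right ?_) (fin_diff hf _)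
      refine Subset.trans ?_ (ball_sub_ub 0 _)
      exact ball_subset_ball (by norm_num)
    | succ k ih =>
      have := bdd_step hM (by positivity) (pow_le_one₀ (by norm_num) (by norm_num)) ih
      have e : (R0 + 1) + 2 - 2 * (1/2 : ℝ) ^ k + (1/2) ^ k = (R0 + 1) + 2 - 2 * (1/2) ^ (k+1) := by
        rw [pow_succ]; ring
      rw [e] at this
      refine this.trans_lt ?_
      have e2 : (kap * (1/2 : ℝ) ^ (k+1)) ^ 3 = (kap * (1/2 : ℝ) ^ k) ^ 3 / 8 := by
        rw [pow_succ]; ring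
      rw [e2]; linarith
  refine ⟨R0 + 3, by linarith, ?_⟩
  have h0 : vol (A \ ball 0 (R0 + 3)) ≤ 0 := by
    have lim : Tendsto (fun k : ℕ => 1/2 * ((kap * (1/2) ^ k) ^ 3 * vol (ball (0:E3) 1))) atTop (𝓝 0) := by
      have := tendsto_pow_atTop_nhds_zero_of_lt_one (r := (1/2 : ℝ)) (by norm_num) (by norm_num)
      have := (((this.const_mul kap).pow 3).mul_const (vol (ball (0:E3) 1))).const_mul (1/2 : ℝ)
      simpa using this
    refine ge_of_tendsto' lim fun k => le_trans ?_ (key k).le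
    refine vol_mono (sdiff_subset_sdiff_right ?_) (fin_diff hf _)
    refine (ub_sub_ball 0 _).trans (ball_subset_ball ?_)
    have : (0:ℝ) < (1/2) ^ k := by positivity
    linarith
  have := le_antisymm h0 (vol_nonneg _)
  rw [vol, ENNReal.toReal_eq_zero_iff] at this
  exact this.resolve_right (fin_diff hf _).ne

/-! ### Upper bound on the mass of minimizers -/

lemma coord_contDiff (i : Fin 3) : ContDiff ℝ 1 (fun x : E3 => x i) := by fun_prop

lemma coord_lip (i : Fin 3) : LipschitzWith 1 (fun x : E3 => x i) := by
  refine LipschitzWith.of_le_add fun x y => ?_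
  have : |(x - y) i| ≤ ‖x - y‖ := by
    simpa only [Real.norm_eq_abs] using PiLp.norm_apply_le (x - y) i
  rw [dist_eq_norm]
  have h2 := le_abs_self ((x - y) i)
  simp only [PiLp.sub_apply] at h2 this
  linarith

lemma min_deriv {A : Set E3} (h : IsMinimizer A) {u : E3 → ℝ} (hu : ContDiff ℝ 1 u)
    (hL : LipschitzWith 1 u) {t : ℝ}
    (hd : DifferentiableAt ℝ (fun t => vol (A ∩ {x | u x < t})) t)
    (hd0 : 0 ≤ deriv (fun t => vol (A ∩ {x | u x < t})) t) :
    (DD (A ∩ {x | u x < t}) (A \ {x | u x < t})).toReal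
      ≤ 2 * C0 * deriv (fun t => vol (A ∩ {x | u x < t})) t := by
  set G := fun t => vol (A ∩ {x | u x < t}) with hG
  have hf := h.2.2.2.1
  have hC := C0_pos
  refine le_of_forall_pos_le_add fun ε hε => ?_
  have key : SliceLe A u t (deriv G t + ε / (2 * C0)) := by
    have h1 : Tendsto (fun h : ℝ => h⁻¹ * (G (t - h) - G t)) (𝓝[>] 0) (𝓝 (- deriv G t)) := by
      have h2 : HasDerivAt (fun h : ℝ => G (t - h)) (- deriv G t) 0 := by
        exact HasDerivAt.comp_const_sub t 0 (by rw [sub_zero]; exact hd.hasDerivAt)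
      have := h2.tendsto_slope_zero_right
      simpa using this
    have h3 := h1.eventually (lt_mem_nhds (a := - (deriv G t + ε / (2 * C0)))
      (by have : 0 < ε / (2 * C0) := by positivity
          linarith))
    refine Eventually.frequently ?_
    filter_upwards [h3, self_mem_nhdsWithin] with h h4 h5
    have h5 : 0 < h := h5
    rw [inv_mul_eq_div, lt_div_iff₀ h5] at h4
    rw [← ENNReal.ofReal_toReal (fin_inter hf _).ne]
    refine ENNReal.ofReal_le_ofReal ?_
    change vol _ ≤ _
    have e := vol_inter_add_diff (Ω := A ∩ {x | u x < t})
      (fin_inter hf _) (sub_meas hu.continuous.measurable (t - h))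
    have q1 : A ∩ {x | u x < t} ∩ {x | u x < t - h} = A ∩ {x | u x < t - h} := by
      ext x
      simp only [mem_inter_iff, mem_setOf_eq]
      constructor
      · rintro ⟨⟨a, b⟩, d⟩; exact ⟨a, d⟩
      · rintro ⟨a, b⟩; exact ⟨⟨a, by linarith⟩, b⟩
    have q2 : (A ∩ {x | u x < t}) \ {x | u x < t - h} = A ∩ {x | t - h ≤ u x ∧ u x < t} := by
      ext x
      simp only [mem_inter_iff, Set.mem_sdiff, mem_setOf_eq, not_lt]
      constructor
      · rintro ⟨⟨a, c⟩, d⟩; exact ⟨a, d, c⟩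
      · rintro ⟨a, b, c⟩; exact ⟨⟨a, c⟩, b⟩
    rw [q1, q2] at e
    have e' : G (t - h) + vol (A ∩ {x | t - h ≤ u x ∧ u x < t}) = G t := e
    linarith
  have := (min_cut h hu hL (by positivity) key).2.2
  refine this.trans_eq ?_
  field_simp

lemma int_DD {A : Set E3} (h : IsMinimizer A) {u : E3 → ℝ} (hu : ContDiff ℝ 1 u)
    (hL : LipschitzWith 1 u) :
    ∫⁻ t : ℝ, DD (A ∩ {x | u x < t}) (A \ {x | u x < t}) ≤ ENNReal.ofReal (2 * C0 * vol A) := by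
  have hf := h.2.2.2.1
  have hC := C0_pos
  set G := fun t => vol (A ∩ {x | u x < t}) with hG
  have hGm : Monotone G := fun t t' htt =>
    vol_mono (inter_subset_inter_right _ fun x hx => lt_of_lt_of_le hx htt) (fin_inter hf _)
  have hd := hGm.ae_differentiableAt
  have hd0 : ∀ t, 0 ≤ deriv G t := fun t => hGm.deriv_nonneg
  have hpt : ∀ᵐ t : ℝ, DD (A ∩ {x | u x < t}) (A \ {x | u x < t})
      ≤ ENNReal.ofReal (2 * C0 * deriv G t) := by
    filter_upwards [hd] with t ht
    have := min_deriv h hu hL ht (hd0 t)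
    rw [← ENNReal.ofReal_toReal (DD_fin (fin_inter hf _) (fin_diff hf _)).ne]
    exact ENNReal.ofReal_le_ofReal this
  have hN : ∀ N : ℕ, ∫⁻ t in Ioc (-(N:ℝ)) N, DD (A ∩ {x | u x < t}) (A \ {x | u x < t})
      ≤ ENNReal.ofReal (2 * C0 * vol A) := by
    intro N
    have hle : -(N:ℝ) ≤ N := by have : (0:ℝ) ≤ N := N.cast_nonneg
                                linarith
    have hi : IntervalIntegrable (deriv G) volume (-(N:ℝ)) N :=
      (hGm.monotoneOn _).intervalIntegrable_deriv
    have hle2 : ∫ t in (-(N:ℝ))..N, deriv G t ≤ vol A := by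
      have h1 := (hGm.monotoneOn (uIcc (-(N:ℝ)) N)).intervalIntegral_deriv_mem_uIcc
      have h2 : 0 ≤ G N - G (-N) := sub_nonneg.2 (hGm hle)
      rw [uIcc_of_le h2] at h1
      have h3 : G N ≤ vol A := vol_mono inter_subset_left hf
      have h4 : 0 ≤ G (-N) := vol_nonneg _
      linarith [h1.2]
    calc _ ≤ ∫⁻ t in Ioc (-(N:ℝ)) N, ENNReal.ofReal (2 * C0 * deriv G t) :=
          lintegral_mono_ae (ae_restrict_of_ae hpt)
      _ = ENNReal.ofReal (∫ t in Ioc (-(N:ℝ)) N, 2 * C0 * deriv G t) := by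
          rw [ofReal_integral_eq_lintegral_ofReal]
          · exact (((intervalIntegrable_iff_integrableOn_Ioc_of_le hle).1 hi).const_mul _)
          · exact Eventually.of_forall fun t => mul_nonneg (by positivity) (hd0 t)
      _ ≤ _ := by
          refine ENNReal.ofReal_le_ofReal ?_
          rw [integral_const_mul, ← intervalIntegral.integral_of_le hle]
          exact mul_le_mul_of_nonneg_left hle2 (by positivity)
  have hU : (⋃ N : ℕ, Ioc (-(N:ℝ)) N) = univ := by
    rw [eq_univ_iff_forall]
    intro x
    obtain ⟨n, hn⟩ := exists_nat_gt |x|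
    have := abs_lt.1 hn
    exact mem_iUnion.2 ⟨n, this.1, this.2.le⟩
  rw [← setLIntegral_univ, ← hU, setLIntegral_iUnion_of_directed]
  · exact iSup_le hN
  · refine Monotone.directed_le ?_
    intro a b hab
    have : (a:ℝ) ≤ b := by exact_mod_cast hab
    exact Ioc_subset_Ioc (by linarith) this

lemma DD_layer (A : Set E3) {u : E3 → ℝ} (hu : Measurable u) (hA : MeasurableSet A) :
    ∫⁻ t : ℝ, DD (A ∩ {x | u x < t}) (A \ {x | u x < t})
      = ∫⁻ x in A, ∫⁻ y in A, kk x y * ENNReal.ofReal (u y - u x) := by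
  set f : ℝ → E3 → E3 → ℝ≥0∞ := fun t x y => kk x y * (Ioc (u x) (u y)).indicator 1 t with hfdef
  have hfm : Measurable (fun p : ℝ × E3 × E3 => f p.1 p.2.1 p.2.2) := by
    have h1 : Measurable (fun p : ℝ × E3 × E3 => kk p.2.1 p.2.2) := kk_meas.comp measurable_snd
    have h2 : Measurable (fun p : ℝ × E3 × E3 => (Ioc (u p.2.1) (u p.2.2)).indicator (1 : ℝ → ℝ≥0∞) p.1) := by
      have hs : MeasurableSet {p : ℝ × E3 × E3 | u p.2.1 < p.1 ∧ p.1 ≤ u p.2.2} := by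
        have a1 : MeasurableSet {p : ℝ × E3 × E3 | u p.2.1 < p.1} :=
          measurableSet_lt (by fun_prop) (by fun_prop)
        have a2 : MeasurableSet {p : ℝ × E3 × E3 | p.1 ≤ u p.2.2} :=
          measurableSet_le (by fun_prop) (by fun_prop)
        exact a1.inter a2
      have : (fun p : ℝ × E3 × E3 => (Ioc (u p.2.1) (u p.2.2)).indicator (1 : ℝ → ℝ≥0∞) p.1)
          = {p : ℝ × E3 × E3 | u p.2.1 < p.1 ∧ p.1 ≤ u p.2.2}.indicator 1 := by
        ext p; simp [indicator, mem_Ioc]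
      rw [this]
      exact measurable_one.indicator hs
    exact h1.mul h2
  clear_value f
  have e1 : ∀ t, DD (A ∩ {x | u x < t}) (A \ {x | u x < t}) = ∫⁻ x in A, ∫⁻ y in A, f t x y := by
    intro t
    have hm := sub_meas hu t
    unfold DD
    rw [inter_comm, ← Measure.restrict_restrict hm, ← lintegral_indicator hm]
    refine lintegral_congr fun x => ?_
    by_cases hx : u x < t
    · rw [indicator_of_mem (by exact hx), Set.sdiff_eq, inter_comm, ← Measure.restrict_restrict hm.compl,
        ← lintegral_indicator hm.compl]
      refine lintegral_congr fun y => ?_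
      by_cases hy : u y < t
      · rw [indicator_of_notMem (by simpa using hy), hfdef]
        simp [indicator, hy]
      · rw [indicator_of_mem (by simpa using hy), hfdef]
        push Not at hy
        simp [indicator, hx, hy]
    · rw [indicator_of_notMem (by simpa using hx), hfdef]
      simp [indicator, hx]
  simp_rw [e1]
  rw [lintegral_lintegral_swap]
  · refine lintegral_congr fun x => ?_
    rw [lintegral_lintegral_swap]
    · refine lintegral_congr fun y => ?_
      simp only [hfdef]
      rw [lintegral_const_mul _ (measurable_one.indicator measurableSet_Ioc),
        lintegral_indicator_one measurableSet_Ioc, Real.volume_Ioc]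
    · have : Measurable (fun p : ℝ × E3 => f p.1 x p.2) :=
        hfm.comp (measurable_fst.prodMk (measurable_const.prodMk measurable_snd))
      exact this.aemeasurable
  · have : Measurable (fun q : (ℝ × E3) × E3 => f q.1.1 q.1.2 q.2) :=
      hfm.comp ((measurable_fst.comp measurable_fst).prodMk
        ((measurable_snd.comp measurable_fst).prodMk measurable_snd))
    have h3 : Measurable (fun p : ℝ × E3 => ∫⁻ y in A, f p.1 p.2 y) :=
      Measurable.lintegral_prod_right' (ν := volume.restrict A) this
    exact h3.aemeasurable

lemma kk_sum {x y : E3} (hxy : x ≠ y) :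
    1 ≤ ∑ i : Fin 3, (kk x y * ENNReal.ofReal (y i - x i) + kk x y * ENNReal.ofReal (x i - y i)) := by
  have hpos : 0 < ‖x - y‖ := norm_pos_iff.2 (sub_ne_zero.2 hxy)
  have h1 : ‖x - y‖ ≤ ∑ i : Fin 3, |x i - y i| := by
    rw [EuclideanSpace.norm_eq]
    refine Real.sqrt_le_iff.2 ⟨Finset.sum_nonneg fun i _ => abs_nonneg _, ?_⟩
    simp only [Fin.sum_univ_three, PiLp.sub_apply, Real.norm_eq_abs]
    nlinarith [abs_nonneg (x 0 - y 0), abs_nonneg (x 1 - y 1), abs_nonneg (x 2 - y 2),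
      mul_nonneg (abs_nonneg (x 0 - y 0)) (abs_nonneg (x 1 - y 1)),
      mul_nonneg (abs_nonneg (x 0 - y 0)) (abs_nonneg (x 2 - y 2)),
      mul_nonneg (abs_nonneg (x 1 - y 1)) (abs_nonneg (x 2 - y 2))]
  have h2 : ∀ i, kk x y * ENNReal.ofReal (y i - x i) + kk x y * ENNReal.ofReal (x i - y i)
      = ENNReal.ofReal (1 / ‖x - y‖ * |x i - y i|) := by
    intro i
    rw [← mul_add, ENNReal.ofReal_mul (by positivity), kk]
    congr 1
    rcases le_total (x i) (y i) with h | h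
    · rw [abs_of_nonpos (by linarith), ENNReal.ofReal_of_nonpos (p := x i - y i) (by linarith), add_zero]
      congr 1; ring
    · rw [abs_of_nonneg (by linarith), ENNReal.ofReal_of_nonpos (p := y i - x i) (by linarith), zero_add]
  simp_rw [h2]
  rw [← ENNReal.ofReal_sum_of_nonneg (fun i _ => by positivity), ← Finset.mul_sum]
  rw [← ENNReal.ofReal_one]
  refine ENNReal.ofReal_le_ofReal ?_
  rw [one_div, inv_mul_eq_div, le_div_iff₀ hpos, one_mul]
  exact h1

lemma lint_sum (A : Set E3) (F G : Fin 3 → E3 → E3 → ℝ≥0∞)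
    (hm : ∀ i, Measurable fun p : E3 × E3 => F i p.1 p.2)
    (hm' : ∀ i, Measurable fun p : E3 × E3 => G i p.1 p.2) :
    ∫⁻ x in A, ∫⁻ y in A, ∑ i : Fin 3, (F i x y + G i x y)
      = ∑ i : Fin 3, ((∫⁻ x in A, ∫⁻ y in A, F i x y) + ∫⁻ x in A, ∫⁻ y in A, G i x y) := by
  have c1 : ∀ (i : Fin 3) (x : E3), Measurable fun y => F i x y :=
    fun i x => (hm i).comp (measurable_const.prodMk measurable_id)
  have c2 : ∀ (i : Fin 3) (x : E3), Measurable fun y => G i x y :=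
    fun i x => (hm' i).comp (measurable_const.prodMk measurable_id)
  have d1 : ∀ i : Fin 3, Measurable fun x => ∫⁻ y in A, F i x y :=
    fun i => Measurable.lintegral_prod_right' (ν := volume.restrict A) (hm i)
  have d2 : ∀ i : Fin 3, Measurable fun x => ∫⁻ y in A, G i x y :=
    fun i => Measurable.lintegral_prod_right' (ν := volume.restrict A) (hm' i)
  have e1 : ∀ x : E3, ∫⁻ y in A, ∑ i : Fin 3, (F i x y + G i x y)
      = ∑ i : Fin 3, ((∫⁻ y in A, F i x y) + ∫⁻ y in A, G i x y) := by
    intro x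
    refine (lintegral_finsetSum _ fun i _ => (c1 i x).add (c2 i x)).trans ?_
    exact Finset.sum_congr rfl fun i _ => lintegral_add_left (c1 i x) _
  simp_rw [e1]
  refine (lintegral_finsetSum _ fun i _ => (d1 i).add (d2 i)).trans ?_
  exact Finset.sum_congr rfl fun i _ => lintegral_add_left (d1 i) _

lemma minimizer_mass_le {A : Set E3} (h : IsMinimizer A) : vol A ≤ 12 * C0 := by
  obtain ⟨hA, hp, -, hf, -⟩ := id h
  have hC := C0_pos
  have key : ∀ i : Fin 3, ∫⁻ x in A, ∫⁻ y in A, kk x y * ENNReal.ofReal (y i - x i)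
      ≤ ENNReal.ofReal (2 * C0 * vol A) := fun i => by
    rw [← DD_layer A (u := fun x : E3 => x i) (coord_contDiff i).continuous.measurable hA]
    exact int_DD h (coord_contDiff i) (coord_lip i)
  have hm : ∀ i : Fin 3, Measurable (fun p : E3 × E3 => kk p.1 p.2 * ENNReal.ofReal (p.2 i - p.1 i)) :=
    fun i => kk_meas.mul (by fun_prop)
  have hm' : ∀ i : Fin 3, Measurable (fun p : E3 × E3 => kk p.1 p.2 * ENNReal.ofReal (p.1 i - p.2 i)) :=
    fun i => kk_meas.mul (by fun_prop)
  have key2 : ∀ i : Fin 3, ∫⁻ x in A, ∫⁻ y in A, kk x y * ENNReal.ofReal (x i - y i)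
      ≤ ENNReal.ofReal (2 * C0 * vol A) := fun i => by
    rw [lintegral_lintegral_swap (hm' i).aemeasurable]
    simp_rw [fun x y => kk_symm x y]
    exact key i
  have tot : volume A * volume A ≤ ∑ i : Fin 3, (ENNReal.ofReal (2 * C0 * vol A) + ENNReal.ofReal (2 * C0 * vol A)) := by
    calc volume A * volume A = ∫⁻ x in A, ∫⁻ y in A, 1 := by simp
      _ ≤ ∫⁻ x in A, ∫⁻ y in A, ∑ i : Fin 3, (kk x y * ENNReal.ofReal (y i - x i) + kk x y * ENNReal.ofReal (x i - y i)) := by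
          refine lintegral_mono fun x => lintegral_mono_ae ?_
          have : ∀ᵐ y : E3, x ≠ y := by
            have h0 : volume ({x} : Set E3) = 0 := measure_singleton x
            filter_upwards [measure_eq_zero_iff_ae_notMem.1 h0] with y hy hxy
            exact hy (by simp [hxy])
          filter_upwards [ae_restrict_of_ae this] with y hy
          exact kk_sum hy
      _ = ∑ i : Fin 3, ((∫⁻ x in A, ∫⁻ y in A, kk x y * ENNReal.ofReal (y i - x i)) + ∫⁻ x in A, ∫⁻ y in A, kk x y * ENNReal.ofReal (x i - y i)) := by
          exact lint_sum A (fun i x y => kk x y * ENNReal.ofReal (y i - x i))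
            (fun i x y => kk x y * ENNReal.ofReal (x i - y i)) hm hm'
      _ ≤ _ := Finset.sum_le_sum fun i _ => add_le_add (key i) (key2 i)
  simp only [Finset.sum_const, Finset.card_univ, Fintype.card_fin] at tot
  rw [← ENNReal.ofReal_add (by have := vol_nonneg A; positivity) (by have := vol_nonneg A; positivity)] at tot
  have t2 := ENNReal.toReal_mono (by simp [ENNReal.mul_eq_top]) tot
  rw [ENNReal.toReal_mul, nsmul_eq_mul, ENNReal.toReal_mul, ENNReal.toReal_ofReal (by have := vol_nonneg A; positivity)] at t2
  change vol A * vol A ≤ _ at t2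
  have hv := h.vol_pos
  simp at t2
  refine le_of_mul_le_mul_right (a := vol A) ?_ hv
  linarith

lemma bddAbove_masses : BddAbove minimizerMasses := by
  refine ⟨12 * C0, ?_⟩
  rintro _ ⟨A, hA, rfl⟩
  exact minimizer_mass_le hA

lemma IsMinimizer.mass_bounds {A : Set E3} (h : IsMinimizer A) : mStarStar ≤ vol A ∧ vol A ≤ mStar :=
  ⟨csInf_le bddBelow_masses ⟨A, h, rfl⟩, le_csSup bddAbove_masses ⟨A, h, rfl⟩⟩

lemma weak_conv (A : ℕ → Set E3) (hA : ∀ n, MeasurableSet (A n)) (hf : ∀ n, volume (A n) < ⊤)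
    {M : ℝ} (hM : ∀ n, vol (A n) ≤ M) : ∃ ψ : ℕ → ℕ, StrictMono ψ ∧ ∀ B : Set E3, MeasurableSet B →
      volume B < ⊤ → ∃ l : ℝ, Tendsto (fun n => vol (A (ψ n) ∩ B)) atTop (𝓝 l) := by
  have : Fact ((2:ℝ≥0∞) ≠ ⊤) := ⟨by simp⟩
  set H := Lp ℝ 2 (volume : Measure E3) with hH
  set f : ℕ → H := fun n => indicatorConstLp 2 (hA n) (hf n).ne (1:ℝ) with hfd
  set g : ℕ → WeakDual ℝ H := fun n => StrongDual.toWeakDual (InnerProductSpace.toDual ℝ H (f n)) with hg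
  have hmem : ∀ n, g n ∈ WeakDual.toStrongDual ⁻¹' closedBall (0 : StrongDual ℝ H) (√M) := by
    intro n
    rw [mem_preimage, mem_closedBall, dist_zero_right]
    change ‖InnerProductSpace.toDual ℝ H (f n)‖ ≤ _
    rw [LinearIsometryEquiv.norm_map, hfd, norm_indicatorConstLp (by simp) (by simp)]
    simp only [norm_one, one_mul]
    have : (volume.real (A n)) ^ (1 / (2:ℝ≥0∞).toReal) = √(vol (A n)) := by
      rw [Real.sqrt_eq_rpow]; rfl
    rw [this]
    exact Real.sqrt_le_sqrt (hM n)
  obtain ⟨l, -, ψ, hψ, hlim⟩ := WeakDual.isSeqCompact_closedBall ℝ H 0 (√M) hmem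
  refine ⟨ψ, hψ, fun B hB hBf => ?_⟩
  set e : H := indicatorConstLp 2 hB hBf.ne (1:ℝ)
  refine ⟨l e, ?_⟩
  have h1 := ((WeakDual.eval_continuous e).tendsto l).comp hlim
  refine h1.congr fun n => ?_
  change inner ℝ (f (ψ n)) e = _
  rw [L2.inner_indicatorConstLp_indicatorConstLp (hA (ψ n)) hB (hf _).ne hBf.ne]
  simp [vol, Measure.real]

lemma F_meas {A : Set E3} (hA : MeasurableSet A) (r : ℝ) :
    Measurable (fun x => volume (A ∩ ball x r)) := by
  have e : ∀ x, volume (A ∩ ball x r) = ∫⁻ y in A, ({p : E3 × E3 | dist p.2 p.1 < r}).indicator 1 (x, y) := by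
    intro x
    have : ∀ y, ({p : E3 × E3 | dist p.2 p.1 < r}).indicator (1 : E3 × E3 → ℝ≥0∞) (x, y) = (ball x r).indicator 1 y := by
      intro y; simp [indicator]
    simp_rw [this]
    rw [lintegral_indicator_one measurableSet_ball, Measure.restrict_apply measurableSet_ball, inter_comm]
  simp_rw [e]
  have hm : MeasurableSet {p : E3 × E3 | dist p.2 p.1 < r} :=
    measurableSet_lt (by fun_prop) measurable_const
  exact Measurable.lintegral_prod_right' (ν := volume.restrict A) (measurable_one.indicator hm)

lemma cauchy_est {A B : Set E3} (hA : MeasurableSet A) (hAf : volume A < ⊤) (hAp : HasFinPer A)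
    (hB : MeasurableSet B) (hBf : volume B < ⊤) (hBp : HasFinPer B) {r : ℝ} (hr : 0 ≤ r) (ρ : ℝ) :
    volume (ball (0:E3) r) * volume ((A \ B) ∩ ball 0 ρ) ≤
      volume (ball (0:E3) r) * ENNReal.ofReal (r * per A)
      + volume (ball (0:E3) r) * ENNReal.ofReal (r * per B)
      + ∫⁻ x in ball (0:E3) ρ, (volume (A ∩ ball x r) - volume (B ∩ ball x r)) := by
  set X := (A \ B) ∩ ball (0:E3) ρ
  have h1 : ∀ x, volume (ball (0:E3) r) ≤ volume (ball x r \ A) + volume (B ∩ ball x r)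
      + (volume (A ∩ ball x r) - volume (B ∩ ball x r)) := by
    intro x
    rw [← Measure.addHaar_ball_center volume x r, ← measure_inter_add_sdiff (ball x r) hA, inter_comm, add_comm,
      add_assoc]
    gcongr
    exact le_add_tsub
  have m2 := (F_meas hB r)
  have m3 := (F_meas hA r).sub (F_meas hB r)
  calc volume (ball (0:E3) r) * volume X = ∫⁻ x in X, volume (ball (0:E3) r) := by simp
    _ ≤ ∫⁻ x in X, (volume (ball x r \ A) + volume (B ∩ ball x r)
      + (volume (A ∩ ball x r) - volume (B ∩ ball x r))) := lintegral_mono h1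
    _ = (∫⁻ x in X, volume (ball x r \ A)) + (∫⁻ x in X, volume (B ∩ ball x r))
      + ∫⁻ x in X, (volume (A ∩ ball x r) - volume (B ∩ ball x r)) := by
        rw [lintegral_add_right _ (by exact m3), lintegral_add_right _ m2]
    _ ≤ (∫⁻ x in A, volume (ball x r \ A)) + (∫⁻ x in Bᶜ, volume (B ∩ ball x r))
      + ∫⁻ x in ball (0:E3) ρ, (volume (A ∩ ball x r) - volume (B ∩ ball x r)) := by
        gcongr
        · exact fun x hx => hx.1.1
        · exact fun x hx => hx.1.2
        · exact fun x hx => hx.2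
    _ ≤ _ := by
        gcongr
        · exact J_est2 hA hAf hAp hr
        · exact J_est hB hBf hBp hr

lemma cauchy_loc (A : ℕ → Set E3) (hA : ∀ n, MeasurableSet (A n)) (hf : ∀ n, volume (A n) < ⊤)
    (hp : ∀ n, HasFinPer (A n)) {C : ℝ} (hC : ∀ n, per (A n) ≤ C)
    (hw : ∀ B : Set E3, MeasurableSet B →
      volume B < ⊤ → ∃ l : ℝ, Tendsto (fun n => vol (A n ∩ B)) atTop (𝓝 l)) (ρ : ℝ) {e : ℝ} (he : 0 < e) :
    ∃ N, ∀ n ≥ N, ∀ k ≥ N, volume ((A n \ A k) ∩ ball 0 ρ) ≤ ENNReal.ofReal e := by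
  have hC0 : 0 ≤ C := (per_nonneg (A 0)).trans (hC 0)
  set r := e / (4 * (C + 1)) with hr
  have hr0 : 0 < r := by positivity
  choose l hl using fun x : E3 => hw (ball x r) measurableSet_ball measure_ball_lt_top
  set F : ℕ → E3 → ℝ≥0∞ := fun n x => volume (A n ∩ ball x r) with hF
  have hFm : ∀ n, Measurable (F n) := fun n => F_meas (hA n) r
  have hFl : ∀ x, Tendsto (fun n => F n x) atTop (𝓝 (ENNReal.ofReal (l x))) := by
    intro x
    refine (ENNReal.tendsto_ofReal (hl x)).congr fun n => ?_
    exact ENNReal.ofReal_toReal (fin_inter (hf n) _).ne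
  have hlm : Measurable fun x => ENNReal.ofReal (l x) :=
    measurable_of_tendsto_metrizable hFm (tendsto_pi_nhds.2 hFl)
  have hFb : ∀ n x, F n x ≤ volume (ball (0:E3) r) := fun n x => by
    rw [← Measure.addHaar_ball_center volume x r]; exact measure_mono inter_subset_right
  have hlb : ∀ x, ENNReal.ofReal (l x) ≤ volume (ball (0:E3) r) := fun x =>
    le_of_tendsto' (hFl x) fun n => hFb n x
  have hbf : ∫⁻ x in ball (0:E3) ρ, volume (ball (0:E3) r) ≠ ⊤ := by
    simp only [lintegral_const, Measure.restrict_apply MeasurableSet.univ, univ_inter]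
    exact (ENNReal.mul_lt_top measure_ball_lt_top measure_ball_lt_top).ne
  have t1 : Tendsto (fun n => ∫⁻ x in ball (0:E3) ρ, (F n x - ENNReal.ofReal (l x))) atTop (𝓝 0) := by
    have := tendsto_lintegral_of_dominated_convergence (μ := volume.restrict (ball (0:E3) ρ))
      (F := fun n x => F n x - ENNReal.ofReal (l x)) (f := fun _ => 0) (fun _ => volume (ball (0:E3) r))
      (fun n => (hFm n).sub hlm) (fun n => Eventually.of_forall fun x => tsub_le_self.trans (hFb n x)) hbf
      (Eventually.of_forall fun x => by
        have := ENNReal.Tendsto.sub (hFl x) (tendsto_const_nhds (x := ENNReal.ofReal (l x))) (Or.inl ENNReal.ofReal_ne_top)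
        simpa using this)
    simpa using this
  have t2 : Tendsto (fun n => ∫⁻ x in ball (0:E3) ρ, (ENNReal.ofReal (l x) - F n x)) atTop (𝓝 0) := by
    have := tendsto_lintegral_of_dominated_convergence (μ := volume.restrict (ball (0:E3) ρ))
      (F := fun n x => ENNReal.ofReal (l x) - F n x) (f := fun _ => 0) (fun _ => volume (ball (0:E3) r))
      (fun n => hlm.sub (hFm n)) (fun n => Eventually.of_forall fun x => tsub_le_self.trans (hlb x)) hbf
      (Eventually.of_forall fun x => by
        have := ENNReal.Tendsto.sub (tendsto_const_nhds (x := ENNReal.ofReal (l x))) (hFl x) (Or.inl ENNReal.ofReal_ne_top)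
        simpa using this)
    simpa using this
  have hb0 : 0 < volume (ball (0:E3) r) := measure_ball_pos _ _ hr0
  have hδ : 0 < volume (ball (0:E3) r) * ENNReal.ofReal (e / 4) :=
    ENNReal.mul_pos hb0.ne' (ENNReal.ofReal_pos.2 (by positivity)).ne'
  obtain ⟨N, hN⟩ := eventually_atTop.1 ((t1.eventually (ge_mem_nhds hδ)).and (t2.eventually (ge_mem_nhds hδ)))
  refine ⟨N, fun n hn k hk => ?_⟩
  have h1 := cauchy_est (hA n) (hf n) (hp n) (hA k) (hf k) (hp k) hr0.le ρ
  have h2 : ∫⁻ x in ball (0:E3) ρ, (F n x - F k x) ≤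
      volume (ball (0:E3) r) * ENNReal.ofReal (e / 4) + volume (ball (0:E3) r) * ENNReal.ofReal (e / 4) := by
    refine le_trans ?_ (add_le_add (hN n hn).1 (hN k hk).2)
    rw [← lintegral_add_left (by exact (hFm n).sub hlm)]
    exact lintegral_mono fun x => tsub_le_tsub_add_tsub
  have h3 : ∀ n, ENNReal.ofReal (r * per (A n)) ≤ ENNReal.ofReal (e / 4) := fun n => by
    refine ENNReal.ofReal_le_ofReal ?_
    calc r * per (A n) ≤ r * C := mul_le_mul_of_nonneg_left (hC n) hr0.le
      _ = e / 4 * (C / (C + 1)) := by rw [hr]; field_simp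
      _ ≤ e / 4 * 1 := by
        refine mul_le_mul_of_nonneg_left ?_ (by positivity)
        rw [div_le_one (by positivity)]; linarith
      _ = _ := mul_one _
  have h4 : volume (ball (0:E3) r) * volume ((A n \ A k) ∩ ball 0 ρ)
      ≤ volume (ball (0:E3) r) * ENNReal.ofReal e := by
    refine h1.trans ((add_le_add (add_le_add (mul_le_mul_right (h3 n) _) (mul_le_mul_right (h3 k) _)) h2).trans_eq ?_)
    rw [← mul_add, ← mul_add, ← ENNReal.ofReal_add (by positivity) (by positivity),
      ← ENNReal.ofReal_add (by positivity) (by positivity)]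
    congr 2; ring
  exact (ENNReal.mul_le_mul_iff_right hb0.ne' measure_ball_lt_top.ne).1 h4

lemma limit_set (A : ℕ → Set E3) (hA : ∀ n, MeasurableSet (A n))
    (hc : ∀ (ρ : ℝ) (e : ℝ), 0 < e → ∃ N, ∀ n ≥ N, ∀ k ≥ N, volume ((A n \ A k) ∩ ball 0 ρ) ≤ ENNReal.ofReal e) :
    ∃ φ : ℕ → ℕ, StrictMono φ ∧ ∃ B, MeasurableSet B ∧
      ∀ ρ, Tendsto (fun n => volume (symmDiff (A (φ n)) B ∩ ball 0 ρ)) atTop (𝓝 0) := by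
  obtain ⟨φ, hφ, hP⟩ := extraction_forall_of_eventually'
    (P := fun k n => ∀ m ≥ n, volume (symmDiff (A n) (A m) ∩ ball 0 (k:ℝ)) ≤ (2⁻¹ : ℝ≥0∞) ^ k) (by
      intro k
      obtain ⟨N, hN⟩ := hc k ((1/2) ^ k / 2) (by positivity)
      refine ⟨N, fun n hn m hm => ?_⟩
      have e1 : symmDiff (A n) (A m) ∩ ball 0 (k:ℝ) ⊆ ((A n \ A m) ∩ ball 0 (k:ℝ)) ∪ ((A m \ A n) ∩ ball 0 (k:ℝ)) := by
        rintro x ⟨h1 | h1, h2⟩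
        · exact Or.inl ⟨h1, h2⟩
        · exact Or.inr ⟨h1, h2⟩
      refine (measure_mono e1).trans ((measure_union_le _ _).trans ?_)
      refine (add_le_add (hN n hn m (hn.trans hm)) (hN m (hn.trans hm) n hn)).trans_eq ?_
      rw [← ENNReal.ofReal_add (by positivity) (by positivity), add_halves,
        ENNReal.ofReal_pow (by norm_num), one_div, ENNReal.ofReal_inv_of_pos (by norm_num)]
      norm_num)
  refine ⟨φ, hφ, ⋂ N, ⋃ k, A (φ (k + N)), ?_, ?_⟩
  · exact MeasurableSet.iInter fun N => MeasurableSet.iUnion fun k => hA _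
  intro ρ
  have hsum : ∑' k : ℕ, (2⁻¹ : ℝ≥0∞) ^ k ≠ ⊤ := by
    rw [ENNReal.tsum_geometric]
    simp
  have lim := ENNReal.tendsto_sum_nat_add _ hsum
  refine tendsto_of_tendsto_of_tendsto_of_le_of_le' tendsto_const_nhds lim
    (Eventually.of_forall fun n => zero_le) ?_
  obtain ⟨N0, hN0⟩ := exists_nat_gt ρ
  filter_upwards [eventually_ge_atTop N0] with N hN
  have sub : symmDiff (A (φ N)) (⋂ N, ⋃ k, A (φ (k + N))) ∩ ball 0 ρ ⊆
      ⋃ k, symmDiff (A (φ (k + N))) (A (φ (k + N + 1))) ∩ ball 0 ((k + N : ℕ) : ℝ) := by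
    rintro x ⟨hx, hxρ⟩
    by_contra hcon
    simp only [mem_iUnion, not_exists] at hcon
    have step : ∀ k, x ∈ A (φ (k + N)) ↔ x ∈ A (φ (k + N + 1)) := by
      intro k
      have h1 := hcon k
      have hb : x ∈ ball (0:E3) ((k + N : ℕ) : ℝ) := by
        refine ball_subset_ball ?_ hxρ
        have : (N0:ℝ) ≤ (k + N : ℕ) := by exact_mod_cast hN.trans (Nat.le_add_left N k)
        linarith
      have h2 : x ∉ symmDiff (A (φ (k + N))) (A (φ (k + N + 1))) := fun h => h1 ⟨h, hb⟩
      rw [mem_symmDiff] at h2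
      tauto
    have all : ∀ k, x ∈ A (φ (k + N)) ↔ x ∈ A (φ N) := by
      intro k
      induction k with
      | zero => simp
      | succ k ih =>
        rw [← ih, show k + 1 + N = k + N + 1 by ring]
        exact (step k).symm
    have hB : x ∈ (⋂ N, ⋃ k, A (φ (k + N))) ↔ x ∈ A (φ N) := by
      simp only [mem_iInter, mem_iUnion]
      constructor
      · intro h
        obtain ⟨k, hk⟩ := h N
        exact (all k).1 hk
      · intro h N'
        refine ⟨N, ?_⟩
        rw [add_comm]
        exact (all N').2 h
    rw [mem_symmDiff] at hx
    tauto
  refine (measure_mono sub).trans ((measure_iUnion_le _).trans (ENNReal.tsum_le_tsum fun k => ?_))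
  exact hP (k + N) _ (hφ.monotone (Nat.le_succ _))

/-- Local convergence of sets. -/
def LocConv (A : ℕ → Set E3) (B : Set E3) : Prop :=
  ∀ ρ : ℝ, Tendsto (fun n => volume (symmDiff (A n) B ∩ ball 0 ρ)) atTop (𝓝 0)

lemma LocConv.comp {A : ℕ → Set E3} {B : Set E3} (h : LocConv A B) {φ : ℕ → ℕ} (hφ : StrictMono φ) :
    LocConv (fun n => A (φ n)) B := fun ρ => (h ρ).comp hφ.tendsto_atTop

lemma compactness (A : ℕ → Set E3) (hA : ∀ n, MeasurableSet (A n)) (hf : ∀ n, volume (A n) < ⊤)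
    (hp : ∀ n, HasFinPer (A n)) {C : ℝ} (hC : ∀ n, per (A n) ≤ C) {M : ℝ} (hM : ∀ n, vol (A n) ≤ M) :
    ∃ φ : ℕ → ℕ, StrictMono φ ∧ ∃ B, MeasurableSet B ∧ LocConv (fun n => A (φ n)) B := by
  obtain ⟨ψ, hψ, hw⟩ := weak_conv A hA hf hM
  obtain ⟨φ, hφ, B, hB, h⟩ := limit_set (fun n => A (ψ n)) (fun n => hA _) (fun ρ e he =>
    cauchy_loc (fun n => A (ψ n)) (fun n => hA _) (fun n => hf _) (fun n => hp _) (fun n => hC _) hw ρ he)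
  exact ⟨ψ ∘ φ, hψ.comp hφ, B, hB, h⟩

lemma int_diff {f : E3 → ℝ} (hf : Integrable f) {C : ℝ} (hC : ∀ x, |f x| ≤ C) {U X Y : Set E3}
    (hU : MeasurableSet U) (hUf : volume U < ⊤) (h0 : ∀ x, x ∉ U → f x = 0) (hX : MeasurableSet X)
    (hY : MeasurableSet Y) : ∫ x in X, f x ≤ (∫ x in Y, f x) + C * vol (symmDiff X Y ∩ U) := by
  have hS : MeasurableSet (symmDiff X Y ∩ U) := (hX.symmDiff hY).inter hU
  have hSf : volume (symmDiff X Y ∩ U) < ⊤ := (measure_mono inter_subset_right).trans_lt hUf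
  have e : C * vol (symmDiff X Y ∩ U) = ∫ x, (symmDiff X Y ∩ U).indicator (fun _ => C) x := by
    rw [integral_indicator hS, setIntegral_const, smul_eq_mul, mul_comm]; rfl
  rw [e, ← integral_indicator hX, ← integral_indicator hY, ← integral_add]
  · refine integral_mono (hf.indicator hX) ((hf.indicator hY).add ?_) fun x => ?_
    · exact (integrable_indicator_iff hS).2 (integrableOn_const hSf.ne)
    · have hc := abs_le.1 (hC x)
      by_cases hxU : x ∈ U
      · by_cases hx : x ∈ X <;> by_cases hy : x ∈ Y <;>
          simp [indicator, hx, hy, hxU, mem_symmDiff] <;> linarith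
      · simp [indicator, hxU, h0 x hxU]
  · exact hf.indicator hY
  · exact (integrable_indicator_iff hS).2 (integrableOn_const hSf.ne)

lemma LocConv.vol_tendsto {A : ℕ → Set E3} {B : Set E3} (h : LocConv A B) (ρ : ℝ) :
    Tendsto (fun n => vol (symmDiff (A n) B ∩ ball 0 ρ)) atTop (𝓝 0) := by
  have := (ENNReal.tendsto_toReal ENNReal.zero_ne_top).comp (h ρ)
  exact this

lemma limit_vol {A : ℕ → Set E3} {B : Set E3} (hf : ∀ n, volume (A n) < ⊤) {M : ℝ}
    (hM : ∀ n, vol (A n) ≤ M) (h : LocConv A B) : volume B ≤ ENNReal.ofReal M := by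
  have h1 : ∀ ρ : ℕ, volume (B ∩ ball 0 (ρ:ℝ)) ≤ ENNReal.ofReal M := by
    intro ρ
    have h2 := (h ρ).const_add (ENNReal.ofReal M)
    rw [add_zero] at h2
    refine ge_of_tendsto' h2 fun n => ?_
    have sub : B ∩ ball 0 (ρ:ℝ) ⊆ A n ∪ (symmDiff (A n) B ∩ ball 0 (ρ:ℝ)) := by
      rintro x ⟨hx, hx2⟩
      by_cases hxA : x ∈ A n
      · exact Or.inl hxA
      · exact Or.inr ⟨Or.inr ⟨hx, hxA⟩, hx2⟩
    refine (measure_mono sub).trans ((measure_union_le _ _).trans (add_le_add_left ?_ _))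
    rw [← ENNReal.ofReal_toReal (hf n).ne]
    exact ENNReal.ofReal_le_ofReal (hM n)
  have e : B = ⋃ ρ : ℕ, B ∩ ball 0 (ρ:ℝ) := by
    rw [← inter_iUnion, iUnion_ball_nat, inter_univ]
  have hmono : Monotone (fun ρ : ℕ => B ∩ ball (0:E3) (ρ:ℝ)) := fun a b hab =>
    inter_subset_inter_right _ (ball_subset_ball (by exact_mod_cast hab))
  rw [e, hmono.measure_iUnion]
  exact iSup_le h1

lemma limit_minimizer {A : ℕ → Set E3} {B : Set E3} (hA : ∀ n, MeasurableSet (A n))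
    (hf : ∀ n, volume (A n) < ⊤) (hp : ∀ n, HasFinPer (A n)) {M : ℝ}
    (hM : ∀ n, vol (A n) ≤ M) {e : ℕ → ℝ} (he : Tendsto e atTop (𝓝 0))
    (hI : ∀ n, II (A n) ≤ muStar * vol (A n) + e n)
    (hB : MeasurableSet B) (hB0 : 0 < volume B) (h : LocConv A B) : IsMinimizer B := by
  have hBf : volume B < ⊤ := (limit_vol hf hM h).trans_lt ENNReal.ofReal_lt_top
  have hM0 : 0 ≤ M := (vol_nonneg _).trans (hM 0)
  have hC := C0_pos
  have hmu := muStar_nonneg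
  set κ := (cP + volume B).toReal with hκ
  have hκf : cP + volume B ≠ ⊤ := (ENNReal.add_lt_top.2 ⟨cP_lt, hBf⟩).ne
  have hκ0 : 0 ≤ κ := ENNReal.toReal_nonneg
  have claim : ∀ φ, ContDiff ℝ 1 φ → HasCompactSupport φ → (∀ x, ‖φ x‖ ≤ 1) →
      ∫ x in B, divg φ x ≤ muStar * vol B - (1/2) * (DD B B).toReal := by
    intro φ h1 h2 h3
    obtain ⟨Cd, hCd0, hCd⟩ := divg_bdd h1 h2
    have hint := divg_integrable h1 h2
    obtain ⟨ρ0, hρ0⟩ := (divg_compact h2).isBounded.subset_ball (0:E3)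
    have main : ∀ ε : ℝ, 0 < ε → (∫ x in B, divg φ x) + (1/2) * (DD B B).toReal
        ≤ muStar * vol B + ε * (1 + κ) := by
      intro ε hε
      obtain ⟨R0, hR0, hR⟩ := tail_small hB hBf hε
      set α := max (max (ρ0 + 1) (R0 + 1)) (2 * C0 * (M + 1) / ε) with hα
      have a1 : ρ0 ≤ α - 1 := by have : ρ0 + 1 ≤ α := (le_max_left _ _).trans (le_max_left _ _)
                                 linarith
      have a2 : R0 ≤ α - 1 := by have : R0 + 1 ≤ α := (le_max_right _ _).trans (le_max_left _ _)
                                 linarith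
      have a0 : 0 < α := by linarith
      have a3 : 2 * C0 * ((M + 1) / α) ≤ ε := by
        have : 2 * C0 * (M + 1) / ε ≤ α := le_max_right _ _
        rw [div_le_iff₀ hε] at this
        rw [← mul_div_assoc, div_le_iff₀ a0]; linarith
      have each : ∀ n, (∫ x in B, divg φ x) + (1/2) * (DD B B).toReal
          ≤ muStar * (vol B + vol (symmDiff (A n) B ∩ ball 0 (2 * α))) + e n + ε
            + Cd * vol (symmDiff (A n) B ∩ ball 0 (2 * α))
            + (ε + vol (symmDiff (A n) B ∩ ball 0 (2 * α))) * κ := by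
        intro n
        set δ := vol (symmDiff (A n) B ∩ ball 0 (2 * α)) with hδ
        have hSf : volume (symmDiff (A n) B ∩ ball 0 (2 * α)) < ⊤ :=
          (measure_mono inter_subset_right).trans_lt measure_ball_lt_top
        obtain ⟨t, ht, hs⟩ := exists_slice (Ω := A n) (u := ub 0) (hf n) (ub_meas 0) (α := α) (β := 2 * α)
          (s := (M + 1) / α) (by linarith) (by
            have e1 : vol (A n ∩ {x | α ≤ ub 0 x ∧ ub 0 x < 2 * α}) ≤ M :=
              (vol_mono inter_subset_left (hf n)).trans (hM n)
            have e2 : (M + 1) / α * (2 * α - α) = M + 1 := by field_simp; ring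
            rw [e2]; linarith)
        obtain ⟨q1, q2, q3⟩ := cut_II (hA n) (hf n) (hp n) (ub_contDiff 0) (ub_lip 0)
          (by positivity) hs
        have hm := sub_meas (ub_meas 0) t
        have q4 := muStar_le ((hA n).diff hm) q2 (fin_diff (hf n) _)
        have q5 := vol_inter_add_diff (hf n) hm
        have q6 : 0 ≤ (DD (A n ∩ {x | ub 0 x < t}) (A n \ {x | ub 0 x < t})).toReal :=
          ENNReal.toReal_nonneg
        have q7 := hI n
        rw [← q5, mul_add] at q7
        set P := A n ∩ {x | ub 0 x < t} with hP
        have hPm : MeasurableSet P := (hA n).inter hm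
        have hPf : volume P < ⊤ := fin_inter (hf n) _
        have hin : ball (0:E3) (α - 1) ⊆ {x | ub 0 x < t} :=
          (ball_subset_ball (by linarith [ht.1])).trans (ball_sub_ub 0 t)
        have hout : {x | ub 0 x < t} ⊆ ball (0:E3) (2 * α) :=
          (ub_sub_ball 0 t).trans (ball_subset_ball ht.2.le)
        have c1 : II P ≤ muStar * vol P + e n + ε := by linarith
        have c2 : vol P ≤ vol B + δ := by
          have : P ⊆ B ∪ (symmDiff (A n) B ∩ ball 0 (2 * α)) := by
            rintro x ⟨hx, hx2⟩
            by_cases hxB : x ∈ B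
            · exact Or.inl hxB
            · exact Or.inr ⟨Or.inl ⟨hx, hxB⟩, hout hx2⟩
          have := (vol_mono this (measure_union_lt_top hBf hSf))
          refine this.trans ?_
          exact ENNReal.toReal_add_le.trans' (ENNReal.toReal_mono (ENNReal.add_ne_top.2 ⟨hBf.ne, hSf.ne⟩) (measure_union_le _ _))
        have c3 : ∫ x in B, divg φ x ≤ (∫ x in P, divg φ x) + Cd * δ := by
          refine (int_diff hint hCd (U := ball 0 (α - 1)) measurableSet_ball measure_ball_lt_top ?_ hB hPm).trans ?_
          · intro x hx
            by_contra hne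
            exact hx (ball_subset_ball a1 (hρ0 (subset_tsupport _ hne)))
          · refine add_le_add_right (mul_le_mul_of_nonneg_left (vol_mono ?_ hSf) hCd0) _
            rintro x ⟨hx, hx2⟩
            refine ⟨?_, ball_subset_ball (by linarith) hx2⟩
            rcases hx with ⟨hx, hx'⟩ | ⟨hx, hx'⟩
            · exact Or.inr ⟨hx, fun hxA => hx' ⟨hxA, hin hx2⟩⟩
            · exact Or.inl ⟨hx.1, hx'⟩
        have c4 : ∫ x in P, divg φ x ≤ per P := le_per q1 h1 h2 h3
        have c5 : (DD B B).toReal ≤ (DD P P).toReal + 2 * ((ε + δ) * κ) := by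
          have d1 : volume (B \ P) ≤ ENNReal.ofReal (ε + δ) := by
            have : B \ P ⊆ (B \ ball 0 (α - 1)) ∪ (symmDiff (A n) B ∩ ball 0 (2 * α)) := by
              rintro x ⟨hx, hx2⟩
              by_cases hb : x ∈ ball (0:E3) (α - 1)
              · exact Or.inr ⟨Or.inr ⟨hx, fun hxA => hx2 ⟨hxA, hin hb⟩⟩, ball_subset_ball (by linarith) hb⟩
              · exact Or.inl ⟨hx, hb⟩
            refine (measure_mono this).trans ((measure_union_le _ _).trans ?_)
            rw [ENNReal.ofReal_add hε.le (vol_nonneg _), vol, ENNReal.ofReal_toReal hSf.ne]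
            refine add_le_add_left ?_ _
            rw [← ENNReal.ofReal_toReal (fin_diff hBf _).ne]
            exact ENNReal.ofReal_le_ofReal (hR _ a2).le
          have d2 : DD B B ≤ DD P P + 2 * (ENNReal.ofReal (ε + δ) * (cP + volume B)) :=
            (DD_diff hB hPm).trans (by gcongr)
          have d3 := ENNReal.toReal_mono (by
            refine ENNReal.add_ne_top.2 ⟨(DD_fin hPf hPf).ne, ?_⟩
            exact ENNReal.mul_ne_top (by simp) (ENNReal.mul_ne_top ENNReal.ofReal_ne_top hκf)) d2
          refine d3.trans (ENNReal.toReal_add_le.trans_eq ?_)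
          rw [ENNReal.toReal_mul, ENNReal.toReal_mul, ENNReal.toReal_ofReal (by have := vol_nonneg (symmDiff (A n) B ∩ ball 0 (2 * α)); positivity)]
          simp [hκ]
        rw [II_eq hPf] at c1
        have c6 := mul_le_mul_of_nonneg_left c2 hmu
        linarith
      have hδl := h.vol_tendsto (2 * α)
      have lim := (((((hδl.const_add (vol B)).const_mul muStar).add he).add_const ε).add
        (hδl.const_mul Cd)).add ((hδl.const_add ε).mul_const κ)
      have := ge_of_tendsto' lim each
      simp only [add_zero, mul_zero] at this
      linarith
    have key : (∫ x in B, divg φ x) + (1/2) * (DD B B).toReal ≤ muStar * vol B := by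
      refine le_of_forall_pos_le_add fun ε hε => ?_
      have := main (ε / (1 + κ)) (by positivity)
      rwa [div_mul_cancel₀ _ (by positivity)] at this
    linarith
  obtain ⟨hpB, hle⟩ := per_le_of claim
  refine ⟨hB, hpB, hB0, hBf, le_antisymm ?_ (muStar_le hB hpB hBf)⟩
  rw [II_eq hBf]; linarith

/-- standing assumptions on an almost minimizing sequence -/
structure Hyp (Ω : ℕ → Set E3) (M C : ℝ) (e : ℕ → ℝ) : Prop where
  meas : ∀ n, MeasurableSet (Ω n)
  fin : ∀ n, volume (Ω n) < ⊤
  fper : ∀ n, HasFinPer (Ω n)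
  volLe : ∀ n, vol (Ω n) ≤ M
  perLe : ∀ n, per (Ω n) ≤ C
  ene : ∀ n, II (Ω n) ≤ muStar * vol (Ω n) + e n
  lim : Tendsto e atTop (𝓝 0)

lemma Hyp.comp {Ω : ℕ → Set E3} {M C : ℝ} {e : ℕ → ℝ} (h : Hyp Ω M C e) {φ : ℕ → ℕ}
    (hφ : StrictMono φ) : Hyp (fun n => Ω (φ n)) M C (fun n => e (φ n)) :=
  ⟨fun n => h.meas _, fun n => h.fin _, fun n => h.fper _, fun n => h.volLe _, fun n => h.perLe _,
    fun n => h.ene _, h.lim.comp hφ.tendsto_atTop⟩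

lemma Hyp.tr {Ω : ℕ → Set E3} {M C : ℝ} {e : ℕ → ℝ} (h : Hyp Ω M C e) (b : ℕ → E3) :
    Hyp (fun n => tr (b n) (Ω n)) M C e :=
  ⟨fun n => tr_meas (h.meas n) _, fun n => by rw [tr_volume]; exact h.fin n, fun n => tr_finPer (h.fper n) _,
    fun n => by rw [vol_tr]; exact h.volLe n, fun n => by rw [tr_per]; exact h.perLe n,
    fun n => by rw [vol_tr, II_tr (h.fin n)]; exact h.ene n, h.lim⟩

/-- A (partial) profile decomposition. -/
structure Prof (Ω : ℕ → Set E3) (K : ℕ) (φ : ℕ → ℕ) (a : ℕ → Fin K → E3) (Ωs : Fin K → Set E3) :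
    Prop where
  mono : StrictMono φ
  sep : ∀ j k, j ≠ k → Tendsto (fun n => ‖a n j - a n k‖) atTop atTop
  meas : ∀ j, MeasurableSet (Ωs j)
  pos : ∀ j, 0 < volume (Ωs j)
  conv : ∀ j, LocConv (fun n => tr (a n j) (Ω (φ n))) (Ωs j)

lemma Prof.comp {Ω : ℕ → Set E3} {K : ℕ} {φ : ℕ → ℕ} {a : ℕ → Fin K → E3} {Ωs : Fin K → Set E3}
    (h : Prof Ω K φ a Ωs) {ψ : ℕ → ℕ} (hψ : StrictMono ψ) :
    Prof Ω K (fun n => φ (ψ n)) (fun n => a (ψ n)) Ωs :=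
  ⟨h.mono.comp hψ, fun j k hjk => (h.sep j k hjk).comp hψ.tendsto_atTop, h.meas, h.pos,
    fun j => (h.conv j).comp hψ⟩

lemma Prof.isMin {Ω : ℕ → Set E3} {M C : ℝ} {e : ℕ → ℝ} (H : Hyp Ω M C e)
    {K : ℕ} {φ : ℕ → ℕ} {a : ℕ → Fin K → E3} {Ωs : Fin K → Set E3}
    (h : Prof Ω K φ a Ωs) (j : Fin K) : IsMinimizer (Ωs j) := by
  have H' := (H.comp h.mono).tr (fun n => a n j)
  exact limit_minimizer H'.meas H'.fin H'.fper H'.volLe H'.lim H'.ene (h.meas j) (h.pos j) (h.conv j)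

lemma tr_inter_ball (A : Set E3) (a : E3) (ρ : ℝ) : tr a A ∩ ball 0 ρ = tr a (A ∩ ball a ρ) := by
  ext x; simp [tr]

lemma vol_symm_le {X Y U : Set E3} (hUf : volume U < ⊤) :
    |vol (X ∩ U) - vol (Y ∩ U)| ≤ vol (symmDiff X Y ∩ U) := by
  have key : ∀ X Y : Set E3, vol (X ∩ U) ≤ vol (Y ∩ U) + vol (symmDiff X Y ∩ U) := by
    intro X Y
    have sub : X ∩ U ⊆ (Y ∩ U) ∪ (symmDiff X Y ∩ U) := by
      rintro x ⟨hx, hu⟩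
      by_cases hy : x ∈ Y
      · exact Or.inl ⟨hy, hu⟩
      · exact Or.inr ⟨Or.inl ⟨hx, hy⟩, hu⟩
    have f1 : volume (Y ∩ U) < ⊤ := (measure_mono inter_subset_right).trans_lt hUf
    have f2 : volume (symmDiff X Y ∩ U) < ⊤ := (measure_mono inter_subset_right).trans_lt hUf
    have := vol_mono sub (measure_union_lt_top f1 f2)
    refine this.trans ?_
    exact ENNReal.toReal_add_le.trans' (ENNReal.toReal_mono (ENNReal.add_ne_top.2 ⟨f1.ne, f2.ne⟩) (measure_union_le _ _))
  rw [abs_le]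
  have h1 := key X Y
  have h2 := key Y X
  rw [symmDiff_comm] at h2
  constructor <;> linarith

lemma LocConv.vol_ball {A : ℕ → Set E3} {B : Set E3} (h : LocConv A B) (ρ : ℝ) :
    Tendsto (fun n => vol (A n ∩ ball 0 ρ)) atTop (𝓝 (vol (B ∩ ball 0 ρ))) := by
  rw [tendsto_iff_dist_tendsto_zero]
  refine squeeze_zero (fun n => dist_nonneg) (fun n => ?_) (h.vol_tendsto ρ)
  rw [Real.dist_eq]
  exact vol_symm_le measure_ball_lt_top

lemma Prof.vol_ball {Ω : ℕ → Set E3} {K : ℕ} {φ : ℕ → ℕ} {a : ℕ → Fin K → E3} {Ωs : Fin K → Set E3}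
    (h : Prof Ω K φ a Ωs) (j : Fin K) (ρ : ℝ) :
    Tendsto (fun n => vol (Ω (φ n) ∩ ball (a n j) ρ)) atTop (𝓝 (vol (Ωs j ∩ ball 0 ρ))) := by
  refine ((h.conv j).vol_ball ρ).congr fun n => ?_
  rw [tr_inter_ball, vol_tr]

lemma Prof.disj {Ω : ℕ → Set E3} {K : ℕ} {φ : ℕ → ℕ} {a : ℕ → Fin K → E3} {Ωs : Fin K → Set E3}
    (h : Prof Ω K φ a Ωs) (L : ℝ) : ∀ᶠ n in atTop, ∀ j k, j ≠ k → L ≤ ‖a n j - a n k‖ := by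
  rw [eventually_all]; intro j
  rw [eventually_all]; intro k
  by_cases hjk : j = k
  · exact Eventually.of_forall fun n hn => absurd hjk hn
  · filter_upwards [(h.sep j k hjk).eventually_ge_atTop L] with n hn _
    exact hn

lemma vol_decomp {K : ℕ} {A : Set E3} (hA : MeasurableSet A) (hf : volume A < ⊤) {U : Fin K → Set E3}
    (hU : ∀ j, MeasurableSet (U j)) (hd : ∀ j k, j ≠ k → Disjoint (U j) (U k)) :
    ∑ j, vol (A ∩ U j) + vol (A \ ⋃ j, U j) = vol A := by
  rw [← vol_inter_add_diff (U := ⋃ j, U j) hf (MeasurableSet.iUnion hU)]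
  congr 1
  rw [inter_iUnion, vol, measure_iUnion, tsum_fintype, ENNReal.toReal_sum]
  · rfl
  · exact fun j _ => (fin_inter hf _).ne
  · exact fun j k hjk => (hd j k hjk).mono inter_subset_right inter_subset_right
  · exact fun j => hA.inter (hU j)

lemma balls_disj {K : ℕ} {a : Fin K → E3} {ρ : ℝ} (h : ∀ j k, j ≠ k → 2 * ρ ≤ ‖a j - a k‖) :
    ∀ j k, j ≠ k → Disjoint (ball (a j) ρ) (ball (a k) ρ) := fun j k hjk =>
  ball_disjoint_ball (by rw [dist_eq_norm]; linarith [h j k hjk])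

lemma vol_inter_of_null {A U : Set E3} (hf : volume A < ⊤) (hU : MeasurableSet U)
    (h : volume (A \ U) = 0) : vol (A ∩ U) = vol A := by
  rw [← vol_inter_add_diff hf hU]
  simp [vol, h]

lemma exists_R0 {K : ℕ} {Ωs : Fin K → Set E3} (h : ∀ j, IsMinimizer (Ωs j)) :
    ∃ R0 : ℝ, 1 ≤ R0 ∧ ∀ j, volume (Ωs j \ ball 0 R0) = 0 := by
  choose R hR0 hR using fun j => minimizer_bdd (h j)
  refine ⟨1 + ∑ j, R j, by have := Finset.sum_nonneg (fun j (_ : j ∈ Finset.univ) => (hR0 j).le); linarith, fun j => ?_⟩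
  refine measure_mono_null (sdiff_subset_sdiff_right (ball_subset_ball ?_)) (hR j)
  have := Finset.single_le_sum (fun j (_ : j ∈ Finset.univ) => (hR0 j).le) (Finset.mem_univ j)
  linarith

lemma Prof.card_le {Ω : ℕ → Set E3} {M C : ℝ} {e : ℕ → ℝ} (H : Hyp Ω M C e)
    {K : ℕ} {φ : ℕ → ℕ} {a : ℕ → Fin K → E3} {Ωs : Fin K → Set E3}
    (h : Prof Ω K φ a Ωs) : K * m0 ≤ M := by
  obtain ⟨R0, hR0, hR⟩ := exists_R0 (fun j => h.isMin H j)
  have lim := tendsto_finsetSum Finset.univ fun j _ => h.vol_ball j R0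
  have h1 : ∑ j, vol (Ωs j ∩ ball 0 R0) ≤ M := by
    refine le_of_tendsto lim ?_
    filter_upwards [h.disj (2 * R0)] with n hn
    have := vol_decomp (H.meas (φ n)) (H.fin (φ n)) (fun j => measurableSet_ball) (balls_disj hn)
    have h2 := vol_nonneg (Ω (φ n) \ ⋃ j, ball (a n j) R0)
    linarith [H.volLe (φ n)]
  refine le_trans ?_ h1
  have : ∑ j : Fin K, m0 = K * m0 := by simp
  rw [← this]
  refine Finset.sum_le_sum fun j _ => ?_
  rw [vol_inter_of_null (h.isMin H j).2.2.2.1 measurableSet_ball (hR j)]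
  exact (h.isMin H j).m0_le

lemma prof_extend {Ω : ℕ → Set E3} {M C : ℝ} {e : ℕ → ℝ} (H : Hyp Ω M C e)
    {K : ℕ} {φ : ℕ → ℕ} {a : ℕ → Fin K → E3} {Ωs : Fin K → Set E3}
    (h : Prof Ω K φ a Ωs) {R0 : ℝ} (hR : ∀ j, volume (Ωs j \ ball 0 R0) = 0)
    (hn : ¬ Tendsto (fun n => vol (Ω (φ n) \ ⋃ j, ball (a n j) (R0 + 1))) atTop (𝓝 0)) :
    ∃ φ' a' Ωs', Prof Ω (K + 1) φ' a' Ωs' := by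
  have h1 : ∃ δ : ℝ, 0 < δ ∧ ∃ᶠ n in atTop, δ ≤ vol (Ω (φ n) \ ⋃ j, ball (a n j) (R0 + 1)) := by
    by_contra hcon
    push Not at hcon
    refine hn (tendsto_order.2 ⟨fun x hx => Eventually.of_forall fun n => hx.trans_le (vol_nonneg _), fun x hx => ?_⟩)
    exact hcon x hx
  obtain ⟨δ, hδ, hfr⟩ := h1
  obtain ⟨ψ, hψ, hge⟩ := extraction_of_frequently_atTop hfr
  have hC0 : 0 ≤ C := (per_nonneg (Ω 0)).trans (H.perLe 0)
  set r := min 1 (δ / (4 * (C + 1))) with hr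
  have hr0 : 0 < r := lt_min one_pos (by positivity)
  have hr1 : r ≤ 1 := min_le_left _ _
  have hex : ∀ n, ∃ x ∈ Ω (φ (ψ n)) \ ⋃ j, ball (a (ψ n) j) (R0 + 1),
      (1 - 1/2) * vol (ball (0:E3) r) ≤ vol (Ω (φ (ψ n)) ∩ ball x r) := by
    intro n
    refine exists_dense (H.meas _) (H.fin _) (H.fper _)
      ((H.meas _).diff (MeasurableSet.iUnion fun j => measurableSet_ball)) sdiff_subset hr0 ?_ (by norm_num)
    calc r * per (Ω (φ (ψ n))) ≤ (δ / (4 * (C + 1))) * C :=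
          mul_le_mul (min_le_right _ _) (H.perLe _) (per_nonneg _) (by positivity)
      _ = δ / 4 * (C / (C + 1)) := by field_simp
      _ ≤ δ / 4 * 1 := by
        refine mul_le_mul_of_nonneg_left ?_ (by positivity)
        rw [div_le_one (by positivity)]; linarith
      _ < 1/2 * δ := by linarith
      _ ≤ _ := mul_le_mul_of_nonneg_left (hge n) (by norm_num)
  choose b hbS hb using hex
  have hvr := vol_ball_pos hr0 (0:E3)
  have hP := h.comp hψ
  have H2 := (H.comp hP.mono).tr b
  obtain ⟨χ, hχ, B, hB, hconv⟩ := compactness _ H2.meas H2.fin H2.fper H2.perLe H2.volLe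
  have hB0 : 0 < volume B := by
    have lim := hconv.vol_ball r
    have h2 : (1 - 1/2) * vol (ball (0:E3) r) ≤ vol (B ∩ ball 0 r) := by
      refine ge_of_tendsto' lim fun n => ?_
      rw [tr_inter_ball, vol_tr]
      exact hb _
    have h3 : 0 < vol (B ∩ ball 0 r) := by linarith
    have := (ENNReal.toReal_pos_iff.1 h3).1
    exact this.trans_le (measure_mono inter_subset_left)
  have hsep : ∀ j, Tendsto (fun n => ‖b n - a (ψ n) j‖) atTop atTop := by
    intro j
    rw [Filter.tendsto_atTop]
    intro L
    have lim := (hP.conv j).vol_tendsto (L + 1)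
    filter_upwards [lim.eventually (gt_mem_nhds (show 0 < (1 - 1/2) * vol (ball (0:E3) r) by linarith))] with n hn
    by_contra hlt
    push Not at hlt
    have hout : b n ∉ ball (a (ψ n) j) (R0 + 1) := fun hx => (hbS n).2 (mem_iUnion.2 ⟨j, hx⟩)
    have sub : tr (a (ψ n) j) (Ω (φ (ψ n)) ∩ ball (b n) r) ⊆
        (symmDiff (tr (a (ψ n) j) (Ω (φ (ψ n)))) (Ωs j) ∩ ball 0 (L + 1)) ∪ (Ωs j \ ball 0 R0) := by
      rintro x ⟨hx1, hx2⟩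
      have hx2 : ‖x + a (ψ n) j - b n‖ < r := by rwa [mem_ball, dist_eq_norm] at hx2
      have i1 : ‖x‖ < L + 1 := by
        have : x = (x + a (ψ n) j - b n) + (b n - a (ψ n) j) := by abel
        have h5 := norm_add_le (x + a (ψ n) j - b n) (b n - a (ψ n) j)
        rw [← this] at h5
        linarith
      have i2 : R0 ≤ ‖x‖ := by
        rw [mem_ball, dist_eq_norm, not_lt] at hout
        have : b n - a (ψ n) j = x - (x + a (ψ n) j - b n) := by abel
        have h5 := norm_sub_le x (x + a (ψ n) j - b n)
        rw [← this] at h5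
        linarith
      by_cases hxs : x ∈ Ωs j
      · exact Or.inr ⟨hxs, by simpa using i2⟩
      · exact Or.inl ⟨Or.inl ⟨hx1, hxs⟩, by simpa using i1⟩
    have h6 := measure_mono (μ := volume) sub
    rw [tr_volume] at h6
    have h7 := h6.trans (measure_union_le _ _)
    rw [hR j, add_zero] at h7
    have h8 : vol (Ω (φ (ψ n)) ∩ ball (b n) r) ≤ _ :=
      ENNReal.toReal_mono ((measure_mono inter_subset_right).trans_lt measure_ball_lt_top).ne h7
    exact absurd (hb n) (not_le.2 (h8.trans_lt hn))
  have hP2 := hP.comp hχ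
  refine ⟨fun n => φ (ψ (χ n)), fun n => Fin.cons (b (χ n)) (a (ψ (χ n))), Fin.cons B Ωs, hP2.mono, ?_, ?_, ?_, ?_⟩
  · intro j k
    refine Fin.cases ?_ (fun j => ?_) j <;> refine Fin.cases ?_ (fun k => ?_) k
    · intro hne; exact absurd rfl hne
    · intro _; exact (hsep k).comp hχ.tendsto_atTop
    · intro _
      change Tendsto (fun n => ‖a (ψ (χ n)) j - b (χ n)‖) atTop atTop
      exact ((hsep j).comp hχ.tendsto_atTop).congr fun n => norm_sub_rev _ _
    · intro hne
      exact hP2.sep j k (fun h => hne (by rw [h]))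
  · exact fun j => Fin.cases hB hP2.meas j
  · exact fun j => Fin.cases hB0 hP2.pos j
  · exact fun j => Fin.cases hconv hP2.conv j

lemma prof_max {Ω : ℕ → Set E3} {M C : ℝ} {e : ℕ → ℝ} (H : Hyp Ω M C e) :
    ∃ (K : ℕ) (φ : ℕ → ℕ) (a : ℕ → Fin K → E3) (Ωs : Fin K → Set E3) (R0 : ℝ), Prof Ω K φ a Ωs ∧
      1 ≤ R0 ∧ (∀ j, volume (Ωs j \ ball 0 R0) = 0) ∧
      Tendsto (fun n => vol (Ω (φ n) \ ⋃ j, ball (a n j) R0)) atTop (𝓝 0) := by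
  set S : Set ℕ := {K | ∃ φ a Ωs, Prof Ω K φ a Ωs} with hS
  have hne : S.Nonempty := ⟨0, id, fun _ => Fin.elim0, Fin.elim0, strictMono_id, fun j => Fin.elim0 j,
    fun j => Fin.elim0 j, fun j => Fin.elim0 j, fun j => Fin.elim0 j⟩
  have hbdd : BddAbove S := by
    refine ⟨⌊M / m0⌋₊, ?_⟩
    rintro K ⟨φ, a, Ωs, h⟩
    refine Nat.le_floor ?_
    rw [le_div_iff₀ m0_pos]
    exact h.card_le H
  obtain ⟨φ, a, Ωs, h⟩ := Nat.sSup_mem hne hbdd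
  obtain ⟨R0, hR0, hR⟩ := exists_R0 (fun j => h.isMin H j)
  refine ⟨sSup S, φ, a, Ωs, R0 + 1, h, by linarith, fun j => ?_, ?_⟩
  · exact measure_mono_null (sdiff_subset_sdiff_right (ball_subset_ball (by linarith))) (hR j)
  · by_contra hn
    have : sSup S + 1 ∈ S := prof_extend H h hR hn
    have := le_csSup hbdd this
    omega

lemma DD_sum_le {K : ℕ} {P X : Set E3} {B : Fin K → Set E3} (hB : ∀ j, MeasurableSet (B j))
    (hd : ∀ j k, j ≠ k → Disjoint (B j) (B k)) (hs : ∀ j, B j ⊆ X) (hP : volume P < ⊤)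
    (hX : volume X < ⊤) : ∑ j, (DD P (B j)).toReal ≤ (DD P X).toReal := by
  have hBf : ∀ j, volume (B j) < ⊤ := fun j => (measure_mono (hs j)).trans_lt hX
  rw [← ENNReal.toReal_sum fun j _ => (DD_fin hP (hBf j)).ne]
  refine ENNReal.toReal_mono (DD_fin hP hX).ne ?_
  have : ∑ j, DD P (B j) = DD (⋃ j, B j) P := by
    rw [DD, lintegral_iUnion hB (fun j k hjk => hd j k hjk), tsum_fintype]
    exact Finset.sum_congr rfl fun j _ => DD_symm _ _
  rw [this, DD_symm]
  exact DD_mono le_rfl (iUnion_subset hs)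

lemma DD_lower {X Y : Set E3} (hX : MeasurableSet X) (hY : MeasurableSet Y)
    (hXf : volume X < ⊤) (hYf : volume Y < ⊤) {d : ℝ} 
    (h : ∀ x ∈ X, ∀ y ∈ Y, 0 < ‖x - y‖ ∧ ‖x - y‖ ≤ d) : vol X * vol Y / d ≤ (DD X Y).toReal := by
  rcases X.eq_empty_or_nonempty with rfl | ⟨x0, hx0⟩
  · simp [vol]
  rcases Y.eq_empty_or_nonempty with rfl | ⟨y0, hy0⟩
  · simp [vol]
  have hd : 0 < d := (h x0 hx0 y0 hy0).1.trans_le (h x0 hx0 y0 hy0).2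
  have key : ENNReal.ofReal (1 / d) * volume Y * volume X ≤ DD X Y := by
    unfold DD
    rw [← setLIntegral_const]
    refine setLIntegral_mono' hX fun x hx => ?_
    rw [← setLIntegral_const]
    refine setLIntegral_mono' hY fun y hy => ?_
    exact ENNReal.ofReal_le_ofReal (one_div_le_one_div_of_le (h x hx y hy).1 (h x hx y hy).2)
  have := ENNReal.toReal_mono (DD_fin hXf hYf).ne key
  rw [ENNReal.toReal_mul, ENNReal.toReal_mul, ENNReal.toReal_ofReal (by positivity)] at this
  refine le_trans (le_of_eq ?_) this
  unfold vol; ring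

lemma multi_cut {t s : ℝ} (hs0 : 0 ≤ s) : ∀ (K : ℕ) (a : Fin K → E3) (A : Set E3),
    MeasurableSet A → volume A < ⊤ → HasFinPer A →
    (∀ j, SliceLe A (ub (a j)) t s) →
    (∀ j k, j ≠ k → Disjoint {x | ub (a j) x < t} {x | ub (a k) x < t}) →
    HasFinPer (A \ ⋃ j, {x | ub (a j) x < t}) ∧
    II (A \ ⋃ j, {x | ub (a j) x < t}) + ∑ j, muStar * vol (A ∩ {x | ub (a j) x < t}) +
      (∑ j, ∑ k, if j < k then
        (DD (A ∩ {x | ub (a j) x < t}) (A ∩ {x | ub (a k) x < t})).toReal else 0)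
      ≤ II A + K * (2 * C0 * s) := by
  intro K
  induction K with
  | zero => intro a A hA hf hp _ _; simpa using hp
  | succ K ih =>
    intro a A hA hf hp hs hd
    set U : Fin (K + 1) → Set E3 := fun j => {x | ub (a j) x < t} with hU
    have hUm : ∀ j, MeasurableSet (U j) := fun j => sub_meas (ub_meas _) t
    obtain ⟨p1, p2, h1⟩ := cut_II hA hf hp (ub_contDiff (a 0)) (ub_lip (a 0)) hs0 (hs 0)
    change HasFinPer (A ∩ U 0) at p1
    change HasFinPer (A \ U 0) at p2
    change II (A ∩ U 0) + II (A \ U 0) + (DD (A ∩ U 0) (A \ U 0)).toReal ≤ _ at h1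
    obtain ⟨q1, q2⟩ := ih (fun j => a j.succ) (A \ U 0) (hA.diff (hUm 0)) (fin_diff hf _) p2
      (fun j => (hs j.succ).mono sdiff_subset) (fun j k hjk => hd _ _ (by simpa using hjk))
    change HasFinPer ((A \ U 0) \ ⋃ j : Fin K, U j.succ) at q1
    have e1 : (A \ U 0) \ ⋃ j : Fin K, U j.succ = A \ ⋃ j, U j := by
      ext x
      simp only [Set.mem_sdiff, mem_iUnion, not_exists, Fin.forall_fin_succ]
      tauto
    have e2 : ∀ j : Fin K, (A \ U 0) ∩ U j.succ = A ∩ U j.succ := by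
      intro j
      ext x
      have : x ∈ U 0 → x ∉ U j.succ := fun h1 =>
        Set.disjoint_left.1 (hd 0 j.succ (Fin.succ_ne_zero j).symm) h1
      constructor
      · exact fun h => ⟨h.1.1, h.2⟩
      · exact fun h => ⟨⟨h.1, fun h0 => this h0 h.2⟩, h.2⟩
    change II ((A \ U 0) \ ⋃ j : Fin K, U j.succ) + ∑ j : Fin K, muStar * vol ((A \ U 0) ∩ U j.succ) +
      (∑ j : Fin K, ∑ k : Fin K, if j < k then
        (DD ((A \ U 0) ∩ U j.succ) ((A \ U 0) ∩ U k.succ)).toReal else 0) ≤ _ at q2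
    rw [e1] at q1 q2
    simp only [e2] at q2
    refine ⟨q1, ?_⟩
    change II (A \ ⋃ j, U j) + ∑ j, muStar * vol (A ∩ U j) +
      (∑ j, ∑ k, if j < k then (DD (A ∩ U j) (A ∩ U k)).toReal else 0) ≤ _
    have h3 := muStar_le (hA.inter (hUm 0)) p1 (fin_inter hf _)
    have h4 : ∑ k : Fin K, (DD (A ∩ U 0) (A ∩ U k.succ)).toReal ≤ (DD (A ∩ U 0) (A \ U 0)).toReal := by
      refine DD_sum_le (fun j => hA.inter (hUm _)) (fun j k hjk => ?_) (fun j => ?_) (fin_inter hf _) (fin_diff hf _)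
      · exact (hd j.succ k.succ (by simpa using hjk)).mono inter_subset_right inter_subset_right
      · rw [← e2]; exact inter_subset_left
    rw [Fin.sum_univ_succ (fun j => muStar * vol (A ∩ U j)), Fin.sum_univ_succ]
    simp only [Fin.sum_univ_succ (n := K), Fin.succ_lt_succ_iff, Fin.succ_pos, Fin.not_lt_zero, lt_self_iff_false, if_true, if_false, zero_add]
    push_cast
    linarith

/-- cross-interaction lower bound for a single set -/
lemma single_lower {A : Set E3} (hA : MeasurableSet A) (hf : volume A < ⊤) (hp : HasFinPer A)
    {K : ℕ} {a : Fin K → E3} {R d r : ℝ} (hR : 0 < R) (hd : ∀ j k, j ≠ k → d ≤ ‖a j - a k‖)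
    (hdR : 4 * (R + 1) ≤ d) (hr : 0 < r) (hrem : vol (A \ ⋃ j, ball (a j) R) ≤ r) :
    muStar * vol A + (∑ j, ∑ k, if j < k then
      vol (A ∩ ball (a j) R) * vol (A ∩ ball (a k) R) / (‖a j - a k‖ + 2 * R) else 0)
      ≤ II A + K * (2 * C0 * (4 * (K + 1) * r / d)) := by
  have hd0 : 0 < d := by linarith
  obtain ⟨t, ⟨ht1, ht2⟩, ht⟩ := exists_slices (ι := Fin K) (fun _ => A) (fun j => ub (a j)) (fun _ => hf)
    (fun j => ub_meas _) (fun _ => 1) (fun _ => one_pos) (α := R + 1) (β := d / 2)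
    (s := 4 * (K + 1) * r / d) (by linarith) ((hasSum_fintype _).summable) (by
      rw [tsum_fintype]
      have h1 : ∀ j : Fin K, 1 * vol (A ∩ {x | R + 1 ≤ ub (a j) x ∧ ub (a j) x < d / 2}) ≤ r := by
        intro j
        rw [one_mul]
        refine le_trans (vol_mono ?_ (fin_diff hf _)) hrem
        rintro x ⟨hx, h1, h2⟩
        refine ⟨hx, fun hx => ?_⟩
        obtain ⟨k, hk⟩ := mem_iUnion.1 hx
        rw [mem_ball, dist_eq_norm] at hk
        have h3 := ub_le (a j) x
        have h4 := le_ub (a j) x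
        by_cases hjk : j = k
        · subst hjk; linarith
        · have h5 := hd j k hjk
          have h6 := norm_sub_le (x - a k) (x - a j)
          have h7 : (x - a k) - (x - a j) = a j - a k := by abel
          rw [h7] at h6
          linarith
      calc _ ≤ ∑ j : Fin K, r := Finset.sum_le_sum fun j _ => h1 j
        _ = K * r := by simp
        _ < (K + 1) * r := by nlinarith
        _ = 4 * (K + 1) * r / d * (d / 4) := by field_simp
        _ ≤ _ := mul_le_mul_of_nonneg_left (by linarith) (by positivity))
  simp only [div_one] at ht
  set U : Fin K → Set E3 := fun j => {x | ub (a j) x < t} with hU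
  have hdisj : ∀ j k, j ≠ k → Disjoint (U j) (U k) := by
    intro j k hjk
    refine Disjoint.mono (ub_sub_ball _ _) (ub_sub_ball _ _) (ball_disjoint_ball ?_)
    rw [dist_eq_norm]; linarith [hd j k hjk]
  have hUm : ∀ j, MeasurableSet (U j) := fun j => sub_meas (ub_meas _) t
  obtain ⟨q1, q2⟩ := multi_cut (s := 4 * (K + 1) * r / d) (by positivity) K a A hA hf hp ht hdisj
  change HasFinPer (A \ ⋃ j, U j) at q1
  change II (A \ ⋃ j, U j) + ∑ j, muStar * vol (A ∩ U j) +
      (∑ j, ∑ k, if j < k then (DD (A ∩ U j) (A ∩ U k)).toReal else 0) ≤ _ at q2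
  have h1 := muStar_le (hA.diff (MeasurableSet.iUnion hUm)) q1 (fin_diff hf _)
  have h2 := vol_decomp hA hf hUm hdisj
  rw [← Finset.mul_sum] at q2
  have h3 : (∑ j, ∑ k, if j < k then
      vol (A ∩ ball (a j) R) * vol (A ∩ ball (a k) R) / (‖a j - a k‖ + 2 * R) else 0) ≤
      ∑ j, ∑ k, if j < k then (DD (A ∩ U j) (A ∩ U k)).toReal else 0 := by
    refine Finset.sum_le_sum fun j _ => Finset.sum_le_sum fun k _ => ?_
    split_ifs with hjk
    · have hBU : ∀ j, A ∩ ball (a j) R ⊆ A ∩ U j := fun j => inter_subset_inter_right _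
        ((ball_subset_ball (by linarith)).trans (ball_sub_ub _ _))
      refine le_trans (DD_lower (hA.inter measurableSet_ball) (hA.inter measurableSet_ball)
        (fin_inter hf _) (fin_inter hf _) ?_) (ENNReal.toReal_mono (DD_fin (fin_inter hf _) (fin_inter hf _)).ne
          (DD_mono (hBU j) (hBU k)))
      rintro x ⟨_, hx⟩ y ⟨_, hy⟩
      rw [mem_ball, dist_eq_norm] at hx hy
      have h5 := hd j k hjk.ne
      have i1 : a j - a k = (x - y) - ((x - a j) - (y - a k)) := by abel
      have i2 : x - y = (a j - a k) + ((x - a j) - (y - a k)) := by abel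
      have i3 := norm_sub_le (x - y) ((x - a j) - (y - a k))
      have i4 := norm_add_le (a j - a k) ((x - a j) - (y - a k))
      have i5 := norm_sub_le (x - a j) (y - a k)
      rw [← i1] at i3
      rw [← i2] at i4
      constructor <;> linarith
    · exact le_rfl
  rw [← h2]
  linarith

lemma rem_per_le {A : Set E3} (hA : MeasurableSet A) (hf : volume A < ⊤) (hp : HasFinPer A)
    {K : ℕ} {a : Fin K → E3} {t s e : ℝ} (hs0 : 0 ≤ s) (hs : ∀ j, SliceLe A (ub (a j)) t s)
    (hd : ∀ j k, j ≠ k → Disjoint {x | ub (a j) x < t} {x | ub (a k) x < t})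
    (he : II A ≤ muStar * vol A + e) :
    per (A \ ⋃ j, {x | ub (a j) x < t}) ≤
      muStar * vol (A \ ⋃ j, {x | ub (a j) x < t}) + e + K * (2 * C0 * s) := by
  obtain ⟨q1, q2⟩ := multi_cut hs0 K a A hA hf hp hs hd
  have h2 := vol_decomp hA hf (fun j => sub_meas (ub_meas (a j)) t) hd
  rw [← Finset.mul_sum] at q2
  have h3 : 0 ≤ ∑ j, ∑ k, if j < k then
        (DD (A ∩ {x | ub (a j) x < t}) (A ∩ {x | ub (a k) x < t})).toReal else 0 :=
    Finset.sum_nonneg fun j _ => Finset.sum_nonneg fun k _ => by split_ifs <;> positivity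
  have h4 := per_le_II (fin_diff hf (⋃ j, {x | ub (a j) x < t}))
  rw [← h2, mul_add] at he
  linarith

/-- sum of inverse distances -/
def invSum {K : ℕ} (a : Fin K → E3) : ℝ :=
  ∑ j : Fin K, ∑ k : Fin K, if j < k then 1 / ‖a j - a k‖ else 0

lemma invSum_ge {K : ℕ} (a : Fin K → E3) {j k : Fin K} (hjk : j < k) : 1 / ‖a j - a k‖ ≤ invSum a := by
  have nn : ∀ j k : Fin K, 0 ≤ if j < k then 1 / ‖a j - a k‖ else 0 := fun j k => by
    split_ifs <;> positivity
  have h1 := Finset.single_le_sum (f := fun k => if j < k then 1 / ‖a j - a k‖ else 0)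
    (fun k _ => nn j k) (Finset.mem_univ k)
  have h2 := Finset.single_le_sum (f := fun j => ∑ k, if j < k then 1 / ‖a j - a k‖ else 0)
    (fun j _ => Finset.sum_nonneg fun k _ => nn j k) (Finset.mem_univ j)
  simp only [hjk, if_true] at h1
  exact h1.trans h2

lemma Prof.invSum {Ω : ℕ → Set E3} {K : ℕ} {φ : ℕ → ℕ} {a : ℕ → Fin K → E3} {Ωs : Fin K → Set E3}
    (h : Prof Ω K φ a Ωs) : Tendsto (fun n => invSum (a n)) atTop (𝓝 0) := by
  have : (0:ℝ) = ∑ j : Fin K, ∑ k : Fin K, 0 := by simp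
  rw [this]
  refine tendsto_finsetSum _ fun j _ => tendsto_finsetSum _ fun k _ => ?_
  by_cases hjk : j < k
  · simp only [hjk, if_true, one_div]
    exact tendsto_inv_atTop_zero.comp (h.sep j k hjk.ne)
  · simp only [hjk, if_false]
    exact tendsto_const_nhds

/-- the interaction estimate along a sequence -/
lemma part_iv {Ω : ℕ → Set E3} {M C : ℝ} {e : ℕ → ℝ} (H : Hyp Ω M C e)
    {K : ℕ} {φ : ℕ → ℕ} {a : ℕ → Fin K → E3} {Ωs : Fin K → Set E3}
    (h : Prof Ω K φ a Ωs) (hK : 2 ≤ K) {R : ℝ} (hR : 0 < R)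
    (hnull : ∀ j, volume (Ωs j \ ball 0 R) = 0)
    (hrem : Tendsto (fun n => vol (Ω (φ n) \ ⋃ j, ball (a n j) R)) atTop (𝓝 0))
    (hpos : ∀ n j k, j ≠ k → 0 < ‖a n j - a n k‖)
    (hS : ∀ n, invSum (a n) ≤ 1 / (4 * (R + 1))) :
    ∃ ε : ℕ → ℝ, Tendsto ε atTop (𝓝 0) ∧ ∀ n : ℕ,
    muStar * vol (Ω (φ n)) +
      (∑ j : Fin K, ∑ k : Fin K,
        if j < k then (vol (Ωs j) * vol (Ωs k) + ε n) / ‖a n j - a n k‖ else 0)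
      ≤ II (Ω (φ n)) := by
  set r : ℕ → ℝ := fun n => vol (Ω (φ n) \ ⋃ j, ball (a n j) R) + 1 / ((n:ℝ) + 1) with hr
  have hrpos : ∀ n, 0 < r n := fun n => by
    have := vol_nonneg (Ω (φ n) \ ⋃ j, ball (a n j) R)
    have : 0 < 1 / ((n:ℝ) + 1) := by positivity
    simp only [hr]; linarith
  have hrlim : Tendsto r atTop (𝓝 0) := by
    have := hrem.add (tendsto_one_div_add_atTop_nhds_zero_nat (𝕜 := ℝ))
    rw [add_zero] at this
    exact this
  set c : ℕ → Fin K → ℝ := fun n j => vol (Ω (φ n) ∩ ball (a n j) R) with hc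
  have hclim : ∀ j, Tendsto (fun n => c n j) atTop (𝓝 (vol (Ωs j))) := fun j => by
    have := h.vol_ball j R
    rwa [vol_inter_of_null (h.isMin H j).2.2.2.1 measurableSet_ball (hnull j)] at this
  set D : ℝ := K * (2 * C0 * (4 * (K + 1))) with hD
  set q : ℕ → Fin K → Fin K → ℝ := fun n j k =>
    c n j * c n k * (‖a n j - a n k‖ / (‖a n j - a n k‖ + 2 * R)) - vol (Ωs j) * vol (Ωs k) with hq
  have hqlim : ∀ j k, j ≠ k → Tendsto (fun n => q n j k) atTop (𝓝 0) := by
    intro j k hjk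
    have h1 : Tendsto (fun n => ‖a n j - a n k‖ / (‖a n j - a n k‖ + 2 * R)) atTop (𝓝 1) := by
      have h2 : Tendsto (fun n => 1 - 2 * R * (‖a n j - a n k‖ + 2 * R)⁻¹) atTop (𝓝 (1 - 2 * R * 0)) :=
        tendsto_const_nhds.sub (tendsto_const_nhds.mul (tendsto_inv_atTop_zero.comp
          (tendsto_atTop_add_const_right _ (2 * R) (h.sep j k hjk))))
      rw [mul_zero, sub_zero] at h2
      refine h2.congr fun n => ?_
      have := norm_nonneg (a n j - a n k)
      have h3 : ‖a n j - a n k‖ + 2 * R ≠ 0 := by positivity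
      field_simp
      ring
    have := ((((hclim j).mul (hclim k)).mul h1).sub_const (vol (Ωs j) * vol (Ωs k)))
    simpa using this
  set T : ℕ → ℝ := fun n => ∑ j : Fin K, ∑ k : Fin K, if j < k then |q n j k| else 0 with hT
  have hTlim : Tendsto T atTop (𝓝 0) := by
    have : (0:ℝ) = ∑ j : Fin K, ∑ k : Fin K, 0 := by simp
    rw [this]
    refine tendsto_finsetSum _ fun j _ => tendsto_finsetSum _ fun k _ => ?_
    by_cases hjk : j < k
    · simp only [hjk, if_true]
      simpa using (hqlim j k hjk.ne).abs
    · simp only [hjk, if_false]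
      exact tendsto_const_nhds
  have hTge : ∀ n j k, j < k → -T n ≤ q n j k := by
    intro n j k hjk
    have nn : ∀ j k : Fin K, 0 ≤ if j < k then |q n j k| else 0 := fun j k => by
      split_ifs <;> positivity
    have h1 := Finset.single_le_sum (f := fun k => if j < k then |q n j k| else 0)
      (fun k _ => nn j k) (Finset.mem_univ k)
    have h2 := Finset.single_le_sum (f := fun j => ∑ k, if j < k then |q n j k| else 0)
      (fun j _ => Finset.sum_nonneg fun k _ => nn j k) (Finset.mem_univ j)
    simp only [hjk, if_true] at h1
    have h3 : |q n j k| ≤ T n := h1.trans h2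
    linarith [neg_abs_le (q n j k)]
  refine ⟨fun n => -T n - D * r n, ?_, fun n => ?_⟩
  · simpa using hTlim.neg.sub (hrlim.const_mul D)
  · set S := invSum (a n) with hSdef
    have h01 : (⟨0, by omega⟩ : Fin K) < ⟨1, by omega⟩ := by simp [Fin.lt_def]
    have hSpos : 0 < S := lt_of_lt_of_le (one_div_pos.2 (hpos n _ _ h01.ne)) (invSum_ge (a n) h01)
    have key := single_lower (H.meas (φ n)) (H.fin (φ n)) (H.fper (φ n)) (a := a n) (R := R) (d := 1 / S)
      (r := r n) hR ?_ ?_ (hrpos n) ?_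
    · have e1 : K * (2 * C0 * (4 * (K + 1) * r n / (1 / S))) = D * r n * S := by
        rw [hD, div_div_eq_mul_div, div_one]; ring
      rw [e1] at key
      have e2 : D * r n * S = ∑ j : Fin K, ∑ k : Fin K, if j < k then D * r n / ‖a n j - a n k‖ else 0 := by
        rw [hSdef, invSum, Finset.mul_sum]
        refine Finset.sum_congr rfl fun j _ => ?_
        rw [Finset.mul_sum]
        refine Finset.sum_congr rfl fun k _ => ?_
        split_ifs
        · ring
        · simp
      have e3 : (∑ j : Fin K, ∑ k : Fin K,
          if j < k then (vol (Ωs j) * vol (Ωs k) + (-T n - D * r n)) / ‖a n j - a n k‖ else 0)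
          + (∑ j : Fin K, ∑ k : Fin K, if j < k then D * r n / ‖a n j - a n k‖ else 0) ≤
          ∑ j, ∑ k, if j < k then c n j * c n k / (‖a n j - a n k‖ + 2 * R) else 0 := by
        rw [← Finset.sum_add_distrib]
        refine Finset.sum_le_sum fun j _ => ?_
        rw [← Finset.sum_add_distrib]
        refine Finset.sum_le_sum fun k _ => ?_
        split_ifs with hjk
        · have hp := hpos n j k hjk.ne
          have h1 := hTge n j k hjk
          have h2 : (vol (Ωs j) * vol (Ωs k) + (-T n - D * r n)) / ‖a n j - a n k‖ + D * r n / ‖a n j - a n k‖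
              = (vol (Ωs j) * vol (Ωs k) - T n) / ‖a n j - a n k‖ := by
            rw [← add_div]; ring
          have h3 : c n j * c n k / (‖a n j - a n k‖ + 2 * R) =
              (q n j k + vol (Ωs j) * vol (Ωs k)) / ‖a n j - a n k‖ := by
            simp only [hq]
            field_simp
            ring
          rw [h2, h3]
          exact div_le_div_of_nonneg_right (by linarith) hp.le
        · simp
      rw [← e2] at e3
      change muStar * vol (Ω (φ n)) + (∑ j, ∑ k, if j < k then
        c n j * c n k / (‖a n j - a n k‖ + 2 * R) else 0) ≤ _ at key
      linarith
    · have aux : ∀ j k : Fin K, j < k → 1 / S ≤ ‖a n j - a n k‖ := fun j k hjk => by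
        have := invSum_ge (a n) hjk
        rw [div_le_iff₀ (hpos n j k hjk.ne)] at this
        rw [div_le_iff₀ hSpos]
        linarith
      intro j k hjk
      rcases lt_or_gt_of_ne hjk with hlt | hlt
      · exact aux j k hlt
      · rw [norm_sub_rev]; exact aux k j hlt
    · rw [le_div_iff₀ hSpos]
      have := hS n
      rw [le_div_iff₀ (by linarith)] at this
      linarith
    · simp only [hr]
      have : 0 < 1 / ((n:ℝ) + 1) := by positivity
      linarith

lemma mk_hyp {Ω : ℕ → Set E3}
    (hmeas : ∀ n, MeasurableSet (Ω n)) (hper : ∀ n, HasFinPer (Ω n))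
    (hfin : ∀ n, volume (Ω n) < ⊤)
    {m : ℝ} (hm : 0 < m) (hvol : Tendsto (fun n => vol (Ω n)) atTop (𝓝 m))
    (hmin : Tendsto (fun n => II (Ω n) / vol (Ω n)) atTop (𝓝 muStar)) :
    ∃ M C e, Hyp Ω M C e := by
  have h1 : Tendsto (fun n => II (Ω n)) atTop (𝓝 (muStar * m)) := by
    refine (hmin.mul hvol).congr' ?_
    filter_upwards [hvol.eventually (lt_mem_nhds hm)] with n hn
    exact div_mul_cancel₀ _ hn.ne'
  obtain ⟨M, hM⟩ := hvol.bddAbove_range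
  obtain ⟨C, hC⟩ := h1.bddAbove_range
  refine ⟨M, C, fun n => II (Ω n) - muStar * vol (Ω n), hmeas, hfin, hper,
    fun n => hM ⟨n, rfl⟩, fun n => (per_le_II (hfin n)).trans (hC ⟨n, rfl⟩), fun n => by linarith, ?_⟩
  simpa using h1.sub (hvol.const_mul muStar)

/-- choice of a common good radius -/
lemma exists_radius {K : ℕ} {A : ℕ → Set E3} {a : ℕ → Fin K → E3} {R0 : ℝ}
    (hf : ∀ n, volume (A n) < ⊤)
    (hsep : ∀ n j k, j ≠ k → 2 * R0 + 3 ≤ ‖a n j - a n k‖)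
    (hrem : ∀ n, vol (A n \ ⋃ j, ball (a n j) R0) ≤ (1/4) ^ n) :
    ∃ t ∈ Ioo (R0 + 1) (R0 + 2), ∃ s : ℝ, 0 ≤ s ∧ ∀ n j, SliceLe (A n) (ub (a n j)) t (s / 2 ^ n) := by
  have h1 : ∀ n j, vol (A n ∩ {x | R0 + 1 ≤ ub (a n j) x ∧ ub (a n j) x < R0 + 2}) ≤ (1/4) ^ n := by
    intro n j
    refine le_trans (vol_mono ?_ (fin_diff (hf n) _)) (hrem n)
    rintro x ⟨hx, h1, h2⟩
    refine ⟨hx, fun hx => ?_⟩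
    obtain ⟨k, hk⟩ := mem_iUnion.1 hx
    rw [mem_ball, dist_eq_norm] at hk
    have h3 := ub_le (a n j) x
    have h4 := le_ub (a n j) x
    by_cases hjk : j = k
    · subst hjk; linarith
    · have h5 := hsep n j k hjk
      have h6 := norm_sub_le (x - a n k) (x - a n j)
      have h7 : (x - a n k) - (x - a n j) = a n j - a n k := by abel
      rw [h7] at h6
      linarith
  set f : ℕ × Fin K → ℝ := fun i => (2:ℝ) ^ i.1 *
    vol (A i.1 ∩ {x | R0 + 1 ≤ ub (a i.1 i.2) x ∧ ub (a i.1 i.2) x < R0 + 2}) with hfdef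
  have hf0 : ∀ i, 0 ≤ f i := fun i => mul_nonneg (by positivity) (vol_nonneg _)
  have hsum : Summable f := by
    have g : Summable (fun i : ℕ × Fin K => ((1:ℝ)/2) ^ i.1 * (1:ℝ)) :=
      Summable.mul_of_nonneg (f := fun n : ℕ => ((1:ℝ)/2) ^ n) (g := fun _ : Fin K => (1:ℝ))
        summable_geometric_two ((hasSum_fintype _).summable)
        (fun n => by positivity) (fun _ => zero_le_one)
    refine Summable.of_nonneg_of_le hf0 (fun i => ?_) g
    calc f i ≤ 2 ^ i.1 * (1/4) ^ i.1 := mul_le_mul_of_nonneg_left (h1 _ _) (by positivity)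
      _ = (1/2) ^ i.1 * 1 := by rw [← mul_pow, mul_one]; norm_num
  obtain ⟨t, ht, hs⟩ := exists_slices (ι := ℕ × Fin K) (fun i => A i.1) (fun i => ub (a i.1 i.2))
    (fun i => hf _) (fun i => ub_meas _) (fun i => 2 ^ i.1) (fun i => by positivity)
    (α := R0 + 1) (β := R0 + 2) (s := ∑' i, f i + 1) (by linarith) hsum (by
      have : R0 + 2 - (R0 + 1) = 1 := by ring
      rw [this, mul_one]
      exact lt_add_one _)
  exact ⟨t, ht, _, add_nonneg (tsum_nonneg hf0) zero_le_one, fun n j => hs (n, j)⟩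

/-- **Decomposition of minimizing sequences** for the isolated liquid drop problem: any sequence
with `|Ωₙ| → m > 0` and `I[Ωₙ]/|Ωₙ| → μ*` decomposes, along a subsequence, into `K ≥ 1`
minimizers around centers with mutually diverging distances, with a negligible remainder and a
Coulomb repulsion lower bound when `K ≥ 2`. -/
theorem decomposition_of_minimizing_sequences (Ω : ℕ → Set E3)
    (hmeas : ∀ n, MeasurableSet (Ω n)) (hper : ∀ n, HasFinPer (Ω n))
    (hfin : ∀ n, volume (Ω n) < ⊤)
    (m : ℝ) (hm : 0 < m) (hvol : Tendsto (fun n => vol (Ω n)) atTop (𝓝 m))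
    (hmin : Tendsto (fun n => II (Ω n) / vol (Ω n)) atTop (𝓝 muStar)) :
    ∃ (K : ℕ) (Ωs : Fin K → Set E3) (a : ℕ → Fin K → E3) (R : ℝ) (φ : ℕ → ℕ),
      1 ≤ K ∧ IsDecomp Ω m K Ωs a R φ := by
  obtain ⟨M, C, e, H⟩ := mk_hyp hmeas hper hfin hm hvol hmin
  obtain ⟨K, φ0, a0, Ωs, R0, hP0, hR0, hnull0, hrem0⟩ := prof_max H
  have hev : ∀ n : ℕ, ∀ᶠ k in atTop,
      (vol (Ω (φ0 k) \ ⋃ j, ball (a0 k j) R0) ≤ (1/4) ^ n ∧ invSum (a0 k) ≤ 1 / (4 * (R0 + 3))) ∧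
      ∀ i j, i ≠ j → 2 * R0 + 4 ≤ ‖a0 k i - a0 k j‖ := by
    intro n
    have e1 := hrem0.eventually (gt_mem_nhds (show (0:ℝ) < (1/4) ^ n by positivity))
    have e2 := hP0.invSum.eventually (gt_mem_nhds (show (0:ℝ) < 1 / (4 * (R0 + 3)) by positivity))
    filter_upwards [e1, e2, hP0.disj (2 * R0 + 4)] with k k1 k2 k3
    exact ⟨⟨k1.le, k2.le⟩, k3⟩
  obtain ⟨ψ, hψ, hall⟩ := extraction_forall_of_eventually hev
  have hP := hP0.comp hψ
  set φ : ℕ → ℕ := fun n => φ0 (ψ n) with hφ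
  set a : ℕ → Fin K → E3 := fun n => a0 (ψ n) with ha
  have hsep : ∀ n i j, i ≠ j → 2 * R0 + 4 ≤ ‖a n i - a n j‖ := fun n => (hall n).2
  obtain ⟨t, ⟨ht1, ht2⟩, s, hs0, hs⟩ := exists_radius (A := fun n => Ω (φ n)) (a := a) (R0 := R0)
    (fun n => hfin _) (fun n i j hij => by linarith [hsep n i j hij]) (fun n => (hall n).1.1)
  set R := √(t ^ 2 - 1) with hR
  have hU : ∀ n j, {x | ub (a n j) x < t} = ball (a n j) R := fun n j => ub_lt (by linarith) _
  have hRR0 : R0 ≤ R := Real.le_sqrt_of_sq_le (by nlinarith)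
  have hRt : R < R0 + 2 := by
    refine lt_of_le_of_lt ?_ ht2
    rw [hR, Real.sqrt_le_left (by linarith)]
    linarith
  have hRpos : 0 < R := by linarith
  have hnull : ∀ j, volume (Ωs j \ ball 0 R) = 0 := fun j =>
    measure_mono_null (sdiff_subset_sdiff_right (ball_subset_ball hRR0)) (hnull0 j)
  have hrem : Tendsto (fun n => vol (Ω (φ n) \ ⋃ j, ball (a n j) R)) atTop (𝓝 0) := by
    refine squeeze_zero (fun n => vol_nonneg _) (fun n => ?_) (hrem0.comp hψ.tendsto_atTop)
    exact vol_mono (sdiff_subset_sdiff_right (iUnion_mono fun j => ball_subset_ball hRR0)) (fin_diff (hfin _) _)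
  have hdisj : ∀ n j k, j ≠ k → Disjoint (ball (a n j) R) (ball (a n k) R) := fun n =>
    balls_disj fun j k hjk => by linarith [hsep n j k hjk]
  have hmass : m = ∑ j, vol (Ωs j) := by
    have l1 : Tendsto (fun n => ∑ j, vol (Ω (φ n) ∩ ball (a n j) R) + vol (Ω (φ n) \ ⋃ j, ball (a n j) R))
        atTop (𝓝 (∑ j, vol (Ωs j ∩ ball 0 R) + 0)) :=
      (tendsto_finsetSum Finset.univ fun j _ => hP.vol_ball j R).add hrem
    have l2 := l1.congr fun n => vol_decomp (hmeas (φ n)) (hfin (φ n)) (fun j => measurableSet_ball) (hdisj n)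
    have l3 : Tendsto (fun n => vol (Ω (φ n))) atTop (𝓝 m) := hvol.comp hP.mono.tendsto_atTop
    rw [tendsto_nhds_unique l3 l2, add_zero]
    exact Finset.sum_congr rfl fun j _ =>
      vol_inter_of_null (hP.isMin H j).2.2.2.1 measurableSet_ball (hnull j)
  have hK : 1 ≤ K := by
    rcases Nat.eq_zero_or_pos K with h0 | h0
    · subst h0
      simp at hmass
      linarith
    · exact h0
  refine ⟨K, Ωs, a, R, φ, hK, hP.mono, hRpos, hP.sep, hP.isMin H, fun j => (hP.isMin H j).mass_bounds,
    fun j => ?_, ?_, ?_, hmass, fun hK2 => ?_⟩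
  · refine tendsto_of_tendsto_of_tendsto_of_le_of_le tendsto_const_nhds (hP.conv j R) (fun n => zero_le) fun n => ?_
    have sub : symmDiff ({x : E3 | x + a n j ∈ Ω (φ n)} ∩ ball (0:E3) R) (Ωs j) ⊆
        (symmDiff (tr (a n j) (Ω (φ n))) (Ωs j) ∩ ball 0 R) ∪ (Ωs j \ ball 0 R) := by
      rintro x (⟨⟨h1, h2⟩, h3⟩ | ⟨h1, h2⟩)
      · exact Or.inl ⟨Or.inl ⟨h1, h3⟩, h2⟩
      · by_cases hx : x ∈ ball (0:E3) R
        · exact Or.inl ⟨Or.inr ⟨h1, fun h => h2 ⟨h, hx⟩⟩, hx⟩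
        · exact Or.inr ⟨h1, hx⟩
    refine (measure_mono sub).trans ((measure_union_le _ _).trans ?_)
    rw [hnull j, add_zero]
  · have := ENNReal.tendsto_ofReal hrem
    rw [ENNReal.ofReal_zero] at this
    refine this.congr fun n => ?_
    exact ENNReal.ofReal_toReal (fin_diff (hfin _) _).ne
  · have hb : ∀ n, per (Ω (φ n) \ ⋃ j, ball (a n j) R) ≤
        muStar * vol (Ω (φ n) \ ⋃ j, ball (a n j) R) + e (φ n) + K * (2 * C0 * (s / 2 ^ n)) := by
      intro n
      have := rem_per_le (hmeas (φ n)) (hfin (φ n)) (hper (φ n)) (a := a n) (t := t) (s := s / 2 ^ n)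
        (e := e (φ n)) (by positivity) (hs n) (fun j k hjk => by rw [hU, hU]; exact hdisj n j k hjk) (H.ene _)
      simpa only [hU] using this
    refine squeeze_zero (fun n => per_nonneg _) hb ?_
    have l1 : Tendsto (fun n : ℕ => s / 2 ^ n) atTop (𝓝 0) :=
      tendsto_const_nhds.div_atTop (tendsto_pow_atTop_atTop_of_one_lt (by norm_num))
    have l2 : Tendsto (fun n => e (φ n)) atTop (𝓝 0) := H.lim.comp hP.mono.tendsto_atTop
    have := ((hrem.const_mul muStar).add l2).add ((l1.const_mul (2 * C0)).const_mul (K:ℝ))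
    simpa using this
  · refine part_iv H hP hK2 hRpos hnull hrem (fun n j k hjk => by linarith [hsep n j k hjk]) fun n => ?_
    refine (hall n).1.2.trans (one_div_le_one_div_of_le (by positivity) (by linarith))

end
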